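/- (Change-of-pole / comparison for elliptic measure) In the same setting, there exists C such that for every ball B = B(x,r) centered on Γ, every Borel set E ⊂ B ∩ Γ, and every X ∈ Ω \ 2B: C⁻¹ ω^{A_B}(E) ≤ ω^X(E)/ω^X(Γ ∩ B) ≤ C ω^{A_B}(E), where A_B is a corkscrew point for (x,r). -/

import Mathlib

open MeasureTheory Metric Set Filter
open scoped ENNReal Topology

namespace EM
open scoped NNReal
open ENNReal (ofReal ofReal_add ofReal_coe_nnreal ofReal_eq_zero ofReal_le_ofReal ofReal_le_ofReal_iff ofReal_lt_top ofReal_mul ofReal_natCast ofReal_ne_top ofReal_ofNat ofReal_of_nonpos ofReal_one ofReal_pow ofReal_toReal ofReal_tsum_of_nonneg ofReal_zero)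
abbrev Eu (n : ℕ) := EuclideanSpace ℝ (Fin n)

structure AR (n : ℕ) (d C₀ : ℝ) (Γ : Set (Eu n)) : Prop where
  hd0 : 0 ≤ d
  hd : d < (n : ℝ) - 1
  hC : 0 < C₀
  cl : IsClosed Γ
  ne : Γ.Nonempty
  ar : ∀ x ∈ Γ, ∀ r : ℝ, 0 < r →
      ofReal (C₀⁻¹ * r ^ d) ≤ μH[d] (Γ ∩ ball x r) ∧
      μH[d] (Γ ∩ ball x r) ≤ ofReal (C₀ * r ^ d)

variable {n : ℕ} {d C₀ : ℝ} {Γ : Set (Eu n)}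

noncomputable def sg (d : ℝ) (Γ : Set (Eu n)) : Measure (Eu n) := (μH[d]).restrict Γ
noncomputable def wt (d : ℝ) (Γ : Set (Eu n)) (X : Eu n) : ℝ := infDist X Γ ^ (d + 1 - (n : ℝ))
noncomputable def mm (d : ℝ) (Γ : Set (Eu n)) : Measure (Eu n) :=
  volume.withDensity fun X => ofReal (wt d Γ X)

lemma AR.two (h : AR n d C₀ Γ) : 2 ≤ n := by
  have h1 := h.hd0; have h2 := h.hd
  have : (1 : ℝ) < n := by linarith
  exact_mod_cast this

lemma AR.pos (h : AR n d C₀ Γ) {X : Eu n} (hX : X ∉ Γ) : 0 < infDist X Γ :=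
  (h.cl.notMem_iff_infDist_pos h.ne).1 hX

lemma AR.near (h : AR n d C₀ Γ) (X : Eu n) : ∃ z ∈ Γ, dist X z = infDist X Γ := by
  obtain ⟨z, hz, h1⟩ := h.cl.exists_infDist_eq_dist h.ne X
  exact ⟨z, hz, h1.symm⟩

lemma meas_wt : Measurable (wt d Γ) := by unfold wt; fun_prop

lemma sg_apply {s : Set (Eu n)} (hs : MeasurableSet s) : sg d Γ s = μH[d] (Γ ∩ s) := by
  rw [sg, Measure.restrict_apply hs, inter_comm]

lemma AR.sg_ge (h : AR n d C₀ Γ) {x : Eu n} (hx : x ∈ Γ) {r : ℝ} (hr : 0 < r) :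
    ofReal (C₀⁻¹ * r ^ d) ≤ sg d Γ (ball x r) := by
  rw [sg_apply measurableSet_ball]; exact (h.ar x hx r hr).1

lemma AR.sg_le (h : AR n d C₀ Γ) (X : Eu n) {r : ℝ} (hr : 0 < r) :
    sg d Γ (ball X r) ≤ ofReal (C₀ * (2 * r) ^ d) := by
  rw [sg_apply measurableSet_ball]
  rcases (Γ ∩ ball X r).eq_empty_or_nonempty with h0 | ⟨z, hz, hzb⟩
  · rw [h0]; simp
  · refine le_trans (measure_mono ?_) (h.ar z hz (2 * r) (by positivity)).2
    refine inter_subset_inter_right _ fun y hy => ?_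
    have := dist_triangle_right y z X
    rw [mem_ball] at *; linarith

lemma AR.locfin (h : AR n d C₀ Γ) : IsLocallyFiniteMeasure (sg d Γ) :=
  ⟨fun x => ⟨ball x 1, ball_mem_nhds _ one_pos,
    (h.sg_le x one_pos).trans_lt ofReal_lt_top⟩⟩

lemma sg_ae : ∀ᵐ y ∂(sg d Γ), IsClosed Γ → y ∈ Γ := by
  by_cases hc : IsClosed Γ
  · filter_upwards [ae_restrict_mem (μ := μH[d]) hc.measurableSet] with y hy _ using hy
  · exact Eventually.of_forall fun y h => absurd h hc

lemma meas_kern (X : Eu n) (p : ℝ) : Measurable fun y : Eu n => ofReal (‖X - y‖ ^ p) := by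
  fun_prop

lemma AR.kern_upper (h : AR n d C₀ Γ) {p : ℝ} (hp : d < p) : ∃ C : ℝ≥0, ∀ X ∉ Γ,
    ∫⁻ y, ofReal (‖X - y‖ ^ (-p)) ∂(sg d Γ) ≤ C * ofReal (infDist X Γ ^ (d - p)) := by
  set q : ℝ := 2 ^ (d - p) with hq
  have hq0 : 0 < q := by positivity
  have hq1 : q < 1 := Real.rpow_lt_one_of_one_lt_of_neg one_lt_two (by linarith)
  have hsum : Summable fun k : ℕ => q ^ k := summable_geometric_of_lt_one hq0.le hq1
  refine ⟨Real.toNNReal (C₀ * 4 ^ d * ∑' k : ℕ, q ^ k), fun X hX => ?_⟩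
  set δ := infDist X Γ with hδ
  have hδ0 : 0 < δ := h.pos hX
  have hC := h.hC
  have key : ∀ y ∈ Γ, ofReal (‖X - y‖ ^ (-p)) ≤
      ∑' k : ℕ, (ball X (2 ^ (k + 1) * δ)).indicator
        (fun _ => ofReal ((2 ^ k * δ) ^ (-p))) y := by
    intro y hy
    have h1 : δ ≤ ‖X - y‖ := by rw [← dist_eq_norm]; exact infDist_le_dist_of_mem hy
    obtain ⟨k, hk1, hk2⟩ := exists_nat_pow_near (x := ‖X - y‖ / δ) (y := 2)
      ((one_le_div hδ0).2 h1) one_lt_two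
    rw [le_div_iff₀ hδ0] at hk1
    rw [div_lt_iff₀ hδ0] at hk2
    refine le_trans ?_ (ENNReal.le_tsum k)
    rw [indicator_of_mem (by rwa [mem_ball', dist_eq_norm])]
    exact ofReal_le_ofReal
      (Real.rpow_le_rpow_of_nonpos (by positivity) hk1 (by linarith [h.hd0]))
  calc ∫⁻ y, ofReal (‖X - y‖ ^ (-p)) ∂(sg d Γ)
      ≤ ∫⁻ y, ∑' k : ℕ, (ball X (2 ^ (k + 1) * δ)).indicator
        (fun _ => ofReal ((2 ^ k * δ) ^ (-p))) y ∂(sg d Γ) :=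
        lintegral_mono_ae (by filter_upwards [sg_ae] with y hy using key y (hy h.cl))
    _ = ∑' k : ℕ, ofReal ((2 ^ k * δ) ^ (-p)) * sg d Γ (ball X (2 ^ (k + 1) * δ)) := by
        rw [lintegral_tsum fun k => (measurable_const.indicator measurableSet_ball).aemeasurable]
        simp_rw [lintegral_indicator_const measurableSet_ball]
    _ ≤ ∑' k : ℕ, ofReal (C₀ * 4 ^ d * δ ^ (d - p) * q ^ k) := by
        refine ENNReal.tsum_le_tsum fun k => ?_
        refine (mul_le_mul_right (h.sg_le X (by positivity)) _).trans ?_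
        rw [← ofReal_mul (by positivity)]
        refine ofReal_le_ofReal (le_of_eq ?_)
        have e1 : (2 : ℝ) * (2 ^ (k + 1) * δ) = 4 * (2 ^ k * δ) := by ring
        have e2 : q ^ k = (2 ^ k : ℝ) ^ (d - p) := by
          rw [hq, ← Real.rpow_natCast, ← Real.rpow_natCast, ← Real.rpow_mul (by norm_num),
            ← Real.rpow_mul (by norm_num), mul_comm]
        rw [e1, e2, Real.mul_rpow (x := 4) (by norm_num) (by positivity)]
        have e3 : (2 ^ k * δ) ^ (-p) * (2 ^ k * δ) ^ d = δ ^ (d - p) * (2 ^ k : ℝ) ^ (d - p) := by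
          rw [← Real.rpow_add (by positivity), ← Real.mul_rpow (by positivity) (by positivity)]
          congr 1 <;> ring
        linear_combination C₀ * 4 ^ d * e3
    _ = _ := by
        rw [← ofReal_tsum_of_nonneg (fun k => by positivity) (hsum.mul_left _), tsum_mul_left,
          ENNReal.ofNNReal_toNNReal, ← ofReal_mul
            (mul_nonneg (by positivity) (tsum_nonneg fun k => by positivity))]
        congr 1; ring

lemma AR.kern_lower (h : AR n d C₀ Γ) {p : ℝ} (hp : 0 ≤ p) : ∃ C : ℝ≥0, ∀ X ∉ Γ,
    ofReal (infDist X Γ ^ (d - p)) ≤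
      C * ∫⁻ y in ball X (2 * infDist X Γ), ofReal (‖X - y‖ ^ (-p)) ∂(sg d Γ) := by
  have hC := h.hC
  refine ⟨Real.toNNReal (C₀ * 2 ^ p), fun X hX => ?_⟩
  obtain ⟨z, hz, hzd⟩ := h.near X
  set δ := infDist X Γ with hδ
  have hδ0 : 0 < δ := h.pos hX
  have hsub : ball z δ ⊆ ball X (2 * δ) := fun y hy => by
    have := dist_triangle y z X
    rw [mem_ball] at *; rw [dist_comm z X] at this; linarith
  have h1 : ofReal ((2 * δ) ^ (-p)) * ofReal (C₀⁻¹ * δ ^ d) ≤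
      ∫⁻ y in ball X (2 * δ), ofReal (‖X - y‖ ^ (-p)) ∂(sg d Γ) := by
    calc _ ≤ ofReal ((2 * δ) ^ (-p)) * sg d Γ (ball z δ) :=
          mul_le_mul_right (h.sg_ge hz hδ0) _
      _ = ∫⁻ y in ball z δ, ofReal ((2 * δ) ^ (-p)) ∂(sg d Γ) := by
          rw [setLIntegral_const]
      _ ≤ ∫⁻ y in ball z δ, ofReal (‖X - y‖ ^ (-p)) ∂(sg d Γ) := by
          refine setLIntegral_mono_ae (meas_kern X _).aemeasurable ?_
          filter_upwards [sg_ae] with y hy hyb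
          have h2 : δ ≤ ‖X - y‖ := by
            rw [← dist_eq_norm]; exact infDist_le_dist_of_mem (hy h.cl)
          have h3 : ‖X - y‖ ≤ 2 * δ := by
            rw [← dist_eq_norm, dist_comm]; exact (hsub hyb).le
          exact ofReal_le_ofReal
            (Real.rpow_le_rpow_of_nonpos (by linarith) h3 (by linarith))
      _ ≤ _ := lintegral_mono_set hsub
  refine le_trans (le_of_eq ?_) (mul_le_mul_right h1 _)
  rw [ENNReal.ofNNReal_toNNReal, ← ofReal_mul (by positivity),
    ← ofReal_mul (by positivity)]
  congr 1
  rw [Real.mul_rpow (by norm_num) hδ0.le, Real.rpow_neg (by norm_num : (0:ℝ) ≤ 2),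
    show d - p = d + -p by ring, Real.rpow_add hδ0]
  field_simp

lemma scal (f : Eu n → ℝ≥0∞) (y : Eu n) {t : ℝ} (ht : 0 < t) :
    ∫⁻ Z, f (y + t • Z) = ofReal ((t ^ n)⁻¹) * ∫⁻ Z, f Z := by
  have h1 := Measure.map_addHaar_smul (volume : Measure (Eu n)) ht.ne'
  have h2 : ∫⁻ Z, f (y + t • Z) = ∫⁻ Z, f (y + Z) ∂(Measure.map (t • ·) volume) :=
    (lintegral_map_equiv (fun Z => f (y + Z)) (Homeomorph.smulOfNeZero t ht.ne').toMeasurableEquiv).symm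
  rw [h2, h1, lintegral_smul_measure, lintegral_add_left_eq_self (fun Z => f Z) y]
  simp [abs_of_pos ht]

lemma vball (y : Eu n) {r : ℝ} (hr : 0 < r) :
    volume (ball y r) = ofReal (r ^ n) * volume (ball (0 : Eu n) 1) := by
  rw [Measure.addHaar_ball_of_pos _ _ hr]; simp

lemma kern_leb (hn : 2 ≤ n) : ∃ C : ℝ≥0, ∀ (z : Eu n) (R : ℝ), 0 < R →
    ∫⁻ X in ball z R, ofReal (‖X - z‖ ^ (1 - (n : ℝ))) ≤ C * ofReal R := by
  have hfin : ∫⁻ X in ball (0 : Eu n) 1, ofReal (‖X‖ ^ (1 - (n : ℝ))) ≠ ∞ := by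
    have : Nontrivial (Eu n) := Module.nontrivial_of_finrank_pos (R := ℝ) (by simp; omega)
    have := (integrableOn_fun_norm_addHaar (volume : Measure (Eu n)) (r := 1)
      (f := fun s : ℝ => s ^ (1 - (n : ℝ)))).2 ?_
    · exact (this.lintegral_lt_top).ne
    · have : IntegrableOn (fun _ : ℝ => (1 : ℝ)) (Ioo 0 1) := by simp
      refine this.congr_fun (fun s hs => ?_) measurableSet_Ioo
      simp only [smul_eq_mul, finrank_euclideanSpace, Fintype.card_fin]
      rw [← Real.rpow_natCast s (n - 1), ← Real.rpow_add hs.1, Nat.cast_sub (by omega)]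
      simp
  lift (∫⁻ X in ball (0 : Eu n) 1, ofReal (‖X‖ ^ (1 - (n : ℝ)))) to ℝ≥0 using hfin with C hC
  refine ⟨C, fun z R hR => le_of_eq ?_⟩
  have h1 := scal (fun X : Eu n => (ball z R).indicator
    (fun X => ofReal (‖X - z‖ ^ (1 - (n : ℝ)))) X) z hR
  rw [lintegral_indicator measurableSet_ball] at h1
  have h2 : ∀ Z : Eu n, (ball z R).indicator
      (fun X => ofReal (‖X - z‖ ^ (1 - (n : ℝ)))) (z + R • Z) =
      ofReal (R ^ (1 - (n : ℝ))) * (ball (0 : Eu n) 1).indicator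
      (fun X => ofReal (‖X‖ ^ (1 - (n : ℝ)))) Z := by
    intro Z
    have : (z + R • Z ∈ ball z R) ↔ Z ∈ ball (0 : Eu n) 1 := by
      simp [norm_smul, abs_of_pos hR, hR]
    by_cases hZ : Z ∈ ball (0 : Eu n) 1
    · rw [indicator_of_mem hZ, indicator_of_mem (this.2 hZ), ← ofReal_mul (by positivity),
        add_sub_cancel_left, norm_smul, Real.mul_rpow (by positivity) (by positivity),
        Real.norm_of_nonneg hR.le]
    · rw [indicator_of_notMem hZ, indicator_of_notMem (fun h => hZ (this.1 h)), mul_zero]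
  simp_rw [h2] at h1
  rw [lintegral_const_mul _ (Measurable.indicator (by fun_prop) measurableSet_ball),
    lintegral_indicator measurableSet_ball, ← hC] at h1
  have h3 : ofReal (R ^ n) * ofReal ((R ^ n)⁻¹) = 1 := by
    rw [← ofReal_mul (by positivity), mul_inv_cancel₀ (by positivity)]; simp
  rw [← one_mul (lintegral _ _), ← h3, mul_assoc, ← h1, ← mul_assoc, mul_comm (C : ℝ≥0∞),
    ← ofReal_mul (by positivity), ← Real.rpow_natCast, ← Real.rpow_add hR]
  simp

lemma AR.nbhd (h : AR n d C₀ Γ) : ∃ C : ℝ≥0, ∀ (x : Eu n) (η R : ℝ), 0 < η → η ≤ R →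
    volume ({X | infDist X Γ < η} ∩ ball x R) ≤ C * ofReal (η ^ (n - d) * R ^ d) := by
  have hC := h.hC
  have := h.locfin
  refine ⟨Real.toNNReal (C₀ * 2 ^ n * C₀ * 6 ^ d) * (volume (ball (0 : Eu n) 1)).toNNReal,
    fun x η R hη hR => ?_⟩
  have hR0 : 0 < R := hη.trans_le hR
  set S := {X | infDist X Γ < η} ∩ ball x R with hS
  have hSm : MeasurableSet S := (measurableSet_lt (by fun_prop) measurable_const).inter measurableSet_ball
  have key : ∀ X ∈ S, (1 : ℝ≥0∞) ≤ ofReal (C₀ * η ^ (-d)) * sg d Γ (ball X (2 * η)) := by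
    rintro X ⟨hX, -⟩
    obtain ⟨z, hz, hzd⟩ := h.near X
    have hsub : ball z η ⊆ ball X (2 * η) := fun y hy => by
      have := dist_triangle y z X
      rw [mem_ball] at *; rw [dist_comm z X, hzd] at this
      have hX' : infDist X Γ < η := hX
      linarith
    refine le_trans (le_of_eq ?_) (mul_le_mul_right ((h.sg_ge hz hη).trans (measure_mono hsub)) _)
    rw [← ofReal_mul (by positivity), Real.rpow_neg hη.le]
    field_simp; simp
  have hm : Measurable fun q : Eu n × Eu n => (ball q.1 (2 * η)).indicator (1 : Eu n → ℝ≥0∞) q.2 := by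
    have : MeasurableSet {q : Eu n × Eu n | dist q.2 q.1 < 2 * η} :=
      measurableSet_lt (by fun_prop) measurable_const
    exact (measurable_one.indicator this)
  calc volume S = ∫⁻ X in S, 1 := by simp
    _ ≤ ∫⁻ X in S, ofReal (C₀ * η ^ (-d)) *
        ∫⁻ y, (ball X (2 * η)).indicator (1 : Eu n → ℝ≥0∞) y ∂(sg d Γ) := by
        refine setLIntegral_mono' hSm fun X hX => ?_
        rw [lintegral_indicator_one measurableSet_ball]; exact key X hX
    _ = ofReal (C₀ * η ^ (-d)) * ∫⁻ y, (∫⁻ X in S,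
        (ball X (2 * η)).indicator (1 : Eu n → ℝ≥0∞) y) ∂(sg d Γ) := by
        rw [lintegral_const_mul _ hm.lintegral_prod_right', lintegral_lintegral_swap hm.aemeasurable]
    _ ≤ ofReal (C₀ * η ^ (-d)) * ∫⁻ y, (ball x (3 * R)).indicator
        (fun _ => ofReal ((2 * η) ^ n) * volume (ball (0 : Eu n) 1)) y ∂(sg d Γ) := by
        gcongr with y
        by_cases hy : y ∈ ball x (3 * R)
        · rw [indicator_of_mem hy, ← vball y (by positivity)]
          have : ∀ X : Eu n, (ball X (2 * η)).indicator (1 : Eu n → ℝ≥0∞) y =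
              (ball y (2 * η)).indicator 1 X := fun X => by
            simp only [indicator, mem_ball, dist_comm]; rfl
          simp_rw [this]
          rw [← lintegral_indicator_one measurableSet_ball]
          exact setLIntegral_le_lintegral _ _
        · rw [indicator_of_notMem hy]
          refine le_of_eq ((setLIntegral_congr_fun hSm fun X hX => ?_).trans lintegral_zero)
          refine indicator_of_notMem (fun hy2 => hy ?_) _
          have := dist_triangle y X x
          have h3 : dist X x < R := hX.2
          rw [mem_ball] at *; linarith
    _ ≤ ofReal (C₀ * η ^ (-d)) * (ofReal ((2 * η) ^ n) * volume (ball (0 : Eu n) 1)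
          * ofReal (C₀ * (2 * (3 * R)) ^ d)) := by
        rw [lintegral_indicator_const measurableSet_ball]
        gcongr
        exact h.sg_le x (by positivity)
    _ = _ := by
        rw [ENNReal.coe_mul, ENNReal.ofNNReal_toNNReal, ENNReal.coe_toNNReal measure_ball_lt_top.ne]
        have e : C₀ * η ^ (-d) * ((2 * η) ^ n * (C₀ * (2 * (3 * R)) ^ d)) =
            C₀ * 2 ^ n * C₀ * 6 ^ d * (η ^ (n - d) * R ^ d) := by
          rw [show (2 : ℝ) * (3 * R) = 6 * R by ring, Real.mul_rpow (by norm_num) hR0.le,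
            show (n : ℝ) - d = -d + n by ring, Real.rpow_add hη, Real.rpow_natCast, mul_pow]
          ring
        calc _ = ofReal (C₀ * η ^ (-d)) * (ofReal ((2 * η) ^ n) *
              ofReal (C₀ * (2 * (3 * R)) ^ d)) * volume (ball (0 : Eu n) 1) := by ring
          _ = _ := by
            rw [← ofReal_mul (by positivity), ← ofReal_mul (by positivity), e,
              ofReal_mul (by positivity)]; ring

lemma small_rpow (C : ℝ≥0) {a : ℝ≥0∞} (ha : a ≠ 0) {p : ℝ} (hp : 0 < p) {b : ℝ} (hb : 0 < b) :
    ∃ c : ℝ, 0 < c ∧ c ≤ b ∧ C * ofReal (c ^ p) < a := by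
  have h1 : Tendsto (fun c : ℝ => (C : ℝ≥0∞) * ofReal (c ^ p)) (𝓝[>] 0) (𝓝 0) := by
    have : Tendsto (fun c : ℝ => c ^ p) (𝓝[>] 0) (𝓝 0) := by
      have := (Real.continuousAt_rpow_const 0 p (Or.inr hp.le)).tendsto
      rw [Real.zero_rpow hp.ne'] at this
      exact this.mono_left nhdsWithin_le_nhds
    have h2 := ENNReal.Tendsto.const_mul (a := (C : ℝ≥0∞)) (ENNReal.tendsto_ofReal this)
      (Or.inr ENNReal.coe_ne_top)
    simpa using h2
  have h2 := (h1.eventually_lt_const (pos_iff_ne_zero.2 ha)).and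
    ((eventually_mem_nhdsWithin).and (nhdsWithin_le_nhds (eventually_le_nhds hb)))
  obtain ⟨c, h3, h4, h5⟩ := h2.exists
  exact ⟨c, h4, h5, h3⟩

lemma v1pos : volume (ball (0 : Eu n) 1) ≠ 0 := (measure_ball_pos _ _ one_pos).ne'

lemma AR.null (h : AR n d C₀ Γ) : volume Γ = 0 := by
  obtain ⟨C, hC⟩ := h.nbhd
  have hnd : 0 < (n : ℝ) - d := by linarith [h.hd]
  have h1 : ∀ k : ℕ, volume (Γ ∩ ball 0 (k + 1)) = 0 := by
    intro k
    by_contra hne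
    obtain ⟨c, hc0, hc1, hc2⟩ := small_rpow (C * Real.toNNReal ((k + 1 : ℝ) ^ d)) hne hnd one_pos
    have h2 := hC 0 c (k + 1) hc0 (by have : (0:ℝ) ≤ k := by positivity
                                      linarith)
    refine absurd hc2 (not_lt.2 ?_)
    refine le_trans (measure_mono (inter_subset_inter_left _ fun x hx => ?_)) (h2.trans (le_of_eq ?_))
    · simpa [infDist_zero_of_mem hx] using hc0
    · rw [ENNReal.coe_mul, ENNReal.ofNNReal_toNNReal, ofReal_mul (by positivity)]; ring
  have h2 : Γ = ⋃ k : ℕ, Γ ∩ ball 0 (k + 1) := by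
    rw [← inter_iUnion, inter_eq_left.2]
    intro x _
    obtain ⟨k, hk⟩ := exists_nat_gt ‖x‖
    exact mem_iUnion.2 ⟨k, by rw [mem_ball_zero_iff]; linarith⟩
  rw [h2, measure_iUnion_null_iff]; exact h1

lemma AR.wt0 (h : AR n d C₀ Γ) {X : Eu n} (hX : X ∈ Γ) : wt d Γ X = 0 := by
  rw [wt, infDist_zero_of_mem hX, Real.zero_rpow (by linarith [h.hd])]

lemma AR.wtpos (h : AR n d C₀ Γ) {X : Eu n} (hX : X ∉ Γ) : 0 < wt d Γ X :=
  Real.rpow_pos_of_pos (h.pos hX) _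

lemma AR.mball (h : AR n d C₀ Γ) : ∃ C : ℝ≥0, ∀ y ∈ Γ, ∀ ρ : ℝ, 0 < ρ →
    mm d Γ (ball y ρ) ≤ C * ofReal (ρ ^ (d + 1)) := by
  have hC0 := h.hC
  have := h.locfin
  have hn : (2 : ℝ) ≤ n := by exact_mod_cast h.two
  obtain ⟨C₁, h1⟩ := h.kern_lower (p := n - 1) (by linarith)
  obtain ⟨C₂, h2⟩ := kern_leb h.two
  refine ⟨C₁ * (C₂ * Real.toNNReal (4 * C₀ * 6 ^ d)), fun y hy ρ hρ => ?_⟩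
  have hm : Measurable fun q : Eu n × Eu n => ofReal (‖q.1 - q.2‖ ^ (-((n : ℝ) - 1))) := by
    fun_prop
  rw [mm, withDensity_apply _ measurableSet_ball]
  calc ∫⁻ X in ball y ρ, ofReal (wt d Γ X)
      ≤ ∫⁻ X in ball y ρ, C₁ * ∫⁻ z in ball y (3 * ρ),
          ofReal (‖X - z‖ ^ (-((n : ℝ) - 1))) ∂(sg d Γ) := by
        refine setLIntegral_mono' measurableSet_ball fun X hX => ?_
        by_cases hXG : X ∈ Γ
        · rw [h.wt0 hXG]; simp
        · have e : wt d Γ X = infDist X Γ ^ (d - ((n : ℝ) - 1)) := by rw [wt]; congr 1; ring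
          rw [e]
          refine (h1 X hXG).trans ?_
          refine mul_le_mul_right (lintegral_mono_set fun z hz => ?_) _
          have h3 := infDist_le_dist_of_mem (x := X) hy
          have h4 := dist_triangle z X y
          rw [mem_ball] at *; linarith
    _ = C₁ * ∫⁻ z in ball y (3 * ρ), (∫⁻ X in ball y ρ,
          ofReal (‖X - z‖ ^ (-((n : ℝ) - 1)))) ∂(sg d Γ) := by
        rw [lintegral_const_mul _ hm.lintegral_prod_right', lintegral_lintegral_swap hm.aemeasurable]
    _ ≤ C₁ * ∫⁻ z in ball y (3 * ρ), (C₂ * ofReal (4 * ρ)) ∂(sg d Γ) := by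
        refine mul_le_mul_right (setLIntegral_mono' measurableSet_ball fun z hz => ?_) _
        refine le_trans ?_ (h2 z (4 * ρ) (by positivity))
        rw [neg_sub]
        refine lintegral_mono_set fun X hX => ?_
        have h4 := dist_triangle_right X z y
        rw [mem_ball] at *; linarith
    _ ≤ C₁ * (C₂ * ofReal (4 * ρ) * ofReal (C₀ * (2 * (3 * ρ)) ^ d)) := by
        rw [setLIntegral_const]
        gcongr
        exact h.sg_le y (by positivity)
    _ = _ := by
        rw [ENNReal.coe_mul, ENNReal.coe_mul, ENNReal.ofNNReal_toNNReal, mul_assoc, mul_assoc, mul_assoc,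
          ← ofReal_mul (by positivity), ← ofReal_mul (by positivity),
          show (2 : ℝ) * (3 * ρ) = 6 * ρ by ring, Real.mul_rpow (by norm_num) hρ.le,
          Real.rpow_add hρ, Real.rpow_one]
        congr 2; congr 1; ring

lemma AR.cork (h : AR n d C₀ Γ) : ∃ c : ℝ, 0 < c ∧ c ≤ 1 ∧ ∀ (x : Eu n) (s : ℝ), 0 < s →
    ∃ Z ∈ ball x s, c * s ≤ infDist Z Γ := by
  obtain ⟨C, hC⟩ := h.nbhd
  obtain ⟨c, hc0, hc1, hc2⟩ := small_rpow C (v1pos (n := n)) (p := n - d) (by linarith [h.hd]) one_pos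
  refine ⟨c, hc0, hc1, fun x s hs => ?_⟩
  by_contra! hcon
  have h1 := hC x (c * s) s (by positivity) (by nlinarith)
  rw [inter_eq_right.2 (show ball x s ⊆ {X | infDist X Γ < c * s} from fun Z hZ => hcon Z hZ), vball x hs, Real.mul_rpow hc0.le hs.le, mul_assoc,
    ← Real.rpow_add hs, sub_add_cancel, Real.rpow_natCast, ofReal_mul (by positivity)] at h1
  refine absurd h1 (not_le.2 ?_)
  rw [← mul_assoc, mul_comm _ (ofReal (s ^ n))]
  exact ENNReal.mul_lt_mul_right (by simp; positivity) ofReal_ne_top hc2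

lemma AR.chain (h : AR n d C₀ Γ) {ε K : ℝ} (hε : 0 < ε) (hK : 0 < K) : ∃ ε' : ℝ, 0 < ε' ∧
    ∀ (s : ℝ) (X Y : Eu n), 0 < s → dist X Y ≤ K * s → ∃ z : Eu n, ‖z‖ < ε * s ∧
      ∀ t : ℝ, t ∈ Icc 0 1 → ε' * s ≤ infDist (X + z + t • (Y - X)) Γ := by
  obtain ⟨C, hC⟩ := h.nbhd
  have hd := h.hd
  obtain ⟨b, hb0, hb1, hb2⟩ := small_rpow (C * Real.toNNReal (2 * (K + 2) * ε ^ (d - n)))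
    (v1pos (n := n)) (p := n - d - 1) (by linarith) (lt_min hε one_pos)
  refine ⟨b / 2, by positivity, fun s X Y hs hXY => ?_⟩
  have hbε : b ≤ ε := hb1.trans (min_le_left _ _)
  have hb1' : b ≤ 1 := hb1.trans (min_le_right _ _)
  set N := ⌈K / (b / 2)⌉₊ with hN
  have hN0 : 0 < (N : ℝ) := by
    have : 0 < N := Nat.ceil_pos.2 (by positivity)
    exact_mod_cast this
  have hN1 : K / (b / 2) ≤ N := Nat.le_ceil _
  have hN2 : (N : ℝ) < K / (b / 2) + 1 := Nat.ceil_lt_add_one (by positivity)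
  let P : ℕ → Eu n := fun k => X + ((k : ℝ) / N) • (Y - X)
  have hb : ∀ k, volume {z ∈ ball (0 : Eu n) (ε * s) | infDist (P k + z) Γ < b * s} ≤
      C * ofReal ((b * s) ^ (n - d) * (ε * s) ^ d) := by
    intro k
    refine le_trans (le_of_eq ?_) (hC (P k) (b * s) (ε * s) (by positivity) (by gcongr))
    have : {z ∈ ball (0 : Eu n) (ε * s) | infDist (P k + z) Γ < b * s} =
        (P k + ·) ⁻¹' ({X | infDist X Γ < b * s} ∩ ball (P k) (ε * s)) := by
      ext z; simp [and_comm]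
    rw [this, measure_preimage_add]
  have hex : ∃ z ∈ ball (0 : Eu n) (ε * s), ∀ k ∈ Finset.range (N + 1), b * s ≤ infDist (P k + z) Γ := by
    by_contra! hcon
    have h1 : volume (ball (0 : Eu n) (ε * s)) ≤
        ∑ k ∈ Finset.range (N + 1), C * ofReal ((b * s) ^ (n - d) * (ε * s) ^ d) := by
      refine le_trans (measure_mono fun z hz => ?_) ((measure_biUnion_finset_le (Finset.range (N + 1))
        (fun k => {z ∈ ball (0 : Eu n) (ε * s) | infDist (P k + z) Γ < b * s})).trans
        (Finset.sum_le_sum fun k _ => hb k))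
      obtain ⟨k, hk, hk2⟩ := hcon z hz
      exact mem_biUnion hk ⟨hz, hk2⟩
    rw [Finset.sum_const, Finset.card_range, vball _ (by positivity), nsmul_eq_mul] at h1
    refine absurd h1 (not_le.2 ?_)
    have h2 := ENNReal.mul_lt_mul_right (a := ofReal ((ε * s) ^ n)) (by simp; positivity)
      ofReal_ne_top hb2
    refine lt_of_le_of_lt ?_ h2
    rw [ENNReal.coe_mul, ENNReal.ofNNReal_toNNReal, ← ofReal_natCast, mul_left_comm,
      mul_left_comm _ (_ * _), mul_assoc (C : ℝ≥0∞)]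
    refine mul_le_mul_right ?_ _
    rw [← ofReal_mul (by positivity), ← ofReal_mul (by positivity),
      ← ofReal_mul (by positivity), mul_left_comm]
    refine ofReal_le_ofReal ?_
    have e1 : (b * s) ^ ((n : ℝ) - d) * (ε * s) ^ d = b * b ^ ((n : ℝ) - d - 1) * ε ^ (d - n) * (ε * s) ^ n := by
      rw [Real.mul_rpow hb0.le hs.le, Real.mul_rpow hε.le hs.le, mul_pow, ← Real.rpow_natCast ε,
        ← Real.rpow_natCast s]
      have e2 : b ^ ((n : ℝ) - d) = b * b ^ ((n : ℝ) - d - 1) := by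
        rw [← Real.rpow_one_add' hb0.le (by linarith)]; congr 1; ring
      have e3 : s ^ (n : ℝ) = s ^ ((n : ℝ) - d) * s ^ d := by
        rw [← Real.rpow_add hs]; congr 1; ring
      have e4 : ε ^ d = ε ^ (d - n) * ε ^ (n : ℝ) := by
        rw [← Real.rpow_add hε]; congr 1; ring
      rw [e2, e3, e4]; ring
    rw [mul_left_comm, e1]
    have e5 : ((N + 1 : ℕ) : ℝ) * b ≤ 2 * (K + 2) := by
      push_cast
      have : K / (b / 2) * b = 2 * K := by field_simp
      nlinarith
    calc _ = ((N + 1 : ℕ) : ℝ) * b * (b ^ ((n : ℝ) - d - 1) * ε ^ (d - n) * (ε * s) ^ n) := by ring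
      _ ≤ 2 * (K + 2) * (b ^ ((n : ℝ) - d - 1) * ε ^ (d - n) * (ε * s) ^ n) := by gcongr
      _ = _ := by ring
  obtain ⟨z, hz, hzk⟩ := hex
  refine ⟨z, by simpa using hz, fun t ht => ?_⟩
  set k := ⌊t * N⌋₊ with hk
  have hk1 : (k : ℝ) ≤ t * N := Nat.floor_le (by have := ht.1; positivity)
  have hk2 : t * N < k + 1 := Nat.lt_floor_add_one _
  have hkN : k ∈ Finset.range (N + 1) := by
    rw [Finset.mem_range]
    have : (k : ℝ) ≤ N := hk1.trans (by nlinarith [ht.2])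
    have : k ≤ N := by exact_mod_cast this
    omega
  have h1 := hzk k hkN
  have h2 := infDist_le_infDist_add_dist (s := Γ) (x := P k + z) (y := X + z + t • (Y - X))
  have h3 : dist (P k + z) (X + z + t • (Y - X)) ≤ b / 2 * s := by
    have : P k + z - (X + z + t • (Y - X)) = ((k : ℝ) / N - t) • (Y - X) := by
      simp only [P]; rw [sub_smul]; abel
    rw [dist_eq_norm, this, norm_smul]
    have hYX : ‖Y - X‖ ≤ K * s := by rw [← dist_eq_norm, dist_comm]; exact hXY
    have h4 : ‖(k : ℝ) / N - t‖ ≤ 1 / N := by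
      rw [Real.norm_eq_abs, abs_le]
      constructor
      · have : t - k / N ≤ 1 / N := by
          rw [sub_le_iff_le_add, ← add_div, le_div_iff₀ hN0]; linarith
        linarith
      · have : (k : ℝ) / N ≤ t := by rw [div_le_iff₀ hN0]; exact hk1
        have : 0 ≤ 1 / (N : ℝ) := by positivity
        linarith
    calc _ ≤ 1 / N * (K * s) := by gcongr
      _ ≤ b / 2 * s := by
        rw [div_le_iff₀ (by positivity)] at hN1
        rw [one_div, ← mul_assoc]
        gcongr
        rw [inv_mul_le_iff₀ hN0]; linarith
  linarith

lemma ray {v : Eu n → ℝ} (hv : ContDiff ℝ 1 v) (y Z : Eu n) :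
    ‖v (y + Z) - v y‖ₑ ≤ ∫⁻ t in Ioc (0:ℝ) 1, ‖fderiv ℝ v (y + t • Z)‖ₑ * ‖Z‖ₑ := by
  have hc : Continuous fun t : ℝ => fderiv ℝ v (y + t • Z) Z :=
    ((hv.continuous_fderiv one_ne_zero).comp (by fun_prop)).clm_apply continuous_const
  have h1 : ∫ t in (0:ℝ)..1, fderiv ℝ v (y + t • Z) Z = v (y + Z) - v y := by
    have := intervalIntegral.integral_eq_sub_of_hasDerivAt (a := 0) (b := 1)
      (f := fun t : ℝ => v (y + t • Z)) (f' := fun t => fderiv ℝ v (y + t • Z) Z) (fun t _ => ?_)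
      (hc.intervalIntegrable _ _)
    · simpa using this
    · have h2 : HasDerivAt (fun t : ℝ => y + t • Z) Z t := by
        simpa using ((hasDerivAt_id t).smul_const Z).const_add y
      exact ((hv.differentiable one_ne_zero _).hasFDerivAt.comp_hasDerivAt t h2)
  rw [← h1, intervalIntegral.integral_of_le zero_le_one]
  refine (enorm_integral_le_lintegral_enorm _).trans (lintegral_mono fun t => ?_)
  exact ContinuousLinearMap.le_opENorm _ _

lemma ray_int {v : Eu n → ℝ} (hv : ContDiff ℝ 1 v) (y : Eu n) {k : Eu n → ℝ≥0∞} (hk : Measurable k) :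
    ∫⁻ X, k (X - y) * ‖v X - v y‖ₑ ≤ ∫⁻ X, ‖fderiv ℝ v X‖ₑ *
      ∫⁻ t in Ioc (0:ℝ) 1, ofReal ((t ^ n)⁻¹) * (k (t⁻¹ • (X - y)) * ‖t⁻¹ • (X - y)‖ₑ) := by
  have hv' : Measurable fun X => ‖fderiv ℝ v X‖ₑ := (hv.continuous_fderiv one_ne_zero).measurable.enorm
  have hm2 : Measurable fun q : ℝ × Eu n => q.1⁻¹ • q.2 := measurable_fst.inv.smul measurable_snd
  have hs : Measurable fun q : Eu n × ℝ => q.2 • q.1 := measurable_snd.smul measurable_fst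
  calc ∫⁻ X, k (X - y) * ‖v X - v y‖ₑ = ∫⁻ Z, k Z * ‖v (y + Z) - v y‖ₑ := by
        rw [← lintegral_add_left_eq_self _ y]; simp
    _ ≤ ∫⁻ Z, ∫⁻ t in Ioc (0:ℝ) 1, k Z * (‖fderiv ℝ v (y + t • Z)‖ₑ * ‖Z‖ₑ) := by
        refine lintegral_mono fun Z => ?_
        rw [lintegral_const_mul _ (by fun_prop)]
        exact mul_le_mul_right (ray hv y Z) _
    _ = ∫⁻ t in Ioc (0:ℝ) 1, ∫⁻ Z, k Z * (‖fderiv ℝ v (y + t • Z)‖ₑ * ‖Z‖ₑ) := by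
        refine lintegral_lintegral_swap (Measurable.aemeasurable ?_)
        exact (hk.comp measurable_fst).mul ((hv'.comp (hs.const_add y)).mul measurable_fst.enorm)
    _ = ∫⁻ t in Ioc (0:ℝ) 1, ∫⁻ W, ‖fderiv ℝ v (y + W)‖ₑ *
          (ofReal ((t ^ n)⁻¹) * (k (t⁻¹ • W) * ‖t⁻¹ • W‖ₑ)) := by
        refine setLIntegral_congr_fun measurableSet_Ioc fun t ht => ?_
        have := scal (fun W => k (t⁻¹ • W) * (‖fderiv ℝ v (y + W)‖ₑ * ‖t⁻¹ • W‖ₑ)) 0 ht.1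
        simp only [zero_add, inv_smul_smul₀ ht.1.ne'] at this
        rw [this, ← lintegral_const_mul']
        · refine lintegral_congr fun W => ?_
          ring
        · exact ofReal_ne_top
    _ = ∫⁻ W, ∫⁻ t in Ioc (0:ℝ) 1, ‖fderiv ℝ v (y + W)‖ₑ *
          (ofReal ((t ^ n)⁻¹) * (k (t⁻¹ • W) * ‖t⁻¹ • W‖ₑ)) := by
        refine lintegral_lintegral_swap (Measurable.aemeasurable ?_)
        refine (hv'.comp (measurable_snd.const_add y)).mul (Measurable.mul ?_ ((hk.comp hm2).mul hm2.enorm))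
        exact ENNReal.measurable_ofReal.comp ((measurable_fst.pow_const n).inv)
    _ = _ := by
        rw [← lintegral_add_left_eq_self (fun X => _ * _) y]
        refine lintegral_congr fun W => ?_
        rw [lintegral_const_mul]
        · simp
        · have : Measurable fun t : ℝ => t⁻¹ • W := measurable_inv.smul_const W
          exact (ENNReal.measurable_ofReal.comp ((measurable_id.pow_const n).inv)).mul
            ((hk.comp this).mul this.enorm)

lemma hardy1 {v : Eu n → ℝ} (hv : ContDiff ℝ 1 v) {y : Eu n} (hy : v y = 0) :
    ∫⁻ X, ofReal (‖X - y‖ ^ (-(n : ℝ) - 1)) * ‖v X‖ₑ ≤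
      ∫⁻ X, ‖fderiv ℝ v X‖ₑ * ofReal (‖X - y‖ ^ (-(n : ℝ))) := by
  have := ray_int hv y (k := fun Z => ofReal (‖Z‖ ^ (-(n : ℝ) - 1))) (by fun_prop)
  simp only [hy, sub_zero] at this
  refine this.trans (lintegral_mono fun X => mul_le_mul_right ?_ _)
  rcases eq_or_ne X y with rfl | hne
  · simp
  have hp : 0 < ‖X - y‖ := norm_pos_iff.2 (sub_ne_zero.2 hne)
  calc _ ≤ ∫⁻ t in Ioc (0:ℝ) 1, ofReal (‖X - y‖ ^ (-(n : ℝ))) := by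
        refine setLIntegral_mono' measurableSet_Ioc fun t ht => ?_
        have ht0 := ht.1
        rw [← ofReal_norm, ← ofReal_mul (by positivity), ← ofReal_mul (by positivity)]
        refine ofReal_le_ofReal (le_of_eq ?_)
        rw [norm_smul, Real.norm_eq_abs, abs_inv, abs_of_pos ht0]
        rw [Real.rpow_sub_one (by positivity), div_mul_cancel₀ _ (by positivity), Real.mul_rpow (by positivity) hp.le,
          Real.rpow_neg (by positivity), Real.inv_rpow ht0.le, Real.rpow_natCast, inv_inv, ← mul_assoc,
          inv_mul_cancel₀ (by positivity), one_mul]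
    _ = _ := by simp

lemma seg (hn : 2 ≤ n) {v : Eu n → ℝ} (hv : ContDiff ℝ 1 v) (y : Eu n) {ρ : ℝ} (hρ : 0 < ρ) :
    ∫⁻ X in ball y ρ, ‖v X - v y‖ₑ ≤ ofReal (ρ ^ n) *
      ∫⁻ X in ball y ρ, ‖fderiv ℝ v X‖ₑ * ofReal (‖X - y‖ ^ (1 - (n : ℝ))) := by
  have hn' : (2 : ℝ) ≤ n := by exact_mod_cast hn
  have := ray_int hv y (k := (ball 0 ρ).indicator 1) (measurable_one.indicator measurableSet_ball)
  rw [← lintegral_const_mul' _ _ ofReal_ne_top, ← lintegral_indicator measurableSet_ball,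
    ← lintegral_indicator measurableSet_ball]
  refine le_trans (le_of_eq ?_) (this.trans (lintegral_mono fun X => ?_))
  · refine lintegral_congr fun X => ?_
    by_cases h : dist X y < ρ
    · simp [indicator, h, ← dist_eq_norm]
    · simp [indicator, h, ← dist_eq_norm]
  rcases eq_or_ne X y with rfl | hne
  · simp
  have hp : 0 < ‖X - y‖ := norm_pos_iff.2 (sub_ne_zero.2 hne)
  by_cases hX : X ∈ ball y ρ
  swap
  · rw [indicator_of_notMem hX, nonpos_iff_eq_zero, mul_eq_zero]; right
    rw [setLIntegral_congr_fun (g := 0) measurableSet_Ioc, Pi.zero_def, lintegral_zero]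
    intro t ht
    have h1 : t⁻¹ • (X - y) ∉ ball (0 : Eu n) ρ := by
      rw [mem_ball_zero_iff, norm_smul, norm_inv, Real.norm_eq_abs, abs_of_pos ht.1, not_lt]
      rw [mem_ball, dist_eq_norm, not_lt] at hX
      exact hX.trans (le_mul_of_one_le_left hp.le ((one_le_inv₀ ht.1).2 ht.2))
    simp only [indicator_of_notMem h1]; simp
  rw [indicator_of_mem hX, mul_left_comm]
  refine mul_le_mul_right ?_ _
  set a := ‖X - y‖ / ρ with ha
  have ha0 : 0 < a := by positivity
  calc _ ≤ ∫⁻ t in Ioc (0:ℝ) 1, (Ioi a).indicator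
          (fun t => ofReal (‖X - y‖ * t ^ (-(n:ℝ) - 1))) t := by
        refine setLIntegral_mono' measurableSet_Ioc fun t ht => ?_
        have ht0 := ht.1
        by_cases hta : a < t
        · rw [indicator_of_mem (show t ∈ Ioi a from hta)]
          refine (mul_le_mul_right (mul_le_mul_left (indicator_le_self' (by simp) _) _) _).trans ?_
          rw [← ofReal_norm, Pi.one_apply, one_mul, ← ofReal_mul (by positivity)]
          refine ofReal_le_ofReal (le_of_eq ?_)
          rw [norm_smul, Real.norm_eq_abs, abs_inv, abs_of_pos ht0, Real.rpow_sub_one ht0.ne',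
            Real.rpow_neg ht0.le, Real.rpow_natCast]
          field_simp
        · have h1 : t⁻¹ • (X - y) ∉ ball (0 : Eu n) ρ := by
            rw [mem_ball_zero_iff, norm_smul, norm_inv, Real.norm_eq_abs, abs_of_pos ht.1, not_lt,
              le_inv_mul_iff₀ ht0]
            rw [not_lt, ha, le_div_iff₀ hρ] at hta
            exact hta
          rw [indicator_of_notMem h1]; simp
    _ ≤ ∫⁻ t in Ioi a, ofReal (‖X - y‖ * t ^ (-(n:ℝ) - 1)) := by
        rw [← lintegral_indicator measurableSet_Ioi]
        exact setLIntegral_le_lintegral _ _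
    _ = ofReal (‖X - y‖ * (-a ^ (-(n:ℝ) - 1 + 1) / (-(n:ℝ) - 1 + 1))) := by
        rw [← integral_Ioi_rpow_of_lt (by linarith) ha0, ← integral_const_mul,
          ofReal_integral_eq_lintegral_ofReal]
        · exact (integrableOn_Ioi_rpow_of_lt (by linarith) ha0).const_mul _
        · filter_upwards [ae_restrict_mem measurableSet_Ioi] with t ht
          have : 0 < t := ha0.trans ht
          simp only [Pi.zero_apply]; positivity
    _ ≤ _ := by
        rw [← ofReal_mul (by positivity)]
        refine ofReal_le_ofReal ?_
        rw [sub_add_cancel, neg_div_neg_eq, Real.rpow_neg ha0.le, Real.rpow_natCast,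
          Real.rpow_sub hp, Real.rpow_one, Real.rpow_natCast, ha, div_pow, inv_div]
        have : ρ ^ n / ‖X - y‖ ^ n / n ≤ ρ ^ n / ‖X - y‖ ^ n := div_le_self (by positivity) (by linarith)
        calc _ ≤ ‖X - y‖ * (ρ ^ n / ‖X - y‖ ^ n) := by gcongr
          _ = _ := by ring

lemma cs {α : Type*} [MeasurableSpace α] {μ : Measure α} {f g : α → ℝ≥0∞} (hf : AEMeasurable f μ)
    (hg : AEMeasurable g μ) : (∫⁻ x, f x * g x ∂μ) ^ 2 ≤ (∫⁻ x, f x ^ 2 ∂μ) * ∫⁻ x, g x ^ 2 ∂μ := by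
  have h := ENNReal.lintegral_mul_le_Lp_mul_Lq μ Real.HolderConjugate.two_two hf hg
  simp only [Pi.mul_apply, ENNReal.rpow_two] at h
  refine (pow_le_pow_left' h 2).trans (le_of_eq ?_)
  rw [mul_pow, ← ENNReal.rpow_natCast, ← ENNReal.rpow_natCast, ← ENNReal.rpow_mul, ← ENNReal.rpow_mul]
  norm_num

lemma AR.t1 (h : AR n d C₀ Γ) {p : ℝ} (hp : 0 ≤ p) : ∃ C : ℝ≥0, ∀ f : Eu n → ℝ≥0∞, Measurable f →
    ∫⁻ X, f X * ofReal (infDist X Γ ^ (d - p)) ≤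
      C * ∫⁻ y, (∫⁻ X, f X * ofReal (‖X - y‖ ^ (-p))) ∂(sg d Γ) := by
  have := h.locfin
  obtain ⟨C, hC⟩ := h.kern_lower hp
  refine ⟨C, fun f hf => ?_⟩
  have hm : Measurable fun q : Eu n × Eu n => f q.1 * ofReal (‖q.1 - q.2‖ ^ (-p)) := by fun_prop
  rw [← lintegral_lintegral_swap hm.aemeasurable, ← lintegral_const_mul _ hm.lintegral_prod_right']
  refine lintegral_mono_ae ?_
  filter_upwards [measure_eq_zero_iff_ae_notMem.1 h.null] with X hX
  rw [lintegral_const_mul _ (meas_kern X _), mul_left_comm]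
  refine mul_le_mul_right ((hC X hX).trans (mul_le_mul_right ?_ _)) _
  exact setLIntegral_le_lintegral _ _

lemma AR.t2 (h : AR n d C₀ Γ) {p : ℝ} (hp : d < p) : ∃ C : ℝ≥0, ∀ f : Eu n → ℝ≥0∞, Measurable f →
    ∫⁻ y, (∫⁻ X, f X * ofReal (‖X - y‖ ^ (-p))) ∂(sg d Γ) ≤
      C * ∫⁻ X, f X * ofReal (infDist X Γ ^ (d - p)) := by
  have := h.locfin
  obtain ⟨C, hC⟩ := h.kern_upper hp
  refine ⟨C, fun f hf => ?_⟩
  have hm : Measurable fun q : Eu n × Eu n => f q.1 * ofReal (‖q.1 - q.2‖ ^ (-p)) := by fun_prop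
  rw [← lintegral_lintegral_swap hm.aemeasurable, ← lintegral_const_mul _ (by fun_prop)]
  refine lintegral_mono_ae ?_
  filter_upwards [measure_eq_zero_iff_ae_notMem.1 h.null] with X hX
  rw [lintegral_const_mul _ (meas_kern X _), mul_left_comm]
  exact mul_le_mul_right (hC X hX) _

noncomputable def m2 (d : ℝ) (Γ : Set (Eu n)) : Measure (Eu n) :=
  volume.withDensity fun X => ofReal (infDist X Γ ^ (d - (n + 1)))

lemma int_m2 {f : Eu n → ℝ≥0∞} (hf : Measurable f) :
    ∫⁻ X, f X ∂(m2 d Γ) = ∫⁻ X, f X * ofReal (infDist X Γ ^ (d - (n + 1))) := by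
  rw [m2, lintegral_withDensity_eq_lintegral_mul _ (by fun_prop) hf]
  exact lintegral_congr fun X => mul_comm _ _

lemma int_mm {f : Eu n → ℝ≥0∞} (hf : Measurable f) :
    ∫⁻ X, f X ∂(mm d Γ) = ∫⁻ X, f X * ofReal (infDist X Γ ^ (d - (n - 1))) := by
  have := meas_wt (d := d) (Γ := Γ)
  rw [mm, lintegral_withDensity_eq_lintegral_mul _ (by fun_prop) hf]
  refine lintegral_congr fun X => ?_
  rw [Pi.mul_apply, mul_comm, wt, sub_sub_eq_add_sub]

structure CC (Γ : Set (Eu n)) (φ : Eu n → ℝ) : Prop where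
  c1 : ContDiff ℝ 1 φ
  cs : HasCompactSupport φ
  ts : tsupport φ ⊆ Γᶜ

lemma CC.meas {φ : Eu n → ℝ} (h : CC Γ φ) : Measurable fun X => ‖φ X‖ₑ := h.c1.continuous.measurable.enorm
lemma measD {φ : Eu n → ℝ} (h : ContDiff ℝ 1 φ) : Measurable fun X => ‖fderiv ℝ φ X‖ₑ :=
  (h.continuous_fderiv one_ne_zero).measurable.enorm

lemma CC.zero {φ : Eu n → ℝ} (h : CC Γ φ) {y : Eu n} (hy : y ∈ Γ) : φ =ᶠ[𝓝 y] 0 :=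
  notMem_tsupport_iff_eventuallyEq.1 fun h' => h.ts h' hy

lemma fd_sq {φ : Eu n → ℝ} (h : ContDiff ℝ 1 φ) (X : Eu n) :
    fderiv ℝ (fun X => φ X ^ 2) X = (2 * φ X) • fderiv ℝ φ X := by
  have := ((h.differentiable one_ne_zero X).hasFDerivAt.pow 2).fderiv
  simpa using this

lemma AR.csw (h : AR n d C₀ Γ) {f g : Eu n → ℝ≥0∞} (hf : Measurable f) (hg : Measurable g) (c a b : ℝ)
    (hc : a + b = 2 * c) : (∫⁻ X, f X * g X * ofReal (infDist X Γ ^ c)) ^ 2 ≤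
      (∫⁻ X, f X ^ 2 * ofReal (infDist X Γ ^ a)) * ∫⁻ X, g X ^ 2 * ofReal (infDist X Γ ^ b) := by
  have e : ∀ (δ : ℝ), 0 ≤ δ → ∀ a : ℝ, ofReal (δ ^ (a / 2)) ^ 2 = ofReal (δ ^ a) := by
    intro δ hδ a
    rw [← ofReal_pow (by positivity), ← Real.rpow_natCast, ← Real.rpow_mul hδ]; simp
  have h1 := cs (μ := volume) (f := fun X => f X * ofReal (infDist X Γ ^ (a / 2)))
    (g := fun X => g X * ofReal (infDist X Γ ^ (b / 2))) (by fun_prop) (by fun_prop)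
  simp only [mul_pow, e _ infDist_nonneg] at h1
  refine le_trans (pow_le_pow_left' (le_of_eq (lintegral_congr_ae ?_)) 2) h1
  filter_upwards [measure_eq_zero_iff_ae_notMem.1 h.null] with X hX
  rw [mul_mul_mul_comm, ← ofReal_mul (by have := infDist_nonneg (x := X) (s := Γ); positivity),
    ← Real.rpow_add (h.pos hX), ← add_div, hc, mul_div_cancel_left₀ _ two_ne_zero]

lemma CC.fin {φ : Eu n → ℝ} (h : CC Γ φ) (hcl : IsClosed Γ) (hne : Γ.Nonempty) (p : ℝ) :
    ∫⁻ X, ‖φ X‖ₑ ^ 2 * ofReal (infDist X Γ ^ p) ≠ ∞ := by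
  have hc : Continuous fun X => φ X ^ 2 * infDist X Γ ^ p := by
    rw [continuous_iff_continuousAt]
    intro X
    by_cases hX : X ∈ Γ
    · refine ContinuousAt.congr (f := fun _ => (0:ℝ)) continuousAt_const ?_
      filter_upwards [h.zero hX] with Y hY
      simp [hY]
    · refine (h.c1.continuous.continuousAt.pow 2).mul
        ((continuous_infDist_pt Γ).continuousAt.rpow_const (Or.inl ?_))
      exact ((hcl.notMem_iff_infDist_pos hne).1 hX).ne'
  have hi := (hc.integrable_of_hasCompactSupport (μ := volume) (h.cs.comp_left (g := fun t => t ^ 2) (by simp)).mul_right)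
  convert hi.lintegral_lt_top.ne using 3 with X
  rw [ofReal_mul (by positivity), ← sq_abs, ofReal_pow (abs_nonneg _), ← Real.norm_eq_abs, ofReal_norm]

lemma sq_div {A B C : ℝ≥0∞} (hA : A ≠ ∞) (h : A ^ 2 ≤ C * (A * B)) : A ≤ C * B := by
  rcases eq_or_ne A 0 with rfl | h0
  · simp
  · rw [sq, mul_left_comm] at h
    exact (ENNReal.mul_le_mul_iff_right h0 hA).1 h

lemma AR.hardy (h : AR n d C₀ Γ) : ∃ C : ℝ≥0, ∀ φ, CC Γ φ →
    ∫⁻ X, ‖φ X‖ₑ ^ 2 ∂(m2 d Γ) ≤ C * ∫⁻ X, ‖fderiv ℝ φ X‖ₑ ^ 2 ∂(mm d Γ) := by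
  have hn : (2 : ℝ) ≤ n := by exact_mod_cast h.two
  have hd := h.hd
  obtain ⟨C₁, h1⟩ := h.t1 (p := n + 1) (by linarith)
  obtain ⟨C₂, h2⟩ := h.t2 (p := n) (by linarith)
  refine ⟨(C₁ * C₂ * 2) ^ 2, fun φ hφ => ?_⟩
  have mφ := hφ.meas
  have mD := measD hφ.c1
  rw [int_m2 (by fun_prop), int_mm (by fun_prop)]
  refine sq_div (hφ.fin h.cl h.ne _) ?_
  have h3 : ∫⁻ X, ‖φ X‖ₑ ^ 2 * ofReal (infDist X Γ ^ (d - (n + 1))) ≤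
      (C₁ * C₂ * 2 : ℝ≥0) * ∫⁻ X, ‖φ X‖ₑ * ‖fderiv ℝ φ X‖ₑ * ofReal (infDist X Γ ^ (d - n)) := by
    calc _ ≤ C₁ * ∫⁻ y, (∫⁻ X, ‖φ X‖ₑ ^ 2 * ofReal (‖X - y‖ ^ (-((n:ℝ) + 1)))) ∂(sg d Γ) :=
          h1 _ (by fun_prop)
      _ ≤ C₁ * ∫⁻ y, (∫⁻ X, (2 * (‖φ X‖ₑ * ‖fderiv ℝ φ X‖ₑ)) * ofReal (‖X - y‖ ^ (-(n:ℝ)))) ∂(sg d Γ) := by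
          refine mul_le_mul_right (lintegral_mono_ae ?_) _
          filter_upwards [sg_ae] with y hy
          have h4 := hardy1 (hφ.c1.pow 2) (y := y) (by simp [(hφ.zero (hy h.cl)).eq_of_nhds])
          convert h4 using 3 with X X
          · rw [mul_comm, neg_add', enorm_pow]
          · rw [fd_sq hφ.c1, enorm_smul, enorm_mul]
            simp [enorm_eq_nnnorm, mul_assoc]
      _ ≤ C₁ * (C₂ * ∫⁻ X, (2 * (‖φ X‖ₑ * ‖fderiv ℝ φ X‖ₑ)) * ofReal (infDist X Γ ^ (d - n))) :=
          mul_le_mul_right (h2 _ (by fun_prop)) _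
      _ = _ := by
          simp only [mul_assoc]
          rw [lintegral_const_mul _ (by fun_prop)]
          push_cast; ring
  refine (pow_le_pow_left' h3 2).trans ?_
  rw [mul_pow]; push_cast
  exact mul_le_mul_right (h.csw mφ mD _ _ _ (by ring)) _

lemma en_add {F : Type*} [SeminormedAddCommGroup F] (a b : F) : ‖a + b‖ₑ ≤ ‖a‖ₑ + ‖b‖ₑ := by
  simp only [enorm]; exact_mod_cast nnnorm_add_le a b
lemma en_zero {F : Type*} [SeminormedAddCommGroup F] : ‖(0 : F)‖ₑ = 0 := by simp [enorm]

lemma en_sq (a b : ℝ≥0∞) : (a + b) ^ 2 ≤ 2 * (a ^ 2 + b ^ 2) := by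
  rcases eq_or_ne a ∞ with rfl | ha
  · simp
  rcases eq_or_ne b ∞ with rfl | hb
  · simp
  lift a to ℝ≥0 using ha
  lift b to ℝ≥0 using hb
  norm_cast
  rw [← NNReal.coe_le_coe]; push_cast
  nlinarith [sq_nonneg ((a : ℝ) - b)]

lemma gns (hn : 2 ≤ n) : ∃ C : ℝ≥0, ∀ q : Eu n → ℝ, ContDiff ℝ 1 q → HasCompactSupport q →
    ∀ S : Set (Eu n), MeasurableSet S →
    ∫⁻ X in S, ‖q X‖ₑ ≤ C * volume S ^ (1 / n : ℝ) * ∫⁻ X, ‖fderiv ℝ q X‖ₑ := by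
  have hn' : (2 : ℝ) ≤ n := by exact_mod_cast hn
  have hc : Real.HolderConjugate (n : ℝ) (n / (n - 1)) := Real.HolderConjugate.conjExponent (by linarith)
  set p : ℝ := n / (n - 1) with hp
  have hp0 : 0 < p := hc.symm.pos
  have hc' : Real.HolderConjugate (Module.finrank ℝ (Eu n)) p := by simpa using hc
  refine ⟨lintegralPowLePowLIntegralFDerivConst (volume : Measure (Eu n)) p ^ (1 / p), fun q hq hq2 S hS => ?_⟩
  have h1 := lintegral_pow_le_pow_lintegral_fderiv volume hq hq2 hc'
  have h2 := ENNReal.lintegral_mul_le_Lp_mul_Lq (volume.restrict S) hc (f := 1)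
    (g := fun X => ‖q X‖ₑ) (by fun_prop) hq.continuous.measurable.enorm.aemeasurable
  simp only [Pi.mul_apply, Pi.one_apply, one_mul, ENNReal.one_rpow, lintegral_one,
    Measure.restrict_apply_univ] at h2
  refine h2.trans ?_
  rw [mul_comm (_ : ℝ≥0∞) (volume S ^ _), mul_assoc]
  refine mul_le_mul_right ?_ _
  refine (ENNReal.rpow_le_rpow ((setLIntegral_le_lintegral _ _).trans h1) (by positivity)).trans ?_
  rw [ENNReal.mul_rpow_of_nonneg _ _ (by positivity), ← ENNReal.rpow_mul, mul_one_div_cancel hp0.ne',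
    ENNReal.rpow_one, ENNReal.coe_rpow_of_nonneg _ (by positivity)]

lemma norm_rpow_fd (y : Eu n) {X : Eu n} (hX : X ≠ y) (p : ℝ) :
    ContDiffAt ℝ 1 (fun X => ‖X - y‖ ^ p) X ∧
    ‖fderiv ℝ (fun X => ‖X - y‖ ^ p) X‖ₑ ≤ ‖p‖ₑ * ofReal (‖X - y‖ ^ (p - 1)) := by
  have hp : 0 < ‖X - y‖ := norm_pos_iff.2 (sub_ne_zero.2 hX)
  have h1 : ContDiffAt ℝ 1 (fun X : Eu n => ‖X - y‖) X :=
    (contDiffAt_norm ℝ (sub_ne_zero.2 hX)).comp X (by fun_prop)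
  refine ⟨h1.rpow_const_of_ne hp.ne', ?_⟩
  have h2 : ‖fderiv ℝ (fun X : Eu n => ‖X - y‖) X‖ ≤ 1 := by
    refine (norm_fderiv_le_of_lipschitz ℝ (C := 1) ?_)
    refine LipschitzWith.of_dist_le_mul fun a b => ?_
    rw [Real.dist_eq, NNReal.coe_one, one_mul, dist_eq_norm]
    have := abs_norm_sub_norm_le (a - y) (b - y); simpa using this
  rw [((h1.differentiableAt one_ne_zero).hasFDerivAt.rpow_const (Or.inl hp.ne')).fderiv, enorm_smul, enorm_mul, mul_assoc]
  refine mul_le_mul_right ?_ _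
  rw [Real.enorm_of_nonneg (by positivity)]
  refine mul_le_of_le_one_right' ?_
  rw [← ofReal_norm, ← ofReal_one]; exact ofReal_le_ofReal h2

lemma AR.fk (h : AR n d C₀ Γ) : ∃ C : ℝ≥0, ∀ φ, CC Γ φ → ∀ S : Set (Eu n), MeasurableSet S →
    (∫⁻ X in S, ‖φ X‖ₑ ^ 2 ∂(mm d Γ)) ^ 2 ≤ C * (volume S ^ (1 / n : ℝ)) ^ 2 *
      ((∫⁻ X, ‖φ X‖ₑ ^ 2 ∂(mm d Γ)) * ∫⁻ X, ‖fderiv ℝ φ X‖ₑ ^ 2 ∂(mm d Γ)) := by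
  have hn : (2 : ℝ) ≤ n := by exact_mod_cast h.two
  have hd := h.hd
  obtain ⟨C₁, h1⟩ := h.t1 (p := n - 1) (by linarith)
  obtain ⟨C₂, h2⟩ := h.t2 (p := n - 1) (by linarith)
  obtain ⟨C₃, h3⟩ := h.t2 (p := n) (by linarith)
  obtain ⟨C₄, h4⟩ := gns h.two
  obtain ⟨C₅, h5⟩ := h.hardy
  refine ⟨(C₁ * C₄) ^ 2 * (2 * ((2 * C₂) ^ 2 + (‖1 - (n:ℝ)‖₊ * C₃) ^ 2 * C₅)), fun φ hφ S hS => ?_⟩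
  have mφ := hφ.meas
  have mD := measD hφ.c1
  have key : ∀ y ∈ Γ, ∫⁻ X, S.indicator (fun X => ‖φ X‖ₑ ^ 2) X * ofReal (‖X - y‖ ^ (-((n:ℝ) - 1))) ≤
      C₄ * volume S ^ (1 / n : ℝ) * ∫⁻ X, (‖φ X‖ₑ * ‖fderiv ℝ φ X‖ₑ * 2 * ofReal (‖X - y‖ ^ (-((n:ℝ) - 1))) +
        ‖φ X‖ₑ ^ 2 * ‖1 - (n:ℝ)‖ₑ * ofReal (‖X - y‖ ^ (-(n:ℝ)))) := by
    intro y hy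
    let q : Eu n → ℝ := fun X => φ X ^ 2 * ‖X - y‖ ^ (1 - (n : ℝ))
    have hq0 : ∀ X ∉ tsupport φ, q =ᶠ[𝓝 X] 0 := by
      intro X hX
      filter_upwards [notMem_tsupport_iff_eventuallyEq.1 hX] with Y hY
      simp [q, hY]
    have hXy : ∀ X ∈ tsupport φ, X ≠ y := fun X hX hXy => hφ.ts hX (hXy ▸ hy)
    have hq : ContDiff ℝ 1 q := by
      rw [contDiff_iff_contDiffAt]
      intro X
      by_cases hX : X ∈ tsupport φ
      · exact (hφ.c1.contDiffAt.pow 2).mul (norm_rpow_fd y (hXy X hX) _).1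
      · exact contDiffAt_const.congr_of_eventuallyEq (hq0 X hX)
    have h6 := h4 q hq (hφ.cs.comp_left (g := fun t => t ^ 2) (by simp)).mul_right S hS
    refine le_trans (le_of_eq ?_) (h6.trans (mul_le_mul_right (lintegral_mono fun X => ?_) _))
    · rw [← lintegral_indicator hS]
      refine lintegral_congr fun X => ?_
      by_cases hX : X ∈ S
      · simp only [indicator_of_mem hX, q]
        rw [enorm_mul, enorm_pow, neg_sub, Real.enorm_of_nonneg (r := ‖X - y‖ ^ _) (by positivity)]
      · simp [indicator_of_notMem hX]
    · by_cases hX : X ∈ tsupport φ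
      · obtain ⟨c1, c2⟩ := norm_rpow_fd y (hXy X hX) (1 - n)
        have : fderiv ℝ q X = φ X ^ 2 • fderiv ℝ (fun X => ‖X - y‖ ^ (1 - (n:ℝ))) X +
            ‖X - y‖ ^ (1 - (n:ℝ)) • fderiv ℝ (fun X => φ X ^ 2) X :=
          fderiv_fun_mul ((hφ.c1.pow 2).differentiable one_ne_zero X) (c1.differentiableAt one_ne_zero)
        rw [this, add_comm]
        refine (en_add _ _).trans (add_le_add ?_ ?_)
        · rw [fd_sq hφ.c1, enorm_smul, enorm_smul, enorm_mul, Real.enorm_of_nonneg (r := ‖X - y‖ ^ _) (by positivity), neg_sub]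
          refine le_of_eq ?_
          rw [Real.enorm_of_nonneg (by norm_num : (0:ℝ) ≤ 2), ofReal_ofNat]; ring
        · rw [enorm_smul, enorm_pow, mul_assoc]
          refine mul_le_mul_right (c2.trans (le_of_eq ?_)) _
          rw [show 1 - (n:ℝ) - 1 = -n by ring]
      · rw [(hq0 X hX).fderiv_eq, fderiv_zero, Pi.zero_apply, en_zero]; exact zero_le
  have h7 := h5 φ hφ
  rw [int_m2 (by fun_prop), int_mm (by fun_prop)] at h7
  rw [← lintegral_indicator hS, int_mm ((mφ.pow_const 2).indicator hS), int_mm (by fun_prop), int_mm (by fun_prop)]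
  have hP := h.csw mφ mD (d - ((n:ℝ) - 1)) (d - ((n:ℝ) - 1)) (d - ((n:ℝ) - 1)) (by ring)
  have hQ := (h.csw mφ mφ (d - n) (d - ((n:ℝ) - 1)) (d - (n + 1)) (by ring)).trans (mul_le_mul_right h7 _)
  set I := ∫⁻ X, ‖φ X‖ₑ ^ 2 * ofReal (infDist X Γ ^ (d - ((n:ℝ) - 1)))
  set D := ∫⁻ X, ‖fderiv ℝ φ X‖ₑ ^ 2 * ofReal (infDist X Γ ^ (d - ((n:ℝ) - 1)))
  set P := ∫⁻ X, ‖φ X‖ₑ * ‖fderiv ℝ φ X‖ₑ * ofReal (infDist X Γ ^ (d - ((n:ℝ) - 1)))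
  set Q := ∫⁻ X, ‖φ X‖ₑ * ‖φ X‖ₑ * ofReal (infDist X Γ ^ (d - (n:ℝ)))
  have hL : ∫⁻ X, S.indicator (fun X => ‖φ X‖ₑ ^ 2) X * ofReal (infDist X Γ ^ (d - ((n:ℝ) - 1))) ≤
      C₁ * C₄ * volume S ^ (1 / n : ℝ) * (2 * C₂ * P + ‖1 - (n:ℝ)‖ₑ * C₃ * Q) := by
    refine (h1 _ ((mφ.pow_const 2).indicator hS)).trans ?_
    rw [mul_assoc, mul_assoc]
    refine mul_le_mul_right ?_ _
    refine (lintegral_mono_ae (g := fun y => C₄ * volume S ^ (1 / n : ℝ) * ∫⁻ X, (‖φ X‖ₑ * ‖fderiv ℝ φ X‖ₑ * 2 * ofReal (‖X - y‖ ^ (-((n:ℝ) - 1))) +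
        ‖φ X‖ₑ ^ 2 * ‖1 - (n:ℝ)‖ₑ * ofReal (‖X - y‖ ^ (-(n:ℝ))))) ?_).trans ?_
    · filter_upwards [sg_ae] with y hy
      exact key y (hy h.cl)
    have := h.locfin
    have hm1 : ∀ {f : Eu n → ℝ≥0∞} {p : ℝ}, Measurable f → Measurable fun q : Eu n × Eu n =>
      f q.2 * ofReal (‖q.2 - q.1‖ ^ p) := by intro f p hf; fun_prop
    have hm2 : ∀ {f : Eu n → ℝ≥0∞} {p : ℝ}, Measurable f → Measurable fun y : Eu n =>
      ∫⁻ X, f X * ofReal (‖X - y‖ ^ p) := fun hf => (hm1 hf).lintegral_prod_right'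
    have hadd : ∀ y : Eu n, ∫⁻ X, (‖φ X‖ₑ * ‖fderiv ℝ φ X‖ₑ * 2 * ofReal (‖X - y‖ ^ (-((n:ℝ) - 1))) +
        ‖φ X‖ₑ ^ 2 * ‖1 - (n:ℝ)‖ₑ * ofReal (‖X - y‖ ^ (-(n:ℝ)))) = _ :=
      fun y => lintegral_add_left (by fun_prop) _
    simp_rw [hadd]
    have ha := hm2 (f := fun X => ‖φ X‖ₑ * ‖fderiv ℝ φ X‖ₑ * 2) (p := -((n:ℝ) - 1)) (by fun_prop)
    have hb := hm2 (f := fun X => ‖φ X‖ₑ ^ 2 * ‖1 - (n:ℝ)‖ₑ) (p := -(n:ℝ)) (by fun_prop)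
    rw [lintegral_const_mul _ (by exact ha.add hb), lintegral_add_left ha, mul_assoc]
    refine mul_le_mul_right (mul_le_mul_right (add_le_add ?_ ?_) _) _
    · refine (h2 _ (by fun_prop)).trans (le_of_eq ?_)
      rw [mul_comm 2 (C₂ : ℝ≥0∞), mul_assoc]
      congr 1; simp only [P]; rw [← lintegral_const_mul _ (by fun_prop)]; exact lintegral_congr fun X => by ring
    · refine (h3 _ (by fun_prop)).trans (le_of_eq ?_)
      rw [mul_comm _ (C₃ : ℝ≥0∞), mul_assoc]
      congr 1; simp only [Q]; rw [← lintegral_const_mul _ (by fun_prop)]; exact lintegral_congr fun X => by ring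
  refine (pow_le_pow_left' hL 2).trans ?_
  rw [mul_pow]
  refine (mul_le_mul_right (en_sq _ _) _).trans ?_
  rw [mul_pow _ P, mul_pow _ Q]
  refine (mul_le_mul_right (mul_le_mul_right (add_le_add (mul_le_mul_right hP _) (mul_le_mul_right hQ _)) _) _).trans (le_of_eq ?_)
  clear_value I D P Q
  rw [enorm_eq_nnnorm]; push_cast; ring

lemma AR.pb (h : AR n d C₀ Γ) : ∃ C : ℝ≥0, ∀ v : Eu n → ℝ, ContDiff ℝ 1 v → ∀ y ∈ Γ, ∀ ρ : ℝ, 0 < ρ →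
    (∀ z ∈ Γ ∩ ball y ρ, v z = 0) →
    ofReal (ρ ^ d) * ∫⁻ X in ball y ρ, ‖v X‖ₑ ≤
      C * ofReal (ρ ^ n) * ∫⁻ X in ball y (4 * ρ), ‖fderiv ℝ v X‖ₑ ∂(mm d Γ) := by
  have hC := h.hC
  have hn : (2 : ℝ) ≤ n := by exact_mod_cast h.two
  obtain ⟨C₂, h2⟩ := h.t2 (p := n - 1) h.hd
  refine ⟨Real.toNNReal C₀ * C₂ * 2 ^ n, fun v hv y hy ρ hρ h0 => ?_⟩
  have mD := measD hv
  have hmi : Measurable ((ball y (4 * ρ)).indicator fun X => ‖fderiv ℝ v X‖ₑ) := mD.indicator measurableSet_ball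
  have h1 : ofReal (C₀⁻¹ * ρ ^ d) * ∫⁻ X in ball y ρ, ‖v X‖ₑ ≤
      C₂ * ofReal ((2 * ρ) ^ n) * ∫⁻ X in ball y (4 * ρ), ‖fderiv ℝ v X‖ₑ ∂(mm d Γ) := by
    calc _ ≤ ∫⁻ z in ball y ρ, (∫⁻ X in ball y ρ, ‖v X‖ₑ) ∂(sg d Γ) := by
          rw [setLIntegral_const, mul_comm]
          exact mul_le_mul_right (h.sg_ge hy hρ) _
      _ ≤ ∫⁻ z in ball y ρ, (ofReal ((2 * ρ) ^ n) * ∫⁻ X, (ball y (4 * ρ)).indicator (fun X => ‖fderiv ℝ v X‖ₑ) X *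
            ofReal (‖X - z‖ ^ (-((n:ℝ) - 1)))) ∂(sg d Γ) := by
          refine lintegral_mono_ae ?_
          filter_upwards [ae_restrict_mem measurableSet_ball, ae_restrict_of_ae sg_ae] with z hz hzG
          have h3 := seg h.two hv z (ρ := 2 * ρ) (by positivity)
          rw [h0 z ⟨hzG h.cl, hz⟩] at h3
          simp only [sub_zero] at h3
          refine (lintegral_mono_set fun X hX => ?_).trans (h3.trans (mul_le_mul_right ?_ _))
          · have := dist_triangle_right X z y
            rw [mem_ball] at *; linarith
          · rw [← lintegral_indicator measurableSet_ball]
            refine lintegral_mono fun X => ?_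
            by_cases hX : X ∈ ball z (2 * ρ)
            · have hX2 : X ∈ ball y (4 * ρ) := by
                have := dist_triangle X z y
                rw [mem_ball] at *; linarith
              rw [indicator_of_mem hX, indicator_of_mem hX2, neg_sub]
            · rw [indicator_of_notMem hX]; exact zero_le
      _ ≤ ofReal ((2 * ρ) ^ n) * ∫⁻ z, (∫⁻ X, (ball y (4 * ρ)).indicator (fun X => ‖fderiv ℝ v X‖ₑ) X *
            ofReal (‖X - z‖ ^ (-((n:ℝ) - 1)))) ∂(sg d Γ) := by
          rw [lintegral_const_mul' _ _ ofReal_ne_top]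
          exact mul_le_mul_right (setLIntegral_le_lintegral _ _) _
      _ ≤ _ := by
          refine (mul_le_mul_right (h2 _ hmi) _).trans (le_of_eq ?_)
          rw [← int_mm hmi, lintegral_indicator measurableSet_ball]; ring
  calc _ = ofReal C₀ * (ofReal (C₀⁻¹ * ρ ^ d) * ∫⁻ X in ball y ρ, ‖v X‖ₑ) := by
        rw [← mul_assoc, ← ofReal_mul hC.le, mul_inv_cancel_left₀ hC.ne']
    _ ≤ _ := mul_le_mul_right h1 _
    _ = _ := by
        rw [mul_pow, ofReal_mul (by positivity), ofReal_pow (by norm_num)]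
        push_cast
        rw [ENNReal.ofNNReal_toNNReal, ofReal_ofNat]; ring

lemma pin (hn : 2 ≤ n) : ∃ C : ℝ≥0, ∀ v : Eu n → ℝ, ContDiff ℝ 1 v → ∀ (y : Eu n) (ρ : ℝ), 0 < ρ →
    ∫⁻ Y in ball y ρ, ∫⁻ X in ball y ρ, ‖v X - v Y‖ₑ ≤
      C * ofReal (ρ ^ (n + 1)) * ∫⁻ X in ball y (4 * ρ), ‖fderiv ℝ v X‖ₑ := by
  obtain ⟨C₂, h2⟩ := kern_leb hn
  refine ⟨2 ^ n * C₂ * 5, fun v hv y ρ hρ => ?_⟩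
  have mD := measD hv
  have hmi : Measurable ((ball y (4 * ρ)).indicator fun X => ‖fderiv ℝ v X‖ₑ) := mD.indicator measurableSet_ball
  calc _ ≤ ∫⁻ Y in ball y ρ, ofReal ((2 * ρ) ^ n) * ∫⁻ X in ball y (4 * ρ), ‖fderiv ℝ v X‖ₑ *
            ofReal (‖X - Y‖ ^ (1 - (n:ℝ))) := by
        refine setLIntegral_mono' measurableSet_ball fun z hz => ?_
        have h3 := seg hn hv z (ρ := 2 * ρ) (by positivity)
        refine (lintegral_mono_set fun X hX => ?_).trans (h3.trans (mul_le_mul_right (lintegral_mono_set fun X hX => ?_) _))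
        · have := dist_triangle_right X z y
          rw [mem_ball] at *; linarith
        · have := dist_triangle X z y
          rw [mem_ball] at *; linarith
    _ = ofReal ((2 * ρ) ^ n) * ∫⁻ X in ball y (4 * ρ), ∫⁻ Y in ball y ρ, ‖fderiv ℝ v X‖ₑ *
            ofReal (‖X - Y‖ ^ (1 - (n:ℝ))) := by
        rw [lintegral_const_mul' _ _ ofReal_ne_top, lintegral_lintegral_swap]
        exact Measurable.aemeasurable (by fun_prop)
    _ ≤ ofReal ((2 * ρ) ^ n) * ∫⁻ X in ball y (4 * ρ), ‖fderiv ℝ v X‖ₑ * (C₂ * ofReal (5 * ρ)) := by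
        refine mul_le_mul_right (setLIntegral_mono' measurableSet_ball fun X hX => ?_) _
        rw [lintegral_const_mul _ (meas_kern X _)]
        refine mul_le_mul_right (le_trans ?_ (h2 X (5 * ρ) (by positivity))) _
        simp_rw [norm_sub_rev X]
        refine lintegral_mono_set fun Y hY => ?_
        have := dist_triangle_right Y X y
        rw [mem_ball] at *; linarith
    _ = _ := by
        rw [lintegral_mul_const _ mD, mul_pow, pow_succ ρ, ofReal_mul (by positivity),
          ofReal_mul (by positivity), ofReal_mul (by positivity), ofReal_pow (by norm_num)]
        push_cast
        rw [ofReal_ofNat, ofReal_ofNat]; ring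

lemma rpow_anti {a b p : ℝ} (ha : 0 < a) (hab : a ≤ b) (hp : p ≤ 0) : b ^ p ≤ a ^ p :=
  Real.rpow_le_rpow_of_nonpos ha hab hp

lemma AR.vol_le (h : AR n d C₀ Γ) {T : Set (Eu n)} (hT : MeasurableSet T) {D : ℝ}
    (hD : ∀ X ∈ T, infDist X Γ ≤ D) {f : Eu n → ℝ≥0∞} (hf : Measurable f) :
    ∫⁻ X in T, f X ≤ ofReal (D ^ ((n:ℝ) - 1 - d)) * ∫⁻ X in T, f X ∂(mm d Γ) := by
  rw [← lintegral_indicator hT, ← lintegral_indicator hT, int_mm (hf.indicator hT),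
    ← lintegral_const_mul' _ _ ofReal_ne_top]
  refine lintegral_mono_ae ?_
  filter_upwards [measure_eq_zero_iff_ae_notMem.1 h.null] with X hX
  by_cases hXT : X ∈ T
  · rw [mul_left_comm, ← ofReal_mul (by have := infDist_nonneg.trans (hD X hXT); positivity)]
    refine le_mul_of_one_le_right' ?_
    rw [ENNReal.one_le_ofReal]
    have h1 := h.pos hX
    have h2 := hD X hXT
    rw [show d - ((n:ℝ) - 1) = -((n:ℝ) - 1 - d) by ring, Real.rpow_neg h1.le, ← div_eq_mul_inv,
      one_le_div (by positivity)]
    exact Real.rpow_le_rpow h1.le h2 (by linarith [h.hd])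
  · rw [indicator_of_notMem hXT]; exact zero_le

lemma AR.mm_le (h : AR n d C₀ Γ) {T : Set (Eu n)} (hT : MeasurableSet T) {D : ℝ}
    (hD : ∀ X ∈ T, infDist X Γ ≤ D) {f : Eu n → ℝ≥0∞} (hf : Measurable f) :
    ∫⁻ X in T, f X ∂(mm d Γ) ≤ ofReal (D ^ 2) * ∫⁻ X in T, f X ∂(m2 d Γ) := by
  rw [← lintegral_indicator hT, ← lintegral_indicator hT, int_mm (hf.indicator hT),
    int_m2 (hf.indicator hT), ← lintegral_const_mul' _ _ ofReal_ne_top]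
  refine lintegral_mono_ae ?_
  filter_upwards [measure_eq_zero_iff_ae_notMem.1 h.null] with X hX
  by_cases hXT : X ∈ T
  · rw [mul_left_comm, ← ofReal_mul (by positivity)]
    refine mul_le_mul_right (ofReal_le_ofReal ?_) _
    have h1 := h.pos hX
    have h2 := hD X hXT
    rw [show d - ((n:ℝ) - 1) = 2 + (d - (n + 1)) by ring, Real.rpow_add h1, Real.rpow_two]
    gcongr
  · rw [indicator_of_notMem hXT, zero_mul]; exact zero_le

lemma infDist_le_of (h : AR n d C₀ Γ) (y : Eu n) (R : ℝ) : ∀ X ∈ ball y R, infDist X Γ ≤ infDist y Γ + R := by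
  intro X hX
  have := infDist_le_infDist_add_dist (s := Γ) (x := X) (y := y)
  rw [mem_ball] at hX; linarith

lemma AR.mfin (h : AR n d C₀ Γ) (y : Eu n) (R : ℝ) : mm d Γ (ball y R) < ∞ := by
  obtain ⟨C, hC⟩ := h.mball
  obtain ⟨z, hz⟩ := h.ne
  refine (measure_mono (ball_subset_ball' (ε₂ := |R| + dist y z + 1) ?_)).trans_lt ((hC z hz (|R| + dist y z + 1)
    (by positivity)).trans_lt (by finiteness))
  linarith [le_abs_self R]

lemma AR.ac2 (h : AR n d C₀ Γ) : (volume : Measure (Eu n)) ≪ m2 d Γ := by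
  refine withDensity_absolutelyContinuous' (by fun_prop) ?_
  filter_upwards [measure_eq_zero_iff_ae_notMem.1 h.null] with X hX
  simpa using Real.rpow_pos_of_pos (h.pos hX) _

lemma mac : mm d Γ ≪ volume := withDensity_absolutelyContinuous _ _

noncomputable def N2 {F : Type*} [NormedAddCommGroup F] (μ : Measure (Eu n)) (f : Eu n → F) : ℝ≥0∞ :=
  ∫⁻ X, ‖f X‖ₑ ^ 2 ∂μ

section N2
variable {F : Type*} [NormedAddCommGroup F] [MeasurableSpace F] [BorelSpace F] {μ : Measure (Eu n)}

lemma N2_add {f g : Eu n → F} (hf : Measurable f) : N2 μ (f + g) ≤ 2 * (N2 μ f + N2 μ g) := by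
  unfold N2
  rw [← lintegral_add_left (by fun_prop), ← lintegral_const_mul' _ _ (by simp)]
  exact lintegral_mono fun X => (pow_le_pow_left' (en_add _ _) 2).trans (en_sq _ _)

lemma N2_neg {f : Eu n → F} : N2 μ (-f) = N2 μ f := by simp [N2, enorm]

lemma N2_smul [NormedSpace ℝ F] (c : ℝ) {f : Eu n → F} : N2 μ (c • f) = ‖c‖ₑ ^ 2 * N2 μ f := by
  unfold N2
  rw [← lintegral_const_mul' _ _ (by simp)]
  refine lintegral_congr fun X => ?_
  rw [Pi.smul_apply, enorm_smul, mul_pow]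

lemma N2_L1 {f : Eu n → F} (hf : Measurable f) (T : Set (Eu n)) :
    (∫⁻ X in T, ‖f X‖ₑ ∂μ) ^ 2 ≤ μ T * N2 μ f := by
  have := cs (μ := μ.restrict T) (f := fun _ => 1) (g := fun X => ‖f X‖ₑ) (by fun_prop) (by fun_prop)
  simp only [one_mul, one_pow, lintegral_one, Measure.restrict_apply_univ] at this
  exact this.trans (mul_le_mul_right (setLIntegral_le_lintegral _ _) _)
end N2

noncomputable abbrev nb (φ : Eu n → ℝ) : Eu n → Eu n := gradient φ

lemma nb_enorm (φ : Eu n → ℝ) (X : Eu n) : ‖nb φ X‖ₑ = ‖fderiv ℝ φ X‖ₑ := by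
  rw [← ofReal_norm, ← ofReal_norm]; simp [nb, gradient]

lemma nb_meas {φ : Eu n → ℝ} (h : ContDiff ℝ 1 φ) : Measurable (nb φ) :=
  ((InnerProductSpace.toDual ℝ (Eu n)).symm.continuous.comp (h.continuous_fderiv one_ne_zero)).measurable

lemma nb_add {φ ψ : Eu n → ℝ} (h : ContDiff ℝ 1 φ) (h' : ContDiff ℝ 1 ψ) : nb (φ + ψ) = nb φ + nb ψ := by
  ext1 X
  simp [nb, gradient, fderiv_add (h.differentiable one_ne_zero X) (h'.differentiable one_ne_zero X)]

lemma nb_smul {φ : Eu n → ℝ} (h : ContDiff ℝ 1 φ) (c : ℝ) : nb (c • φ) = c • nb φ := by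
  ext1 X
  simp [nb, gradient, fderiv_const_smul (h.differentiable one_ne_zero X)]

structure W0 (d : ℝ) (Γ S : Set (Eu n)) (φ : Eu n → ℝ) (H : Eu n → Eu n) : Prop where
  m1 : Measurable φ
  m2 : Measurable H
  sp : Function.support φ ⊆ S
  ex : ∃ P : ℕ → Eu n → ℝ, (∀ j, CC Γ (P j)) ∧ (∀ j, Function.support (P j) ⊆ S) ∧
    Tendsto (fun j => N2 (mm d Γ) (nb (P j) - H)) atTop (𝓝 0) ∧
    Tendsto (fun j => N2 (EM.m2 d Γ) (P j - φ)) atTop (𝓝 0)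

lemma CC.add {φ ψ : Eu n → ℝ} (h : CC Γ φ) (h' : CC Γ ψ) : CC Γ (φ + ψ) :=
  ⟨h.c1.add h'.c1, h.cs.add h'.cs, (tsupport_add _ _).trans (union_subset h.ts h'.ts)⟩

lemma CC.smul {φ : Eu n → ℝ} (h : CC Γ φ) (c : ℝ) : CC Γ (c • φ) :=
  ⟨h.c1.const_smul c, h.cs.smul_left, (closure_mono (Function.support_const_smul_subset c φ)).trans h.ts⟩

lemma gfin0 {φ : Eu n → ℝ} (h1 : ContDiff ℝ 1 φ) (hcs : HasCompactSupport φ) (hA : AR n d C₀ Γ) : N2 (mm d Γ) (nb φ) ≠ ∞ := by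
  have hc : Continuous fun X => ‖fderiv ℝ φ X‖ := (h1.continuous_fderiv one_ne_zero).norm
  obtain ⟨M, hM⟩ := hc.bounded_above_of_compact_support (hcs.fderiv (𝕜 := ℝ)).norm
  obtain ⟨R, hR⟩ := hcs.isCompact.isBounded.subset_ball 0
  have : N2 (mm d Γ) (nb φ) ≤ ∫⁻ X in ball 0 R, ofReal M ^ 2 ∂(mm d Γ) := by
    rw [← lintegral_indicator measurableSet_ball]
    refine lintegral_mono fun X => ?_
    rw [nb_enorm]
    by_cases hX : X ∈ ball 0 R
    · rw [indicator_of_mem hX, ← ofReal_norm]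
      gcongr; simpa using hM X
    · have : fderiv ℝ φ X = 0 := image_eq_zero_of_notMem_tsupport fun hX' => hX (hR (tsupport_fderiv_subset ℝ hX'))
      simp [this, en_zero]
  refine (this.trans_lt ?_).ne
  rw [setLIntegral_const]
  exact ENNReal.mul_lt_top (by finiteness) (hA.mfin _ _)

lemma CC.gfin {φ : Eu n → ℝ} (h : CC Γ φ) (hA : AR n d C₀ Γ) : N2 (mm d Γ) (nb φ) ≠ ∞ := gfin0 h.c1 h.cs hA

section
variable {F : Type*} [NormedAddCommGroup F] [MeasurableSpace F] [BorelSpace F]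

lemma AR.vL1 (h : AR n d C₀ Γ) (y : Eu n) (R : ℝ) : ∃ K : ℝ≥0, ∀ f : Eu n → F, Measurable f →
    (∫⁻ X in ball y R, ‖f X‖ₑ) ^ 2 ≤ K * N2 (mm d Γ) f := by
  refine ⟨(volume (ball y R)).toNNReal * (Real.toNNReal ((infDist y Γ + R) ^ ((n:ℝ) - 1 - d))), fun f hf => ?_⟩
  have h1 := N2_L1 (μ := volume.restrict (ball y R)) hf (ball y R)
  rw [Measure.restrict_restrict measurableSet_ball, inter_self] at h1
  refine h1.trans ?_
  rw [Measure.restrict_apply_self, ENNReal.coe_mul, ENNReal.coe_toNNReal measure_ball_lt_top.ne, mul_assoc]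
  refine mul_le_mul_right ((h.vol_le measurableSet_ball (infDist_le_of h y R) (by fun_prop)).trans ?_) _
  exact mul_le_mul_right (setLIntegral_le_lintegral _ _) _

lemma AR.vL2 (h : AR n d C₀ Γ) (y : Eu n) (R : ℝ) : ∃ K : ℝ≥0, ∀ f : Eu n → F, Measurable f →
    ∫⁻ X in ball y R, ‖f X‖ₑ ^ 2 ∂(mm d Γ) ≤ K * N2 (m2 d Γ) f :=
  ⟨_, fun f hf => (h.mm_le measurableSet_ball (infDist_le_of h y R) (by fun_prop)).trans
    (mul_le_mul_right (setLIntegral_le_lintegral _ _) _)⟩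

lemma sq0 {e : ℕ → ℝ≥0∞} (he : Tendsto (fun j => e j ^ 2) atTop (𝓝 0)) : Tendsto e atTop (𝓝 0) := by
  have := (ENNReal.continuous_rpow_const (y := 1/2)).tendsto 0 |>.comp he
  simp only [ENNReal.zero_rpow_of_pos (show (0:ℝ) < 1/2 by norm_num)] at this
  refine this.congr fun j => ?_
  simp only [Function.comp, ← ENNReal.rpow_two, ← ENNReal.rpow_mul]; norm_num

lemma lim0 {K : ℝ≥0} {e f : ℕ → ℝ≥0∞} (he : Tendsto e atTop (𝓝 0)) (hf : ∀ j, f j ≤ K * e j) :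
    Tendsto f atTop (𝓝 0) := by
  have := ENNReal.Tendsto.const_mul (a := K) he (Or.inr (by simp))
  rw [mul_zero] at this
  exact tendsto_of_tendsto_of_tendsto_of_le_of_le tendsto_const_nhds this (fun _ => zero_le) hf

lemma lim1 {a C b : ℝ≥0∞} {e : ℕ → ℝ≥0∞} (he : Tendsto e atTop (𝓝 0)) (hC : C ≠ ∞)
    (h : ∀ j, a ≤ C * (b + e j)) : a ≤ C * b := by
  have := ENNReal.Tendsto.const_mul (a := C) (tendsto_const_nhds (x := b).add he) (Or.inr hC)
  rw [add_zero] at this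
  exact ge_of_tendsto' this h

lemma tri {μ : Measure (Eu n)} {f g : Eu n → F} (hf : Measurable f) (hg : Measurable g) :
    N2 μ g ≤ 2 * (N2 μ f + N2 μ (f - g)) := by
  have := N2_add (μ := μ) (f := f) (g := -(f - g)) hf
  rwa [N2_neg, show f + -(f - g) = g by abel] at this

lemma N2_symm {μ : Measure (Eu n)} {f g : Eu n → F} : N2 μ (f - g) = N2 μ (g - f) := by
  rw [← N2_neg, neg_sub]

lemma triL {μ : Measure (Eu n)} {f g : Eu n → F} (hf : Measurable f) :
    ∫⁻ X, ‖g X‖ₑ ∂μ ≤ ∫⁻ X, ‖f X‖ₑ ∂μ + ∫⁻ X, ‖(g - f) X‖ₑ ∂μ := by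
  rw [← lintegral_add_left (by fun_prop)]
  refine lintegral_mono fun X => ?_
  have := en_add (f X) ((g - f) X)
  simpa using this
end

lemma W0.mono {S S' : Set (Eu n)} {φ H} (h : W0 d Γ S φ H) (hS : S ⊆ S') : W0 d Γ S' φ H := by
  obtain ⟨P, h1, h2, h3⟩ := h.ex
  exact ⟨h.m1, h.m2, h.sp.trans hS, P, h1, fun j => (h2 j).trans hS, h3⟩

lemma CC.w0 {φ : Eu n → ℝ} (h : CC Γ φ) : W0 d Γ univ φ (nb φ) :=
  ⟨h.c1.continuous.measurable, nb_meas h.c1, subset_univ _, fun _ => φ, fun _ => h, fun _ => subset_univ _,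
    by simp [N2], by simp [N2]⟩

lemma W0.smul {S : Set (Eu n)} {φ H} (h : W0 d Γ S φ H) (c : ℝ) : W0 d Γ S (c • φ) (c • H) := by
  obtain ⟨P, h1, h2, h3, h4⟩ := h.ex
  refine ⟨h.m1.const_smul c, h.m2.const_smul c, (Function.support_const_smul_subset c φ).trans h.sp, fun j => c • P j,
    fun j => (h1 j).smul c, fun j => (Function.support_const_smul_subset c _).trans (h2 j), ?_, ?_⟩
  · refine lim0 (K := ‖c‖₊ ^ 2) h3 fun j => ?_
    rw [nb_smul (h1 j).c1, ← smul_sub, N2_smul]; simp [enorm]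
  · refine lim0 (K := ‖c‖₊ ^ 2) h4 fun j => ?_
    rw [← smul_sub, N2_smul]; simp [enorm]

lemma W0.add {S : Set (Eu n)} {φ H φ' H'} (h : W0 d Γ S φ H) (h' : W0 d Γ S φ' H') :
    W0 d Γ S (φ + φ') (H + H') := by
  obtain ⟨P, h1, h2, h3, h4⟩ := h.ex
  obtain ⟨P', h1', h2', h3', h4'⟩ := h'.ex
  have e3 := h3.add h3'
  have e4 := h4.add h4'
  rw [add_zero] at e3 e4
  refine ⟨h.m1.add h'.m1, h.m2.add h'.m2, (Function.support_add _ _).trans (union_subset h.sp h'.sp), fun j => P j + P' j,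
    fun j => (h1 j).add (h1' j), fun j => (Function.support_add _ _).trans (union_subset (h2 j) (h2' j)),
    lim0 (K := 2) e3 fun j => ?_, lim0 (K := 2) e4 fun j => ?_⟩
  · rw [nb_add (h1 j).c1 (h1' j).c1, add_sub_add_comm]
    exact N2_add ((nb_meas (h1 j).c1).sub h.m2)
  · rw [add_sub_add_comm]
    exact N2_add ((h1 j).c1.continuous.measurable.sub h.m1)

lemma W0.gfin {S : Set (Eu n)} {φ H} (h : W0 d Γ S φ H) (hA : AR n d C₀ Γ) : N2 (mm d Γ) H ≠ ∞ := by
  obtain ⟨P, h1, -, h3, -⟩ := h.ex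
  obtain ⟨j, hj⟩ := (h3.eventually (gt_mem_nhds zero_lt_one)).exists
  refine ((tri (nb_meas (h1 j).c1) h.m2).trans_lt ?_).ne
  have := (h1 j).gfin hA
  have := hj.ne_top
  finiteness

lemma AR.hardyW (hA : AR n d C₀ Γ) : ∃ C : ℝ≥0, ∀ S φ H, W0 d Γ S φ H → N2 (m2 d Γ) φ ≤ C * N2 (mm d Γ) H := by
  obtain ⟨C, hC⟩ := hA.hardy
  refine ⟨4 * (C + 1), fun S φ H h => ?_⟩
  obtain ⟨P, h1, -, h3, h4⟩ := h.ex
  have e := h3.add h4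
  rw [add_zero] at e
  refine lim1 e ENNReal.coe_ne_top fun j => (tri (h1 j).c1.continuous.measurable h.m1).trans ?_
  have a1 : N2 (m2 d Γ) (P j) ≤ C * N2 (mm d Γ) (nb (P j)) := by
    simp only [N2, nb_enorm]; exact hC _ (h1 j)
  have a2 := tri (μ := mm d Γ) h.m2 (nb_meas (h1 j).c1)
  rw [N2_symm] at a2
  set x := N2 (mm d Γ) H
  set e1 := N2 (mm d Γ) (nb (P j) - H)
  set e2 := N2 (m2 d Γ) (P j - φ)
  calc 2 * (N2 (m2 d Γ) (P j) + e2) ≤ 2 * (C * (2 * (x + e1)) + e2) := by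
        gcongr; exact a1.trans (by gcongr)
    _ ≤ 2 * (C * (2 * (x + e1)) + e2) + (4 * C * e2 + 2 * e2 + 4 * x + 4 * e1) := le_self_add
    _ = _ := by push_cast; ring

lemma AR.fkW (hA : AR n d C₀ Γ) : ∃ C : ℝ≥0, ∀ S T φ H, W0 d Γ S φ H → Bornology.IsBounded S →
    MeasurableSet T → Function.support φ ⊆ T → volume T ≠ ∞ →
    N2 (mm d Γ) φ ≤ C * (volume T ^ (1 / n : ℝ)) ^ 2 * N2 (mm d Γ) H := by
  obtain ⟨C, hC⟩ := hA.fk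
  obtain ⟨C', hC'⟩ := hA.hardyW
  refine ⟨32 * C, fun S T φ H h hS hT hφ hv => ?_⟩
  obtain ⟨P, h1, h2, h3, h4⟩ := h.ex
  obtain ⟨R, hR⟩ := hS.subset_ball 0
  obtain ⟨K, hK⟩ := hA.vL2 (F := ℝ) 0 R
  have key : ∀ f : Eu n → ℝ, Function.support f ⊆ S → Measurable f → N2 (mm d Γ) f ≤ K * N2 (m2 d Γ) f := by
    intro f hf hm
    refine le_trans (le_of_eq ?_) (hK f hm)
    unfold N2
    rw [setLIntegral_eq_of_support_subset]
    intro X hX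
    refine hR (hf fun h0 => hX ?_)
    simp [h0]
  have hfin : N2 (mm d Γ) φ ≠ ∞ := by
    refine (((key φ h.sp h.m1).trans (mul_le_mul_right (hC' _ _ _ h) _)).trans_lt ?_).ne
    have := h.gfin hA
    finiteness
  set A := N2 (mm d Γ) φ with hAd
  set B := N2 (mm d Γ) H
  have hB : B ≠ ∞ := h.gfin hA
  have e4 : Tendsto (fun j => N2 (mm d Γ) (P j - φ)) atTop (𝓝 0) :=
    lim0 h4 fun j => key _ ((Function.support_sub _ _).trans (union_subset (h2 j) h.sp))
      ((h1 j).c1.continuous.measurable.sub h.m1)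
  have hV : volume T ^ (1 / n : ℝ) ≠ ∞ := ENNReal.rpow_ne_top_of_nonneg (by positivity) hv
  set V := volume T ^ (1 / n : ℝ)
  refine sq_div hfin ?_
  have L : Tendsto (fun j => 8 * (4 * C * V ^ 2 * ((A + N2 (mm d Γ) (P j - φ)) * (B + N2 (mm d Γ) (nb (P j) - H)))
      + N2 (mm d Γ) (P j - φ) ^ 2)) atTop (𝓝 (8 * (4 * C * V ^ 2 * ((A + 0) * (B + 0)) + 0 ^ 2))) := by
    refine ENNReal.Tendsto.const_mul ((ENNReal.Tendsto.const_mul (ENNReal.Tendsto.mul (tendsto_const_nhds.add e4) ?_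
      (tendsto_const_nhds.add h3) ?_) ?_).add ?_) ?_
    · right; simpa using hB
    · right; simpa using hfin
    · right; finiteness
    · exact ((ENNReal.continuous_pow 2).tendsto 0).comp e4
    · right; simp
  refine (ge_of_tendsto' L fun j => ?_).trans (le_of_eq (by push_cast; simp only [add_zero]; ring))
  set e1 := N2 (mm d Γ) (nb (P j) - H)
  set e2 := N2 (mm d Γ) (P j - φ)
  have a1 := hC (P j) (h1 j) T hT
  simp_rw [← nb_enorm] at a1
  have a2 : A ≤ 2 * ((∫⁻ X in T, ‖P j X‖ₑ ^ 2 ∂(mm d Γ)) + e2) := by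
    have b1 := tri (μ := (mm d Γ).restrict T) (h1 j).c1.continuous.measurable h.m1
    have b2 : N2 ((mm d Γ).restrict T) φ = A := by
      unfold N2 at hAd ⊢
      rw [hAd, setLIntegral_eq_of_support_subset]
      intro X hX
      refine hφ fun h0 => hX ?_
      simp [h0]
    rw [b2] at b1
    refine b1.trans ?_
    exact mul_le_mul_right (add_le_add_right (setLIntegral_le_lintegral _ _) _) _
  set q := ∫⁻ X in T, ‖P j X‖ₑ ^ 2 ∂(mm d Γ)
  have a3 : N2 (mm d Γ) (P j) ≤ 2 * (A + e2) := by
    have := tri (μ := mm d Γ) h.m1 (h1 j).c1.continuous.measurable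
    rwa [N2_symm] at this
  have a4 : N2 (mm d Γ) (nb (P j)) ≤ 2 * (B + e1) := by
    have := tri (μ := mm d Γ) h.m2 (nb_meas (h1 j).c1)
    rwa [N2_symm] at this
  calc A ^ 2 ≤ (2 * (q + e2)) ^ 2 := by gcongr
    _ = 4 * (q + e2) ^ 2 := by ring
    _ ≤ 4 * (2 * (q ^ 2 + e2 ^ 2)) := by gcongr; exact en_sq _ _
    _ ≤ 4 * (2 * (C * V ^ 2 * ((2 * (A + e2)) * (2 * (B + e1))) + e2 ^ 2)) := by
        gcongr; exact a1.trans (by gcongr; exacts [a3, a4])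
    _ = _ := by ring

lemma AR.vL3 (hA : AR n d C₀ Γ) {P : ℕ → Eu n → ℝ} {φ : Eu n → ℝ} (hP : ∀ j, Measurable (P j)) (hφ : Measurable φ)
    (h4 : Tendsto (fun j => N2 (m2 d Γ) (P j - φ)) atTop (𝓝 0)) (y : Eu n) (ρ : ℝ) :
    Tendsto (fun j => ∫⁻ X in ball y ρ, ‖(φ - P j) X‖ₑ) atTop (𝓝 0) := by
  obtain ⟨K, hK⟩ := hA.vL2 (F := ℝ) y ρ
  obtain ⟨K', hK'⟩ := hA.vL1 (F := ℝ) y ρ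
  exact sq0 (lim0 (K := K' * K) h4 fun j => by
      have hm : Measurable (φ - P j) := hφ.sub (hP j)
      have := hK' ((ball y ρ).indicator (φ - P j)) (hm.indicator measurableSet_ball)
      rw [ENNReal.coe_mul, mul_assoc, N2_symm]
      refine le_trans (le_of_eq ?_) (this.trans (mul_le_mul_right (le_trans (le_of_eq ?_) (hK _ hm)) _))
      · congr 1; exact setLIntegral_congr_fun measurableSet_ball fun X hX => by simp only [indicator_of_mem hX]
      · unfold N2; rw [← lintegral_indicator measurableSet_ball]
        refine lintegral_congr fun X => ?_
        by_cases hX : X ∈ ball y ρ <;> simp [hX])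

lemma AR.pbW (hA : AR n d C₀ Γ) : ∃ C : ℝ≥0, ∀ S φ H, W0 d Γ S φ H → ∀ y ∈ Γ, ∀ ρ : ℝ, 0 < ρ →
    ofReal (ρ ^ d) * ∫⁻ X in ball y ρ, ‖φ X‖ₑ ≤
      C * ofReal (ρ ^ n) * ∫⁻ X in ball y (4 * ρ), ‖H X‖ₑ ∂(mm d Γ) := by
  obtain ⟨C, hC⟩ := hA.pb
  refine ⟨C, fun S φ H h y hy ρ hρ => ?_⟩
  obtain ⟨P, h1, -, h3, h4⟩ := h.ex
  have e1 : Tendsto (fun j => ∫⁻ X in ball y (4 * ρ), ‖(nb (P j) - H) X‖ₑ ∂(mm d Γ)) atTop (𝓝 0) :=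
    sq0 (lim0 (K := (mm d Γ (ball y (4 * ρ))).toNNReal) h3 fun j => by
      rw [ENNReal.coe_toNNReal (hA.mfin _ _).ne]
      exact N2_L1 ((nb_meas (h1 j).c1).sub h.m2) _)
  have e2 := hA.vL3 (fun j => (h1 j).c1.continuous.measurable) h.m1 h4 y ρ
  have e3 := (ENNReal.Tendsto.const_mul (a := C * ofReal (ρ ^ n)) e1 (Or.inr (by finiteness))).add
    (ENNReal.Tendsto.const_mul (a := ofReal (ρ ^ d)) e2 (Or.inr (by finiteness)))
  simp only [mul_zero, add_zero] at e3
  rw [← one_mul (C * ofReal _ * _)]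
  refine lim1 e3 (by simp) fun j => ?_
  have a1 := hC (P j) (h1 j).c1 y hy ρ hρ fun z hz => ((h1 j).zero hz.1).self_of_nhds
  simp_rw [← nb_enorm] at a1
  have a2 := triL (μ := volume.restrict (ball y ρ)) (f := P j) (g := φ) (h1 j).c1.continuous.measurable
  have a3 := triL (μ := (mm d Γ).restrict (ball y (4 * ρ))) (f := H) (g := nb (P j)) h.m2
  calc _ ≤ _ := mul_le_mul_right a2 _
    _ ≤ C * ofReal (ρ ^ n) * _ + _ := by
      rw [mul_add]; exact add_le_add_left (a1.trans (mul_le_mul_right a3 _)) _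
    _ = _ := by ring

lemma AR.pinW (hA : AR n d C₀ Γ) : ∃ C : ℝ≥0, ∀ S φ H, W0 d Γ S φ H → ∀ (y : Eu n) (ρ : ℝ), 0 < ρ →
    ∫⁻ Y in ball y ρ, ∫⁻ X in ball y ρ, ‖φ X - φ Y‖ₑ ≤
      C * ofReal (ρ ^ (n + 1)) * ∫⁻ X in ball y (4 * ρ), ‖H X‖ₑ := by
  obtain ⟨C, hC⟩ := pin hA.two
  refine ⟨C, fun S φ H h y ρ hρ => ?_⟩
  obtain ⟨P, h1, -, h3, h4⟩ := h.ex
  obtain ⟨K'', hK''⟩ := hA.vL1 (F := Eu n) y (4 * ρ)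
  have e1 : Tendsto (fun j => ∫⁻ X in ball y (4 * ρ), ‖(nb (P j) - H) X‖ₑ) atTop (𝓝 0) :=
    sq0 (lim0 (K := K'') h3 fun j => hK'' _ ((nb_meas (h1 j).c1).sub h.m2))
  have e2 := hA.vL3 (fun j => (h1 j).c1.continuous.measurable) h.m1 h4 y ρ
  have hv : volume (ball y ρ) ≠ ∞ := measure_ball_lt_top.ne
  have e3 := (ENNReal.Tendsto.const_mul (a := C * ofReal (ρ ^ (n + 1))) e1 (Or.inr (by finiteness))).add
    (ENNReal.Tendsto.const_mul (a := 2 * volume (ball y ρ)) e2 (Or.inr (by finiteness)))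
  simp only [mul_zero, add_zero] at e3
  rw [← one_mul (C * ofReal _ * _)]
  refine lim1 e3 (by simp) fun j => ?_
  have a1 := hC (P j) (h1 j).c1 y ρ hρ
  simp_rw [← nb_enorm] at a1
  have a3 := triL (μ := volume.restrict (ball y (4 * ρ))) (f := H) (g := nb (P j)) h.m2
  have hm1 := h.m1
  have hm2 := (h1 j).c1.continuous.measurable
  have a2 : ∫⁻ Y in ball y ρ, ∫⁻ X in ball y ρ, ‖φ X - φ Y‖ₑ ≤ (∫⁻ Y in ball y ρ, ∫⁻ X in ball y ρ, ‖P j X - P j Y‖ₑ) +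
      2 * volume (ball y ρ) * ∫⁻ X in ball y ρ, ‖(φ - P j) X‖ₑ := by
    calc _ ≤ ∫⁻ Y in ball y ρ, ∫⁻ X in ball y ρ, (‖P j X - P j Y‖ₑ + (‖(φ - P j) X‖ₑ + ‖(φ - P j) Y‖ₑ)) := by
          refine lintegral_mono fun Y => lintegral_mono fun X => ?_
          have b1 := en_add (P j X - P j Y) ((φ - P j) X - (φ - P j) Y)
          have b2 := en_add ((φ - P j) X) (-(φ - P j) Y)
          rw [enorm_neg, ← sub_eq_add_neg] at b2
          refine le_trans (le_of_eq ?_) (b1.trans (add_le_add_right b2 _))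
          congr 1; simp only [Pi.sub_apply]; ring
      _ = _ := by
          have hj : Measurable fun Y : Eu n => ∫⁻ X in ball y ρ, ‖P j X - P j Y‖ₑ :=
            Measurable.lintegral_prod_left (f := fun X Y => ‖P j X - P j Y‖ₑ)
              (((hm2.comp measurable_fst).sub (hm2.comp measurable_snd)).enorm)
          have : ∀ Y, ∫⁻ X in ball y ρ, (‖P j X - P j Y‖ₑ + (‖(φ - P j) X‖ₑ + ‖(φ - P j) Y‖ₑ)) =
              (∫⁻ X in ball y ρ, ‖P j X - P j Y‖ₑ) + ((∫⁻ X in ball y ρ, ‖(φ - P j) X‖ₑ) +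
                ‖(φ - P j) Y‖ₑ * volume (ball y ρ)) := fun Y => by
            rw [lintegral_add_left (by fun_prop), lintegral_add_left (by fun_prop), setLIntegral_const]
          simp_rw [this]
          rw [lintegral_add_left hj, lintegral_add_left measurable_const, setLIntegral_const,
            lintegral_mul_const' _ _ hv]
          ring
  calc _ ≤ _ := a2
    _ ≤ C * ofReal (ρ ^ (n + 1)) * _ + _ := add_le_add_left (a1.trans (mul_le_mul_right a3 _)) _
    _ = _ := by ring

lemma aesub {μ : Measure (Eu n)} {P : ℕ → Eu n → ℝ} {φ : Eu n → ℝ} (hP : ∀ j, Measurable (P j)) (hφ : Measurable φ)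
    (h : Tendsto (fun j => N2 μ (P j - φ)) atTop (𝓝 0)) :
    ∃ s : ℕ → ℕ, StrictMono s ∧ ∀ᵐ X ∂μ, Tendsto (fun j => P (s j) X) atTop (𝓝 (φ X)) := by
  refine (tendstoInMeasure_of_tendsto_eLpNorm (p := 2) (by norm_num) (fun j => (hP j).aestronglyMeasurable)
    hφ.aestronglyMeasurable (sq0 (h.congr fun j => ?_))).exists_seq_tendsto_ae
  rw [eLpNorm_eq_lintegral_rpow_enorm_toReal (by norm_num) (by norm_num)]
  simp only [ENNReal.toReal_ofNat, ENNReal.rpow_two]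
  rw [← ENNReal.rpow_two, ← ENNReal.rpow_mul]; norm_num [N2]

lemma nb_mul {η v : Eu n → ℝ} {F : ℝ → ℝ} (hη : ContDiff ℝ 1 η) (hv : ContDiff ℝ 1 v) (hF : ContDiff ℝ 1 F) (X : Eu n) :
    nb (fun X => η X * F (v X)) X = (η X * deriv F (v X)) • nb v X + F (v X) • nb η X := by
  have h1 := (hη.differentiable one_ne_zero X).hasFDerivAt
  have h2 := ((hF.differentiable one_ne_zero (v X)).hasDerivAt.comp_hasFDerivAt X
    (hv.differentiable one_ne_zero X).hasFDerivAt)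
  have h3 := (h1.mul h2).fderiv
  simp only [nb, gradient]
  erw [h3]
  simp [smul_smul]

lemma W0.test (hA : AR n d C₀ Γ) {u g η : Eu n → ℝ} {G : Eu n → Eu n} (hg : ContDiff ℝ 1 g)
    (hw : W0 d Γ univ (u - g) (G - nb g)) (hum : Measurable u) (hGm : Measurable G) (hG : N2 (mm d Γ) G ≠ ∞)
    (hη : ContDiff ℝ 1 η) {M : ℝ≥0} (hM : ∀ X, ‖η X‖ₑ ≤ M ∧ ‖nb η X‖ₑ ≤ M) {k R : ℝ}
    (hΓ : ∀ X ∈ Γ, X ∈ tsupport η → g X < k)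
    (hR : ∀ X, R ≤ ‖X‖ → nb η X = 0 ∧ (η X = 0 ∨ g X < k)) {F : ℝ → ℝ} (hF : ContDiff ℝ 1 F)
    {L : ℝ≥0} (hL : ∀ t, ‖deriv F t‖₊ ≤ L) (hF0 : ∀ t ≤ k, F t = 0) :
    W0 d Γ (Function.support η) (fun X => η X * F (u X))
      (fun X => (η X * deriv F (u X)) • G X + F (u X) • nb η X) := by
  have hdF : Measurable (deriv F) := (hF.continuous_deriv le_rfl).measurable
  have hnη := nb_meas hη
  have hηm := hη.continuous.measurable
  have hFm := hF.continuous.measurable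
  obtain ⟨Q, q1, -, q3, q4⟩ := hw.ex
  obtain ⟨s, hs, hsc⟩ := aesub (fun j => (q1 j).c1.continuous.measurable) hw.m1 q4
  have hsc := (mac (d := d) (Γ := Γ)).ae_le (hA.ac2.ae_le hsc)
  set P := fun j => Q (s j) with hP
  have h1 : ∀ j, CC Γ (P j) := fun j => q1 _
  have h3 : Tendsto (fun j => N2 (mm d Γ) (nb (P j) - (G - nb g))) atTop (𝓝 0) := q3.comp hs.tendsto_atTop
  have h4 : Tendsto (fun j => N2 (EM.m2 d Γ) (P j - (u - g))) atTop (𝓝 0) := q4.comp hs.tendsto_atTop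
  set v : ℕ → Eu n → ℝ := fun j => P j + g
  have hv : ∀ j, ContDiff ℝ 1 (v j) := fun j => (h1 j).c1.add hg
  have hvm : ∀ j, Measurable (v j) := fun j => (hv j).continuous.measurable
  have hnv : ∀ j, nb (v j) = nb (P j) + nb g := fun j => nb_add (h1 j).c1 hg
  have hvm' : ∀ j, Measurable (nb (v j)) := fun j => nb_meas (hv j)
  have lip : ∀ a b, ‖F a - F b‖ₑ ≤ L * ‖a - b‖ₑ := fun a b => by
    have := (lipschitzWith_of_nnnorm_deriv_le (hF.differentiable one_ne_zero) hL) a b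
    simpa [edist_eq_enorm_sub] using this
  refine ⟨by fun_prop, by fun_prop, fun X hX => ?_, fun j X => η X * F (v j X), fun j => ?_, fun j X hX => ?_, ?_, ?_⟩
  · exact fun h0 => hX (by simp [h0])
  · obtain ⟨R', hR'⟩ := (h1 j).cs.isCompact.isBounded.subset_closedBall 0
    refine ⟨hη.mul (hF.comp (hv j)), HasCompactSupport.intro (isCompact_closedBall (0 : Eu n) (max R R')) fun X hX => ?_,
      fun X hX hXΓ => ?_⟩
    · simp only [mem_closedBall, dist_zero_right, not_le, max_lt_iff] at hX
      have : P j X = 0 := image_eq_zero_of_notMem_tsupport fun h => by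
        have := hR' h; simp at this; linarith [hX.2]
      rcases (hR X hX.1.le).2 with h | h
      · simp [h]
      · simp [v, this, hF0 _ h.le]
    · by_cases hXη : X ∈ tsupport η
      · refine notMem_tsupport_iff_eventuallyEq.2 ?_ hX
        filter_upwards [(h1 j).zero hXΓ, hg.continuous.continuousAt.eventually_lt continuousAt_const (hΓ X hXΓ hXη)] with Y h1 h2
        simp only [v, Pi.add_apply, h1, Pi.zero_apply, zero_add]
        rw [hF0 _ h2.le, mul_zero]
      · exact hXη (tsupport_mul_subset_left hX)
  · exact fun h0 => hX (by simp [h0])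
  · have e1 : Tendsto (fun j => N2 (mm d Γ) (fun X => (η X * deriv F (v j X)) • (nb (v j) X - G X))) atTop (𝓝 0) := by
      refine lim0 (K := (M * L) ^ 2) h3 fun j => ?_
      unfold N2
      rw [← lintegral_const_mul' _ _ ENNReal.coe_ne_top]
      refine lintegral_mono fun X => ?_
      rw [enorm_smul, mul_pow, enorm_mul]
      have : nb (v j) X - G X = (nb (P j) - (G - nb g)) X := by simp [hnv]; abel
      rw [this]
      push_cast
      gcongr
      · exact (hM X).1
      · exact ENNReal.coe_le_coe.2 (hL _)
    have e2 : Tendsto (fun j => N2 (mm d Γ) (fun X => (η X * (deriv F (v j X) - deriv F (u X))) • G X)) atTop (𝓝 0) := by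
      have := tendsto_lintegral_of_dominated_convergence (μ := mm d Γ)
        (F := fun j X => ‖(η X * (deriv F (v j X) - deriv F (u X))) • G X‖ₑ ^ 2) (f := fun _ => 0)
        (fun X => (M * (2 * L)) ^ 2 * ‖G X‖ₑ ^ 2) (fun j => by have := hvm j; fun_prop) (fun j => ae_of_all _ fun X => ?_) ?_ ?_
      · simpa [N2] using this
      · beta_reduce
        rw [enorm_smul, mul_pow, enorm_mul]
        gcongr
        · exact (hM X).1
        · rw [sub_eq_add_neg, two_mul]
          refine (en_add _ _).trans (add_le_add (ENNReal.coe_le_coe.2 (hL _)) ?_)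
          rw [enorm_neg]; exact ENNReal.coe_le_coe.2 (hL _)
      · rw [lintegral_const_mul' _ _ (by finiteness)]
        unfold N2 at hG
        finiteness
      · filter_upwards [hsc] with X hX
        have : Tendsto (fun j => v j X) atTop (𝓝 (u X)) := by
          have := hX.add_const (g X)
          simpa [v, hP] using this
        have : Tendsto (fun j => (η X * (deriv F (v j X) - deriv F (u X))) • G X) atTop (𝓝 ((η X * (deriv F (u X) - deriv F (u X))) • G X)) :=
          ((((hF.continuous_deriv le_rfl).tendsto _).comp this).sub_const _ |>.const_mul _).smul_const _
        simpa [en_zero, Function.comp_def] using ((ENNReal.continuous_pow 2).tendsto _).comp this.enorm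
    have e3 : Tendsto (fun j => N2 (mm d Γ) (fun X => (F (v j X) - F (u X)) • nb η X)) atTop (𝓝 0) := by
      obtain ⟨K, hK⟩ := hA.vL2 (F := ℝ) 0 R
      refine lim0 (K := (L * M) ^ 2 * K) h4 fun j => ?_
      rw [ENNReal.coe_mul, mul_assoc]
      refine le_trans ?_ (mul_le_mul_right (hK _ ((h1 j).c1.continuous.measurable.sub (hum.sub hg.continuous.measurable))) _)
      rw [← lintegral_const_mul' _ _ ENNReal.coe_ne_top, ← lintegral_indicator measurableSet_ball]
      refine lintegral_mono fun X => ?_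
      by_cases hX : X ∈ ball 0 R
      · rw [indicator_of_mem hX, enorm_smul, mul_pow]
        have : (P j - (u - g)) X = v j X - u X := by simp [v]; abel
        rw [this]
        calc _ ≤ (L * ‖v j X - u X‖ₑ) ^ 2 * (M:ℝ≥0∞) ^ 2 := by gcongr; exacts [lip _ _, (hM X).2]
          _ = _ := by push_cast; ring
      · beta_reduce
        rw [(hR X (by simpa using hX)).1]; simp [en_zero]
    have e := ENNReal.Tendsto.const_mul (a := 2) (ENNReal.Tendsto.const_mul (a := 2) (e1.add e2) (Or.inr (by simp)) |>.add e3)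
      (Or.inr (by simp))
    simp only [add_zero, mul_zero] at e
    refine lim0 (K := 1) e fun j => ?_
    have := hvm j
    have := hvm' j
    rw [ENNReal.coe_one, one_mul]
    refine le_trans (le_of_eq ?_) ((N2_add (by fun_prop)).trans (mul_le_mul_right (add_le_add_left (N2_add (by fun_prop)) _) _))
    congr 1
    ext1 X
    simp only [Pi.sub_apply, Pi.add_apply]
    rw [nb_mul hη (hv j) hF]
    module
  · refine lim0 (K := (M * L) ^ 2) h4 fun j => ?_
    unfold N2
    rw [← lintegral_const_mul' _ _ ENNReal.coe_ne_top]
    refine lintegral_mono fun X => ?_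
    have : (P j - (u - g)) X = v j X - u X := by simp [v]; abel
    rw [this, Pi.sub_apply, ← mul_sub, enorm_mul]
    calc _ ≤ (M * (L * ‖v j X - u X‖ₑ)) ^ 2 := by gcongr; exacts [(hM X).1, lip _ _]
      _ = _ := by push_cast; ring

def LL (d : ℝ) (Γ : Set (Eu n)) (G : Eu n → Eu n) : Prop := Measurable G ∧ N2 (mm d Γ) G ≠ ∞

structure Fm (d : ℝ) (Γ : Set (Eu n)) (Λ : ℝ≥0) (b : (Eu n → Eu n) → (Eu n → Eu n) → ℝ) : Prop where
  add₁ : ∀ {G G' H}, LL d Γ G → LL d Γ G' → LL d Γ H → b (G + G') H = b G H + b G' H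
  add₂ : ∀ {G H H'}, LL d Γ G → LL d Γ H → LL d Γ H' → b G (H + H') = b G H + b G H'
  smul₁ : ∀ {G H} (c : ℝ), LL d Γ G → LL d Γ H → b (c • G) H = c * b G H
  smul₂ : ∀ {G H} (c : ℝ), LL d Γ G → LL d Γ H → b G (c • H) = c * b G H
  bd : ∀ {G H}, LL d Γ G → LL d Γ H → ofReal |b G H| ≤ Λ * ∫⁻ X, ‖G X‖ₑ * ‖H X‖ₑ ∂(mm d Γ)
  co : ∀ {G} {f : Eu n → ℝ} {M : ℝ}, LL d Γ G → Measurable f → (∀ X, 0 ≤ f X ∧ f X ≤ M) →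
    ∫⁻ X, ofReal (f X) * ‖G X‖ₑ ^ 2 ∂(mm d Γ) ≤ Λ * ofReal (b G fun X => f X • G X)

structure Sol (d : ℝ) (Γ : Set (Eu n)) (b : (Eu n → Eu n) → (Eu n → Eu n) → ℝ) (u : Eu n → ℝ) (G : Eu n → Eu n)
    (g : Eu n → ℝ) : Prop where
  g1 : ContDiff ℝ 1 g
  gc : ∃ c R : ℝ, ∀ X, R ≤ ‖X‖ → g X = c
  w : W0 d Γ univ (u - g) (G - nb g)
  um : Measurable u
  Gl : LL d Γ G
  eq : ∀ φ H, W0 d Γ univ φ H → b G H = 0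

lemma LL.smul {G : Eu n → Eu n} (h : LL d Γ G) (c : ℝ) : LL d Γ (c • G) :=
  ⟨h.1.const_smul c, by rw [N2_smul]; have := h.2; finiteness⟩

lemma LL.add {G H : Eu n → Eu n} (h : LL d Γ G) (h' : LL d Γ H) : LL d Γ (G + H) :=
  ⟨h.1.add h'.1, ((N2_add h.1).trans_lt (by have := h.2; have := h'.2; finiteness)).ne⟩

lemma LL.mul {G : Eu n → Eu n} (h : LL d Γ G) {f : Eu n → ℝ} (hf : Measurable f) {M : ℝ≥0} (hM : ∀ X, ‖f X‖ₑ ≤ M) :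
    LL d Γ fun X => f X • G X := by
  refine ⟨hf.smul h.1, ne_top_of_le_ne_top (b := (M:ℝ≥0∞) ^ 2 * N2 (mm d Γ) G) (by have := h.2; finiteness) ?_⟩
  unfold N2
  rw [← lintegral_const_mul' _ _ (by finiteness)]
  refine lintegral_mono fun X => ?_
  rw [enorm_smul, mul_pow]
  gcongr; exact hM X

lemma prim {ψ : ℝ → ℝ} (hψ : Continuous ψ) {k : ℝ} (h0 : ∀ t ≤ k, ψ t = 0) :
    ContDiff ℝ 1 (fun t => ∫ s in k..t, ψ s) ∧ deriv (fun t => ∫ s in k..t, ψ s) = ψ ∧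
      ∀ t ≤ k, ∫ s in k..t, ψ s = 0 := by
  have hd : ∀ t, HasDerivAt (fun t => ∫ s in k..t, ψ s) (ψ t) t := fun t => hψ.integral_hasStrictDerivAt k t |>.hasDerivAt
  have hd' : deriv (fun t => ∫ s in k..t, ψ s) = ψ := funext fun t => (hd t).deriv
  refine ⟨contDiff_one_iff_deriv.2 ⟨fun t => (hd t).differentiableAt, by rwa [hd']⟩, hd', fun t ht => ?_⟩
  rw [intervalIntegral.integral_congr (g := fun _ => 0)]
  · simp
  · intro s hs
    rw [uIcc_of_ge ht] at hs
    exact h0 s hs.2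

lemma Sol.eng (hA : AR n d C₀ Γ) {Λ : ℝ≥0} {b} (hb : Fm d Γ Λ b) {u G g} (hs : Sol d Γ b u G g) {η : Eu n → ℝ}
    (hη : ContDiff ℝ 1 η) {M : ℝ≥0} (hM : ∀ X, ‖η X‖ₑ ≤ M ∧ ‖nb η X‖ₑ ≤ M) {k R : ℝ}
    (hΓ : ∀ X ∈ Γ, X ∈ tsupport η → g X < k) (hR : ∀ X, R ≤ ‖X‖ → nb η X = 0 ∧ (η X = 0 ∨ g X < k))
    {ψ : ℝ → ℝ} (hψ : Continuous ψ) (h0 : ∀ t ≤ k, ψ t = 0) {L : ℝ≥0} (hL : ∀ t, ‖ψ t‖₊ ≤ L) {Q : Eu n → ℝ≥0∞}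
    (hQm : Measurable Q) (hQ : ∀ᵐ X, nb η X ≠ 0 → ‖∫ s in k..u X, ψ s ^ 2‖ₑ ≤ Q X * ‖ψ (u X)‖ₑ) :
    W0 d Γ (Function.support η) (fun X => η X * ∫ s in k..u X, ψ s)
      (fun X => (η X * ψ (u X)) • G X + (∫ s in k..u X, ψ s) • nb η X) ∧
    N2 (mm d Γ) (fun X => (η X * ψ (u X)) • G X) ≤ 4 * Λ ^ 4 * ∫⁻ X, (Q X * ‖nb η X‖ₑ) ^ 2 ∂(mm d Γ) := by
  have hGm := hs.Gl.1
  have hum := hs.um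
  have hnη := nb_meas hη
  have hηm := hη.continuous.measurable
  have hψm := hψ.measurable
  obtain ⟨p1, p2, p3⟩ := prim hψ h0
  obtain ⟨r1, r2, r3⟩ := prim (ψ := fun t => ψ t ^ 2) (by fun_prop) (k := k) (fun t ht => by simp [h0 t ht])
  constructor
  · have := W0.test hA hs.g1 hs.w hum hGm hs.Gl.2 hη hM hΓ hR p1 (L := L) (by rw [p2]; exact hL) p3
    rwa [p2] at this
  set F : ℝ → ℝ := fun t => ∫ s in k..t, ψ s ^ 2 with hF
  have hz : ∀ X, nb (fun X => η X * η X) X = (2 * η X) • nb η X := fun X => by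
    have := nb_mul hη hη contDiff_id X
    simp only [id, deriv_id'', deriv_id, mul_one] at this
    rw [this]; module
  have T := W0.test (η := fun X => η X * η X) hA hs.g1 hs.w hum hGm hs.Gl.2 (hη.mul hη) (M := M * M + 2 * M * M) (fun X => ?_)
    (fun X hX hX' => hΓ X hX (tsupport_mul_subset_left hX')) (R := R) (fun X hX => ?_) r1 (L := L ^ 2)
    (fun t => by rw [r2, nnnorm_pow]; exact pow_le_pow_left' (hL t) 2) r3
  rotate_left
  · rw [hz]
    constructor
    · rw [enorm_mul]; push_cast
      exact (mul_le_mul' (hM X).1 (hM X).1).trans le_self_add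
    · rw [enorm_smul, enorm_mul]; push_cast
      refine le_trans ?_ le_add_self
      have : ‖(2:ℝ)‖ₑ = 2 := by simp [enorm]
      rw [this]
      gcongr; exacts [(hM X).1, (hM X).2]
  · rw [hz]
    refine ⟨by rw [(hR X hX).1, smul_zero], (hR X hX).2.imp (fun h => by simp [h]) id⟩
  rw [r2] at T
  set H1 : Eu n → Eu n := fun X => (η X * ψ (u X)) ^ 2 • G X with hH1
  have hb0 : ∀ X, ‖(η X * ψ (u X)) ^ 2‖ ≤ (M * L) ^ 2 := fun X => by
    rw [norm_pow, norm_mul]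
    have h1 : ‖η X‖ ≤ M := by have := (hM X).1; rw [enorm_le_coe] at this; exact this
    have h2 : ‖ψ (u X)‖ ≤ L := hL _
    gcongr
  have L1 : LL d Γ H1 := hs.Gl.mul (M := (M * L) ^ 2) (by fun_prop) fun X => by
    rw [enorm_le_coe]; have := hb0 X; exact_mod_cast this
  have LT : LL d Γ _ := ⟨T.m2, T.gfin hA⟩
  set H2 : Eu n → Eu n := fun X => F (u X) • (2 * η X) • nb η X with hH2
  have hTe : (fun X => (η X * η X * ψ (u X) ^ 2) • G X + F (u X) • nb (fun X => η X * η X) X) = H1 + H2 := by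
    ext1 X; simp only [hH1, hH2, Pi.add_apply, hz]; module
  rw [hTe] at T LT
  have L2 : LL d Γ H2 := by
    have := LT.add (L1.smul (-1))
    rwa [show H1 + H2 + (-1:ℝ) • H1 = H2 by module] at this
  have e0 : b G H1 + b G H2 = 0 := by
    rw [← hb.add₂ hs.Gl L1 L2]; exact hs.eq _ _ (T.mono (subset_univ _))
  have c1 := hb.co (f := fun X => (η X * ψ (u X)) ^ 2) (M := (M * L) ^ 2) hs.Gl (by fun_prop)
    fun X => ⟨sq_nonneg _, (le_abs_self _).trans (hb0 X)⟩
  set A := N2 (mm d Γ) (fun X => (η X * ψ (u X)) • G X) with hAd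
  have hAf : A ≠ ∞ := (hs.Gl.mul (M := M * L) (f := fun X => η X * ψ (u X)) (by fun_prop) fun X => by
    rw [enorm_mul]; push_cast; exact mul_le_mul' (hM X).1 (ENNReal.coe_le_coe.2 (hL _))).2
  have hA1 : A = ∫⁻ X, ofReal ((η X * ψ (u X)) ^ 2) * ‖G X‖ₑ ^ 2 ∂(mm d Γ) := by
    rw [hAd]; refine lintegral_congr fun X => ?_
    rw [enorm_smul, mul_pow, ← ofReal_norm (η X * _), ← ofReal_pow (norm_nonneg _), Real.norm_eq_abs, sq_abs]
  have c2 : A ≤ Λ * (Λ * ∫⁻ X, ‖(η X * ψ (u X)) • G X‖ₑ * (2 * (Q X * ‖nb η X‖ₑ)) ∂(mm d Γ)) := by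
    rw [hA1]
    refine c1.trans (mul_le_mul_right ?_ _)
    refine (ofReal_le_ofReal (q := |b G H2|) ?_).trans ((hb.bd hs.Gl L2).trans (mul_le_mul_right ?_ _))
    · have : (b G fun X => (η X * ψ (u X)) ^ 2 • G X) = - b G H2 := by linarith
      rw [this]; exact neg_le_abs _
    · refine lintegral_mono_ae ?_
      filter_upwards [mac.ae_le hQ] with X hX
      simp only [hH2, enorm_smul, enorm_mul]
      by_cases h : nb η X = 0
      · simp [h, en_zero]
      · have : ‖(2:ℝ)‖ₑ = 2 := by simp [enorm]
        rw [this]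
        calc _ ≤ ‖G X‖ₑ * ((Q X * ‖ψ (u X)‖ₑ) * (2 * ‖η X‖ₑ * ‖nb η X‖ₑ)) := by gcongr; exact hX h
          _ = _ := by ring
  have c3 := cs (μ := mm d Γ) (f := fun X => ‖(η X * ψ (u X)) • G X‖ₑ) (g := fun X => 2 * (Q X * ‖nb η X‖ₑ))
    (by fun_prop) (by fun_prop)
  refine sq_div hAf ?_
  calc A ^ 2 ≤ _ := pow_le_pow_left' c2 2
    _ = Λ ^ 4 * (∫⁻ X, ‖(η X * ψ (u X)) • G X‖ₑ * (2 * (Q X * ‖nb η X‖ₑ)) ∂(mm d Γ)) ^ 2 := by ring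
    _ ≤ Λ ^ 4 * (A * (4 * ∫⁻ X, (Q X * ‖nb η X‖ₑ) ^ 2 ∂(mm d Γ))) := by
        refine mul_le_mul_right (c3.trans (le_of_eq ?_)) _
        rw [← lintegral_const_mul' 4 _ (by simp)]
        refine congrArg _ (lintegral_congr fun X => ?_)
        ring
    _ = _ := by ring

noncomputable def rmp (k h t : ℝ) : ℝ := max 0 (min 1 ((t - k) / h))

lemma rmp_cont (k h : ℝ) : Continuous (rmp k h) := by unfold rmp; fun_prop
lemma rmp_le (k h t : ℝ) : 0 ≤ rmp k h t ∧ rmp k h t ≤ 1 := ⟨le_max_left _ _, max_le zero_le_one (min_le_left _ _)⟩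
lemma rmp_zero {k h t : ℝ} (hh : 0 < h) (ht : t ≤ k) : rmp k h t = 0 :=
  max_eq_left ((min_le_right _ _).trans (div_nonpos_of_nonpos_of_nonneg (by linarith) hh.le))
lemma rmp_one {k h t : ℝ} (hh : 0 < h) (ht : k + h ≤ t) : rmp k h t = 1 := by
  have : 1 ≤ (t - k) / h := by rw [le_div_iff₀ hh]; linarith
  simp [rmp, this]
lemma rmp_mono {k h : ℝ} (hh : 0 < h) : Monotone (rmp k h) := fun a b hab => by unfold rmp; gcongr

lemma rmp_int {k h t : ℝ} (hh : 0 < h) (ht : k ≤ t) : t - (k + h) ≤ ∫ s in k..t, rmp k h s := by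
  have hi : ∀ a c, IntervalIntegrable (rmp k h) volume a c := fun a c => (rmp_cont k h).intervalIntegrable a c
  rcases le_total t (k + h) with h1 | h1
  · exact (by linarith : t - (k + h) ≤ 0).trans (intervalIntegral.integral_nonneg ht fun s _ => (rmp_le _ _ _).1)
  · rw [← intervalIntegral.integral_add_adjacent_intervals (hi k (k + h)) (hi _ t)]
    have a1 : 0 ≤ ∫ s in k..k + h, rmp k h s := intervalIntegral.integral_nonneg (by linarith) fun s _ => (rmp_le _ _ _).1
    have a2 : ∫ s in (k + h)..t, rmp k h s = t - (k + h) := by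
      rw [intervalIntegral.integral_congr (g := fun _ => 1) fun s hs => ?_]
      · simp
      · rw [uIcc_of_le h1] at hs; exact rmp_one hh hs.1
    linarith

lemma prim_le {f : ℝ → ℝ} (hf : Continuous f) (h0 : ∀ s, 0 ≤ f s) {k t B : ℝ} (ht : k ≤ t) (hB : ∀ s ∈ Icc k t, f s ≤ B) :
    ‖∫ s in k..t, f s‖ ≤ B * (t - k) := by
  have := intervalIntegral.norm_integral_le_of_norm_le_const (a := k) (b := t) (f := f) (C := B) fun s hs => by
    rw [uIoc_of_le ht] at hs
    rw [Real.norm_of_nonneg (h0 s)]; exact hB s ⟨hs.1.le, hs.2⟩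
  rwa [abs_of_nonneg (by linarith)] at this

lemma Sol.maxp (hA : AR n d C₀ Γ) {Λ : ℝ≥0} {b} (hb : Fm d Γ Λ b) {u G g} (hs : Sol d Γ b u G g) {η : Eu n → ℝ}
    (hη : ContDiff ℝ 1 η) {M : ℝ≥0} (hM : ∀ X, ‖η X‖ₑ ≤ M ∧ ‖nb η X‖ₑ ≤ M) {k R : ℝ}
    (hΓ : ∀ X ∈ Γ, X ∈ tsupport η → g X < k) (hR : ∀ X, R ≤ ‖X‖ → nb η X = 0 ∧ (η X = 0 ∨ g X < k))
    (hu : ∀ᵐ X, nb η X ≠ 0 → u X ≤ k) : ∀ᵐ X, η X ≠ 0 → u X ≤ k := by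
  obtain ⟨C, hC⟩ := hA.hardyW
  have hz : ∀ h : ℝ, 0 < h → ∀ t ≤ k, ∫ s in k..t, rmp k h s = 0 := fun h hh =>
    (prim (rmp_cont k h) (fun t ht => rmp_zero hh ht)).2.2
  have key : ∀ h : ℝ, 0 < h → ∀ᵐ X, η X ≠ 0 → u X ≤ k + h := fun h hh => by
    obtain ⟨e1, e2⟩ := hs.eng hA hb hη hM hΓ hR (rmp_cont k h) (fun t ht => rmp_zero hh ht) (L := 1)
      (fun t => by
        rw [← NNReal.coe_le_coe, coe_nnnorm, Real.norm_of_nonneg (rmp_le _ _ _).1]; exact (rmp_le _ _ _).2)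
      (Q := 0) measurable_const (by
        filter_upwards [hu] with X hX hX'
        rw [(prim (ψ := fun s => rmp k h s ^ 2) ((rmp_cont k h).pow 2) (k := k) fun t ht => by simp [rmp_zero hh ht]).2.2 _ (hX hX')]
        simp)
    simp only [Pi.zero_apply, zero_mul, ne_eq, OfNat.ofNat_ne_zero, not_false_eq_true, zero_pow, lintegral_const,
      mul_zero, nonpos_iff_eq_zero] at e2
    have e3 := hC _ _ _ e1
    have e4 : N2 (mm d Γ) (fun X => (η X * rmp k h (u X)) • G X + (∫ s in k..u X, rmp k h s) • nb η X) = 0 := by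
      rw [← e2]
      refine lintegral_congr_ae ?_
      filter_upwards [mac.ae_le hu] with X hX
      by_cases h0 : nb η X = 0
      · simp [h0]
      · simp [hz h hh _ (hX h0)]
    rw [e4, mul_zero, nonpos_iff_eq_zero] at e3
    unfold N2 at e3
    rw [lintegral_eq_zero_iff (e1.m1.enorm.pow_const 2)] at e3
    filter_upwards [hA.ac2.ae_le e3] with X hX hηX
    simp only [Pi.zero_apply, ne_eq, OfNat.ofNat_ne_zero, not_false_eq_true, pow_eq_zero_iff, enorm_eq_zero, mul_eq_zero, hηX, false_or] at hX
    rcases le_total (u X) k with h1 | h1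
    · linarith
    · have := rmp_int hh h1; linarith
  have : ∀ᵐ X, ∀ j : ℕ, η X ≠ 0 → u X ≤ k + 1 / ((j:ℝ) + 1) := ae_all_iff.2 fun j => key _ (by positivity)
  filter_upwards [this] with X hX hηX
  have := tendsto_one_div_add_atTop_nhds_zero_nat (𝕜 := ℝ) |>.const_add k
  rw [add_zero] at this
  exact ge_of_tendsto' this fun j => hX j hηX

lemma cutoff : ∃ C : ℝ, 0 < C ∧ ∀ (y : Eu n) (r r' : ℝ), 0 < r' → r' < r → ∃ η : Eu n → ℝ, ContDiff ℝ (⊤ : ℕ∞) η ∧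
    (∀ X, 0 ≤ η X ∧ η X ≤ 1) ∧ (∀ X ∈ ball y r', η X = 1) ∧ tsupport η ⊆ ball y r ∧
    ∀ X, ‖nb η X‖ ≤ C / (r - r') := by
  have hs : ContDiff ℝ 1 Real.smoothTransition := Real.smoothTransition.contDiff
  obtain ⟨C, hC⟩ : ∃ C, ∀ t, ‖deriv Real.smoothTransition t‖ ≤ C := by
    refine (hs.continuous_deriv le_rfl).bounded_above_of_compact_support
      (HasCompactSupport.intro (isCompact_Icc (a := (0:ℝ)) (b := 1)) fun t ht => ?_)
    simp only [mem_Icc, not_and_or, not_le] at ht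
    rcases ht with ht | ht
    · rw [(Filter.EventuallyEq.deriv_eq (f := fun _ => (0:ℝ)) (x := t) ?_), deriv_const]
      filter_upwards [gt_mem_nhds ht] with s hs using Real.smoothTransition.zero_of_nonpos hs.le
    · rw [(Filter.EventuallyEq.deriv_eq (f := fun _ => (1:ℝ)) (x := t) ?_), deriv_const]
      filter_upwards [lt_mem_nhds ht] with s hs using Real.smoothTransition.one_of_one_le hs.le
  have hC0 : 0 ≤ C := (norm_nonneg _).trans (hC 0)
  refine ⟨4 * C + 1, by linarith, fun y r r' h0 hr => ?_⟩
  set q := (r + r') / 2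
  have hq : r' < q := by simp only [q]; linarith
  have hq' : q < r := by simp only [q]; linarith
  have hD : 0 < q ^ 2 - r' ^ 2 := by nlinarith
  have hqc : ContDiff ℝ (⊤ : ℕ∞) fun X : Eu n => (q ^ 2 - ‖X - y‖ ^ 2) / (q ^ 2 - r' ^ 2) :=
    (contDiff_const.sub ((contDiff_id.sub contDiff_const).norm_sq ℝ)).div_const _
  refine ⟨fun X => Real.smoothTransition ((q ^ 2 - ‖X - y‖ ^ 2) / (q ^ 2 - r' ^ 2)),
    Real.smoothTransition.contDiff.comp hqc,
    fun X => ⟨Real.smoothTransition.nonneg _, Real.smoothTransition.le_one _⟩, fun X hX => ?_, ?_, fun X => ?_⟩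
  · rw [mem_ball, dist_eq_norm] at hX
    refine Real.smoothTransition.one_of_one_le ?_
    rw [one_le_div hD]; nlinarith [norm_nonneg (X - y)]
  · refine (closure_minimal (fun X hX => ?_) isClosed_closedBall).trans (closedBall_subset_ball hq')
    by_contra hX'
    rw [mem_closedBall, dist_eq_norm, not_le] at hX'
    exact hX (Real.smoothTransition.zero_of_nonpos (div_nonpos_of_nonpos_of_nonneg (by nlinarith) hD.le))
  · by_cases hX : ‖X - y‖ ≤ q
    · have d1 : HasFDerivAt (fun X : Eu n => (q ^ 2 - ‖X - y‖ ^ 2) / (q ^ 2 - r' ^ 2)) _ X :=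
        (hqc.differentiable (by simp) X).hasFDerivAt
      have d2 : HasFDerivAt (fun X : Eu n => (q ^ 2 - ‖X - y‖ ^ 2) / (q ^ 2 - r' ^ 2))
          ((q ^ 2 - r' ^ 2)⁻¹ • (-((2 : ℕ) • (innerSL ℝ (X - y)).comp (ContinuousLinearMap.id ℝ (Eu n))) : Eu n →L[ℝ] ℝ)) X := by
        simp_rw [div_eq_inv_mul]
        exact (((hasFDerivAt_id X).sub_const y).norm_sq.const_sub (q ^ 2)).const_mul _
      have d3 := ((hs.differentiable one_ne_zero _).hasDerivAt.comp_hasFDerivAt X d2).fderiv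
      have : ‖nb (fun X => Real.smoothTransition ((q ^ 2 - ‖X - y‖ ^ 2) / (q ^ 2 - r' ^ 2))) X‖ =
        ‖fderiv ℝ (fun X => Real.smoothTransition ((q ^ 2 - ‖X - y‖ ^ 2) / (q ^ 2 - r' ^ 2))) X‖ := by simp [nb, gradient]
      rw [this]
      erw [d3]
      rw [norm_smul, norm_smul, norm_neg, ← Nat.cast_smul_eq_nsmul ℝ, norm_smul, ContinuousLinearMap.comp_id, innerSL_apply_norm,
        norm_inv, Real.norm_of_nonneg hD.le, le_div_iff₀ (by linarith)]
      have e1 : q ^ 2 - r' ^ 2 = (r - r') / 2 * (q + r') := by simp only [q]; ring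
      rw [e1] at hD ⊢
      have e2 : ((r - r') / 2 * (q + r'))⁻¹ * (‖((2:ℕ):ℝ)‖ * ‖X - y‖) * (r - r') ≤ 4 := by
        have : 0 < r - r' := by linarith
        have hn : ‖((2:ℕ):ℝ)‖ = 2 := by norm_num
        rw [hn, mul_inv, inv_div]
        have : 0 < q + r' := by linarith
        rw [show 2 / (r - r') * (q + r')⁻¹ * (2 * ‖X - y‖) * (r - r') = 4 * (‖X - y‖ / (q + r')) by field_simp; ring]
        have : ‖X - y‖ / (q + r') ≤ 1 := by rw [div_le_one (by linarith)]; linarith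
        linarith
      rw [mul_assoc]
      have := mul_le_mul (hC ((q ^ 2 - ‖X - y‖ ^ 2) / ((r - r') / 2 * (q + r')))) e2 (by
        have : 0 < r - r' := by linarith
        positivity) hC0
      linarith
    · push Not at hX
      have : (fun X : Eu n => Real.smoothTransition ((q ^ 2 - ‖X - y‖ ^ 2) / (q ^ 2 - r' ^ 2))) =ᶠ[𝓝 X] fun _ => 0 := by
        filter_upwards [(continuous_id.sub continuous_const).norm.continuousAt.eventually (lt_mem_nhds hX)] with Y hY
        have hY : q < ‖Y - y‖ := hY
        exact Real.smoothTransition.zero_of_nonpos (div_nonpos_of_nonpos_of_nonneg (by nlinarith) hD.le)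
      simp only [nb, gradient, this.fderiv_eq]
      have : 0 < r - r' := by linarith
      simp
      positivity

lemma AR.mball2 (h : AR n d C₀ Γ) : ∃ C : ℝ≥0, ∀ (y : Eu n) (ρ : ℝ), 0 < ρ →
    ofReal ((infDist y Γ + ρ) ^ ((n:ℝ) - 1 - d)) * mm d Γ (ball y ρ) ≤ C * ofReal (ρ ^ n) := by
  obtain ⟨C, hC⟩ := h.mball
  have hd := h.hd
  have hd0 := h.hd0
  have hg : 0 < (n:ℝ) - 1 - d := by linarith
  have v1 : volume (ball (0 : Eu n) 1) ≠ ∞ := measure_ball_lt_top.ne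
  obtain ⟨c, hc⟩ : ∃ c : ℝ≥0, (c : ℝ≥0∞) = volume (ball (0 : Eu n) 1) := ⟨_, ENNReal.coe_toNNReal v1⟩
  refine ⟨Real.toNNReal (3 ^ ((n:ℝ) - 1 - d)) * (c + C * Real.toNNReal (3 ^ (d + 1))), fun y ρ hρ => ?_⟩
  have hδ : 0 ≤ infDist y Γ := infDist_nonneg
  set D := infDist y Γ + ρ with hD
  have hD0 : 0 < D := by positivity
  have e3 : (Real.toNNReal (3 ^ ((n:ℝ) - 1 - d)) : ℝ≥0∞) = ofReal (3 ^ ((n:ℝ) - 1 - d)) := rfl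
  rcases le_total (2 * ρ) (infDist y Γ) with h1 | h1
  · have : mm d Γ (ball y ρ) ≤ ofReal ((D / 3) ^ (d + 1 - (n:ℝ))) * volume (ball y ρ) := by
      rw [mm, withDensity_apply _ measurableSet_ball, ← setLIntegral_const]
      refine setLIntegral_mono measurable_const fun X hX => ofReal_le_ofReal ?_
      refine rpow_anti (by positivity) ?_ (by linarith)
      have := infDist_le_infDist_add_dist (s := Γ) (x := y) (y := X)
      rw [mem_ball, dist_comm] at hX
      linarith
    calc _ ≤ ofReal (D ^ ((n:ℝ) - 1 - d)) * (ofReal ((D / 3) ^ (d + 1 - (n:ℝ))) * volume (ball y ρ)) := by gcongr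
      _ = ofReal (3 ^ ((n:ℝ) - 1 - d)) * volume (ball y ρ) := by
        rw [← mul_assoc, ← ofReal_mul (by positivity)]
        congr 2
        rw [show d + 1 - (n:ℝ) = -((n:ℝ) - 1 - d) by ring, Real.rpow_neg (by positivity), Real.div_rpow hD0.le (by norm_num)]
        have := (Real.rpow_pos_of_pos hD0 ((n:ℝ) - 1 - d)).ne'
        field_simp
      _ = (Real.toNNReal (3 ^ ((n:ℝ) - 1 - d)) * c : ℝ≥0) * ofReal (ρ ^ n) := by
        rw [vball y hρ, ← hc]; push_cast [e3]; ring
      _ ≤ _ := by gcongr; exact le_self_add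
  · obtain ⟨z, hz, hz'⟩ := h.near y
    have a1 : mm d Γ (ball y ρ) ≤ C * ofReal ((3 * ρ) ^ (d + 1)) :=
      (measure_mono (ball_subset_ball' (by linarith))).trans (hC z hz _ (by positivity))
    calc _ ≤ ofReal ((3 * ρ) ^ ((n:ℝ) - 1 - d)) * (C * ofReal ((3 * ρ) ^ (d + 1))) := by
          gcongr; linarith
      _ = (Real.toNNReal (3 ^ ((n:ℝ) - 1 - d)) * (C * Real.toNNReal (3 ^ (d + 1))) : ℝ≥0) * ofReal (ρ ^ n) := by
        have : ofReal (ρ ^ n) = ofReal (ρ ^ ((n:ℝ) - 1 - d)) * ofReal (ρ ^ (d + 1)) := by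
          rw [← ofReal_mul (by positivity), ← Real.rpow_add hρ, ← Real.rpow_natCast]; congr 2; ring
        have e4 : (Real.toNNReal (3 ^ (d + 1)) : ℝ≥0∞) = ofReal (3 ^ (d + 1)) := rfl
        rw [this, Real.mul_rpow (by norm_num) hρ.le, Real.mul_rpow (by norm_num) hρ.le, ofReal_mul (by positivity),
          ofReal_mul (by positivity)]
        push_cast [e3, e4]; ring
      _ ≤ _ := by gcongr; exact le_add_self

lemma AR.vol2 (h : AR n d C₀ Γ) (y : Eu n) (ρ : ℝ) {T : Set (Eu n)} (hT : MeasurableSet T) (hs : T ⊆ ball y ρ) :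
    volume T ≤ ofReal ((infDist y Γ + ρ) ^ ((n:ℝ) - 1 - d)) * mm d Γ T := by
  have := h.vol_le hT (fun X hX => infDist_le_of h y ρ X (hs hX)) (f := fun _ => 1) measurable_const
  simpa using this

lemma nb_ts {η : Eu n → ℝ} {X : Eu n} (h : nb η X ≠ 0) : X ∈ tsupport η := by
  by_contra hX
  have := image_eq_zero_of_notMem_tsupport fun h' => hX (tsupport_fderiv_subset ℝ h')
  exact h (by rw [← enorm_eq_zero, nb_enorm, this]; exact en_zero)

lemma cut_bd {y : Eu n} {r r' C : ℝ} {η : Eu n → ℝ} (h1 : ∀ X, 0 ≤ η X ∧ η X ≤ 1) (h2 : tsupport η ⊆ ball y r)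
    (h3 : ∀ X, ‖nb η X‖ ≤ C / (r - r')) : (∀ X, ‖η X‖ₑ ≤ (Real.toNNReal (max 1 (C / (r - r'))) : ℝ≥0) ∧
      ‖nb η X‖ₑ ≤ (Real.toNNReal (max 1 (C / (r - r'))) : ℝ≥0)) ∧ ∀ X, ‖y‖ + r ≤ ‖X‖ → nb η X = 0 ∧ η X = 0 := by
  refine ⟨fun X => ⟨?_, ?_⟩, fun X hX => ?_⟩
  · rw [← ofReal_norm, Real.norm_of_nonneg (h1 X).1]
    exact ofReal_le_ofReal ((h1 X).2.trans (le_max_left _ _))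
  · rw [← ofReal_norm]
    exact ofReal_le_ofReal ((h3 X).trans (le_max_right _ _))
  · have : X ∉ tsupport η := fun h => by
      have := mem_ball.1 (h2 h)
      have h4 := norm_le_norm_add_norm_sub y X
      rw [dist_eq_norm] at this
      rw [norm_sub_rev] at h4
      linarith
    exact ⟨by_contra fun h => this (nb_ts h), image_eq_zero_of_notMem_tsupport this⟩

lemma Fm.dg (hA : AR n d C₀ Γ) {Λ : ℝ≥0} {b} (hb : Fm d Γ Λ b) : ∃ C : ℝ, 0 < C ∧ ∀ u G g, Sol d Γ b u G g →
    ∀ (y : Eu n) (r r' k h κ : ℝ), 0 < r' → r' < r → 0 < h → 0 ≤ k → 0 ≤ κ → (∀ᵐ X, X ∈ ball y r → u X ≤ 1) →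
    (∀ X ∈ Γ, X ∈ ball y r → g X < k) → volume ({X | k < u X} ∩ ball y r) ≤ ofReal (κ ^ n) →
    mm d Γ ({X | k + 2 * h < u X} ∩ ball y r') ≤
      ofReal (C * (κ / (h * (r - r'))) ^ 2) * mm d Γ ({X | k < u X} ∩ ball y r) := by
  obtain ⟨C, hC⟩ := hA.fkW
  obtain ⟨B, hB0, hB⟩ := cutoff (n := n)
  refine ⟨C * (2 * (4 * Λ ^ 4 + 1)) * B ^ 2 + 1, by positivity, fun u G g hs y r r' k h κ hr' hr hh hk hκ hu hg hv => ?_⟩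
  obtain ⟨η, c1, c2, c3, c4, c5⟩ := hB y r r' hr' hr
  have hη : ContDiff ℝ 1 η := c1.of_le (by exact_mod_cast le_top)
  obtain ⟨d1, d2⟩ := cut_bd c2 c4 c5
  have hum := hs.um
  set T := {X | k < u X} ∩ ball y r with hT
  have hTm : MeasurableSet T := (measurableSet_lt measurable_const hum).inter measurableSet_ball
  obtain ⟨e1, e2⟩ := hs.eng hA hb hη d1 (k := k) (R := ‖y‖ + r) (fun X hX hX' => hg X hX (c4 hX'))
    (fun X hX => ⟨(d2 X hX).1, .inl (d2 X hX).2⟩) (rmp_cont k h) (fun t ht => rmp_zero hh ht) (L := 1)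
      (fun t => by
        rw [← NNReal.coe_le_coe, coe_nnnorm, Real.norm_of_nonneg (rmp_le _ _ _).1]; exact (rmp_le _ _ _).2)
      (Q := T.indicator 1) (measurable_one.indicator hTm) (by
        filter_upwards [hu] with X hX hX'
        have hXb := c4 (nb_ts hX')
        rcases le_or_gt (u X) k with h1 | h1
        · rw [(prim (ψ := fun s => rmp k h s ^ 2) ((rmp_cont k h).pow 2) (k := k) fun t ht => by simp [rmp_zero hh ht]).2.2 _ h1]
          simp
        · rw [indicator_of_mem (show X ∈ T from ⟨h1, hXb⟩), Pi.one_apply, one_mul, ← ofReal_norm, ← ofReal_norm]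
          refine ofReal_le_ofReal ((prim_le ((rmp_cont k h).pow 2) (fun s => sq_nonneg _) h1.le
            (B := rmp k h (u X)) fun s hs => ?_).trans ?_)
          · show rmp k h s ^ 2 ≤ _
            have a1 := rmp_le k h s
            have a2 := rmp_mono (k := k) hh hs.2
            nlinarith
          · have a1 := rmp_le k h (u X)
            rw [Real.norm_of_nonneg a1.1]
            nlinarith [hX hXb])
  have hbd : ∀ᵐ X ∂(mm d Γ), ‖(∫ s in k..u X, rmp k h s) • nb η X‖ₑ ^ 2 ≤ T.indicator (fun _ => ofReal ((B / (r - r'))) ^ 2) X := by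
    filter_upwards [mac.ae_le hu] with X hX
    by_cases h0 : nb η X = 0
    · simp [h0]
    have hXb := c4 (nb_ts h0)
    rcases le_or_gt (u X) k with h1 | h1
    · rw [(prim (rmp_cont k h) fun t ht => rmp_zero hh ht).2.2 _ h1]; simp
    · rw [indicator_of_mem (show X ∈ T from ⟨h1, hXb⟩), ← ofReal_norm]
      gcongr
      rw [norm_smul, ← one_mul (B / _)]
      refine mul_le_mul ((prim_le (rmp_cont k h) (fun s => (rmp_le _ _ _).1) h1.le (B := 1)
            fun s _ => (rmp_le _ _ _).2).trans (by linarith [hX hXb])) (c5 X) (norm_nonneg _) zero_le_one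
  have f1 : ∫⁻ X, (T.indicator 1 X * ‖nb η X‖ₑ) ^ 2 ∂(mm d Γ) ≤ ofReal ((B / (r - r'))) ^ 2 * mm d Γ T := by
    rw [← setLIntegral_const, ← lintegral_indicator hTm]
    refine lintegral_mono fun X => ?_
    by_cases hX : X ∈ T
    · simp only [indicator_of_mem hX, Pi.one_apply, one_mul, ← ofReal_norm]
      gcongr; exact c5 X
    · simp [hX]
  have f2 : N2 (mm d Γ) (fun X => (∫ s in k..u X, rmp k h s) • nb η X) ≤ ofReal ((B / (r - r'))) ^ 2 * mm d Γ T := by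
    rw [← setLIntegral_const, ← lintegral_indicator hTm]
    exact lintegral_mono_ae hbd
  have f3 := hC _ T _ _ e1 (isBounded_ball.subset ((subset_tsupport η).trans c4)) hTm (fun X hX => by
    simp only [Function.mem_support, ne_eq, mul_eq_zero, not_or] at hX
    refine ⟨not_le.1 fun h1 => hX.2 ((prim (rmp_cont k h) fun t ht => rmp_zero hh ht).2.2 _ h1), c4 (subset_tsupport η hX.1)⟩)
    (ne_top_of_le_ne_top measure_ball_lt_top.ne (measure_mono inter_subset_right))
  have f4 : N2 (mm d Γ) (fun X => (η X * rmp k h (u X)) • G X + (∫ s in k..u X, rmp k h s) • nb η X) ≤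
      2 * (4 * Λ ^ 4 + 1) * (ofReal ((B / (r - r'))) ^ 2 * mm d Γ T) := by
    refine (N2_add (f := fun X => (η X * rmp k h (u X)) • G X) ?_).trans ?_
    · have := hs.Gl.1; have := hη.continuous.measurable; have := (rmp_cont k h).measurable; fun_prop
    · calc _ ≤ 2 * (4 * Λ ^ 4 * (ofReal ((B / (r - r'))) ^ 2 * mm d Γ T) + ofReal ((B / (r - r'))) ^ 2 * mm d Γ T) := by
            gcongr; exact e2.trans (by gcongr)
        _ = _ := by ring
  have f5 : ofReal (h ^ 2) * mm d Γ ({X | k + 2 * h < u X} ∩ ball y r') ≤ N2 (mm d Γ) (fun X => η X * ∫ s in k..u X, rmp k h s) := by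
    rw [← setLIntegral_const]
    refine (setLIntegral_mono' ((measurableSet_lt measurable_const hum).inter measurableSet_ball) fun X hX => ?_).trans (setLIntegral_le_lintegral _ _)
    have h1 : k + 2 * h < u X := hX.1
    have := rmp_int (k := k) (t := u X) hh (by linarith)
    simp only []
    rw [c3 X hX.2, one_mul, ← ofReal_norm, ← ofReal_pow (norm_nonneg _)]
    exact ofReal_le_ofReal (pow_le_pow_left₀ hh.le ((by linarith : h ≤ _).trans (le_abs_self _)) 2)
  have f6 : (volume T ^ (1 / n : ℝ)) ^ 2 ≤ ofReal (κ ^ 2) := by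
    rw [ofReal_pow hκ]
    gcongr
    calc _ ≤ (ofReal κ ^ n) ^ (1 / n : ℝ) := by gcongr; rwa [← ofReal_pow hκ]
      _ = _ := by
        have := hA.two
        rw [← ENNReal.rpow_natCast, ← ENNReal.rpow_mul, mul_one_div_cancel (by positivity), ENNReal.rpow_one]
  have hh2 : ofReal (h ^ 2) ≠ 0 := by simpa using hh.ne'
  rw [← ENNReal.mul_le_mul_iff_right hh2 (by finiteness)]
  calc _ ≤ _ := f5.trans (f3.trans (mul_le_mul' (mul_le_mul_right f6 _) f4))
    _ = ofReal (C * (2 * (4 * Λ ^ 4 + 1)) * (κ * (B / (r - r'))) ^ 2) * mm d Γ T := by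
      rw [ofReal_mul (by positivity), ofReal_mul (by positivity), ofReal_mul (by positivity), mul_pow,
        ofReal_mul (by positivity), ofReal_add (by positivity) (by positivity), ofReal_mul (by positivity)]
      simp only [ofReal_pow (show 0 ≤ B / (r - r') by have := sub_pos.2 hr; positivity), ofReal_coe_nnreal, ofReal_ofNat,
        ofReal_one, ofReal_pow (NNReal.coe_nonneg Λ)]
      ring
    _ ≤ _ := by
      rw [← mul_assoc (ofReal (h ^ 2)), ← ofReal_mul (by positivity)]
      refine mul_le_mul_left (ofReal_le_ofReal ?_) _
      have := sub_pos.2 hr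
      rw [show h ^ 2 * ((C * (2 * (4 * Λ ^ 4 + 1)) * B ^ 2 + 1) * (κ / (h * (r - r'))) ^ 2) =
        (C * (2 * (4 * Λ ^ 4 + 1)) * B ^ 2 + 1) * (κ / (r - r')) ^ 2 by field_simp,
        show (C * (2 * (4 * Λ ^ 4 + 1)) * (κ * (B / (r - r'))) ^ 2 : ℝ) = (C * (2 * (4 * Λ ^ 4 + 1)) * B ^ 2) * (κ / (r - r')) ^ 2 by field_simp]
      gcongr; linarith

variable {Λ : ℝ≥0} {b : (Eu n → Eu n) → (Eu n → Eu n) → ℝ}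

lemma pow0 {a : ℝ} (ha : 0 ≤ a) (hn : 2 ≤ n) {t : ℝ≥0∞} (h : ∀ i : ℕ, t ≤ ofReal ((a * (1 / 4) ^ i) ^ n)) : t = 0 := by
  have h1 : Tendsto (fun i : ℕ => ofReal ((a * (1 / 4) ^ i) ^ n)) atTop (𝓝 0) := by
    rw [← ofReal_zero]
    refine (ENNReal.continuous_ofReal.tendsto _).comp ?_
    have := ((tendsto_pow_atTop_nhds_zero_of_lt_one (r := (1/4:ℝ)) (by norm_num) (by norm_num)).const_mul a).pow n
    simpa [show n ≠ 0 by omega] using this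
  exact le_antisymm (ge_of_tendsto' h1 h) (zero_le)

lemma small {a b : ℝ} (ha : 0 ≤ a) (hb : 0 < b) : ∃ e : ℝ, 0 < e ∧ a * e ^ 2 ≤ b := by
  refine ⟨min 1 (b / (a + 1)), by positivity, ?_⟩
  have h1 := min_le_left 1 (b / (a + 1))
  have h2 := min_le_right 1 (b / (a + 1))
  set e := min 1 (b / (a + 1))
  have h0 : 0 < e := by positivity
  rw [le_div_iff₀ (by positivity)] at h2
  nlinarith [mul_nonneg ha h0.le]

lemma Fm.sup (hA : AR n d C₀ Γ) (hb : Fm d Γ Λ b) {K : ℝ} (hK : 0 < K) : ∃ ε : ℝ, 0 < ε ∧ ∀ u G g, Sol d Γ b u G g →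
    ∀ (y : Eu n) (ρ : ℝ), 0 < ρ → (∀ᵐ X, X ∈ ball y ρ → u X ≤ 1) → (∀ X ∈ Γ, X ∈ ball y ρ → g X < 0) →
    volume ({X | 0 < u X} ∩ ball y ρ) ≤ ofReal (ε * ρ ^ n) → ∀ᵐ X, X ∈ ball y (ρ / 2) → u X ≤ K := by
  obtain ⟨C, hC0, hC⟩ := hb.dg hA
  obtain ⟨C2, hC2⟩ := hA.mball2
  obtain ⟨e, he, he'⟩ := small (a := C * (64 / K) ^ 2) (b := (1 / 4) ^ n) (by positivity) (by positivity)
  obtain ⟨ε, hε, hε'⟩ := small (a := C * (16 / K) ^ 2 * C2) (b := e ^ n) (by positivity) (by positivity)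
  refine ⟨ε ^ n, by positivity, fun u G g hs y ρ hρ hu hg hv => ?_⟩
  have hum := hs.um
  set α := ofReal ((infDist y Γ + ρ) ^ ((n:ℝ) - 1 - d))
  set k : ℕ → ℝ := fun i => K - K / 2 * (1 / 2) ^ i with hk
  set r : ℕ → ℝ := fun i => ρ / 2 + ρ / 4 * (1 / 2) ^ i with hr
  have hp : ∀ i : ℕ, (0:ℝ) < (1 / 2) ^ i ∧ ((1:ℝ) / 2) ^ i ≤ 1 := fun i => ⟨by positivity, pow_le_one₀ (by norm_num) (by norm_num)⟩
  have hk0 : ∀ i, 0 < k i := fun i => by simp only [hk]; nlinarith [hp i]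
  have hrρ : ∀ i, r i ≤ ρ := fun i => by simp only [hr]; nlinarith [hp i]
  have hr0 : ∀ i, ρ / 2 < r i := fun i => by simp only [hr]; nlinarith [hp i]
  set T : ℕ → Set (Eu n) := fun i => {X | k i < u X} ∩ ball y (r i) with hT
  have hTm : ∀ i, MeasurableSet (T i) := fun i => (measurableSet_lt measurable_const hum).inter measurableSet_ball
  have hTs : ∀ i, T i ⊆ ball y ρ := fun i => inter_subset_right.trans (ball_subset_ball (hrρ i))
  have main : ∀ i, α * mm d Γ (T i) ≤ ofReal ((e * ρ * (1 / 4) ^ i) ^ n) := by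
    intro i
    induction i with
    | zero =>
      have h1 := hC u G g hs y ρ (r 0) 0 (K / 4) (ε * ρ) (by linarith [hr0 0]) (by simp only [hr]; linarith)
        (by positivity) le_rfl (by positivity) hu hg (by rwa [mul_pow])
      have e1 : 0 + 2 * (K / 4) = k 0 := by simp only [hk]; ring
      have e2 : ε * ρ / (K / 4 * (ρ - r 0)) = 16 / K * ε := by simp only [hr]; field_simp; ring
      rw [e1, e2] at h1
      calc _ ≤ α * (ofReal (C * (16 / K * ε) ^ 2) * mm d Γ (ball y ρ)) := by
            gcongr; exact h1.trans (by gcongr; exact inter_subset_right)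
        _ = ofReal (C * (16 / K * ε) ^ 2) * (α * mm d Γ (ball y ρ)) := by ring
        _ ≤ ofReal (C * (16 / K * ε) ^ 2) * (C2 * ofReal (ρ ^ n)) := mul_le_mul_right (hC2 y ρ hρ) _
        _ = ofReal (C * (16 / K) ^ 2 * C2 * ε ^ 2 * ρ ^ n) := by
          rw [← ofReal_coe_nnreal, ← ofReal_mul (by positivity), ← ofReal_mul (by positivity)]
          congr 1; ring
        _ ≤ _ := by
          refine ofReal_le_ofReal ?_
          rw [pow_zero, mul_one, mul_pow]; gcongr
    | succ i ih =>
      have h1 := hC u G g hs y (r i) (r (i+1)) (k i) (K / 8 * (1 / 2) ^ i) (e * ρ * (1 / 4) ^ i) (by linarith [hr0 (i+1)])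
        (by simp only [hr, pow_succ]; nlinarith [hp i]) (by positivity) (hk0 i).le (by positivity)
        (hu.mono fun X h hX => h (ball_subset_ball (hrρ i) hX))
        (fun X hX hX' => (hg X hX (ball_subset_ball (hrρ i) hX')).trans (hk0 i)) ((hA.vol2 y ρ (hTm i) (hTs i)).trans ih)
      have e1 : k i + 2 * (K / 8 * (1 / 2) ^ i) = k (i + 1) := by simp only [hk, pow_succ]; ring
      have e2 : e * ρ * (1 / 4) ^ i / (K / 8 * (1 / 2) ^ i * (r i - r (i + 1))) = 64 / K * e := by
        simp only [hr, pow_succ]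
        rw [show ((1:ℝ) / 4) ^ i = (1 / 2) ^ i * (1 / 2) ^ i by rw [← mul_pow]; norm_num]
        have := (hp i).1
        rw [show ρ / 2 + ρ / 4 * (1 / 2) ^ i - (ρ / 2 + ρ / 4 * ((1 / 2) ^ i * (1 / 2))) = ρ / 8 * (1 / 2) ^ i by ring]
        generalize ((1:ℝ) / 2) ^ i = q at *
        field_simp; norm_num
      rw [e1, e2] at h1
      calc _ ≤ α * (ofReal (C * (64 / K * e) ^ 2) * mm d Γ (T i)) := by gcongr
        _ = ofReal (C * (64 / K * e) ^ 2) * (α * mm d Γ (T i)) := by ring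
        _ ≤ ofReal (C * (64 / K * e) ^ 2) * ofReal ((e * ρ * (1 / 4) ^ i) ^ n) := by gcongr
        _ ≤ _ := by
          rw [← ofReal_mul (by positivity)]
          refine ofReal_le_ofReal ?_
          rw [pow_succ (1/4 : ℝ), ← mul_assoc (e * ρ), mul_pow _ (1/4 : ℝ), mul_comm]
          refine mul_le_mul_of_nonneg_left ?_ (by positivity)
          linarith [he']
  have h0 : volume ({X | K < u X} ∩ ball y (ρ / 2)) = 0 := by
    refine pow0 (a := e * ρ) (by positivity) hA.two fun i => le_trans ?_ (main i)
    refine (measure_mono ?_).trans (hA.vol2 y ρ (hTm i) (hTs i))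
    refine inter_subset_inter (fun X (hX : K < u X) => ?_) (ball_subset_ball (hr0 i).le)
    exact lt_trans (by simp only [hk]; nlinarith [hp i]) hX
  filter_upwards [measure_eq_zero_iff_ae_notMem.1 h0] with X hX hX'
  exact not_lt.1 fun h => hX ⟨h, hX'⟩

lemma nb_addc (g : Eu n → ℝ) (c : ℝ) : nb (fun X => g X + c) = nb g := by ext1 X; simp [nb, gradient]

lemma W0.ll {S : Set (Eu n)} {φ H} (h : W0 d Γ S φ H) (hA : AR n d C₀ Γ) : LL d Γ H := ⟨h.m2, h.gfin hA⟩

lemma Sol.aff (hA : AR n d C₀ Γ) (hb : Fm d Γ Λ b) {u G g} (hs : Sol d Γ b u G g) (a c : ℝ) :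
    Sol d Γ b (fun X => a * u X + c) (a • G) (fun X => a * g X + c) := by
  refine ⟨(contDiff_const.mul hs.g1).add contDiff_const, ?_, ?_, (hs.um.const_mul a).add_const c, hs.Gl.smul a, fun φ H h => ?_⟩
  · obtain ⟨c', R, h⟩ := hs.gc
    exact ⟨a * c' + c, R, fun X hX => by rw [h X hX]⟩
  · convert hs.w.smul a using 1
    · ext1 X; simp only [Pi.sub_apply, Pi.smul_apply, smul_eq_mul]; ring
    · rw [nb_addc, smul_sub, ← nb_smul hs.g1]; rfl
  · rw [hb.smul₁ a hs.Gl (h.ll hA), hs.eq φ H h, mul_zero]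

lemma Sol.add (hA : AR n d C₀ Γ) (hb : Fm d Γ Λ b) {u G g u' G' g'} (hs : Sol d Γ b u G g) (hs' : Sol d Γ b u' G' g') :
    Sol d Γ b (fun X => u X + u' X) (G + G') (fun X => g X + g' X) := by
  refine ⟨hs.g1.add hs'.g1, ?_, ?_, hs.um.add hs'.um, hs.Gl.add hs'.Gl, fun φ H h => ?_⟩
  · obtain ⟨c, R, h⟩ := hs.gc
    obtain ⟨c', R', h'⟩ := hs'.gc
    exact ⟨c + c', max R R', fun X hX => by rw [h X ((le_max_left _ _).trans hX), h' X ((le_max_right _ _).trans hX)]⟩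
  · convert hs.w.add hs'.w using 1
    · ext1 X; simp only [Pi.sub_apply, Pi.add_apply]; ring
    · have := nb_add hs.g1 hs'.g1
      rw [show (fun X => g X + g' X) = g + g' from rfl, this]; abel
  · rw [hb.add₁ hs.Gl hs'.Gl (h.ll hA), hs.eq φ H h, hs'.eq φ H h, add_zero]

noncomputable def lg (h t : ℝ) : ℝ := (max (1 / 2) (min t 1) - 1 / 2) / (1 + h - max (1 / 2) (min t 1))

lemma lg_aux (t : ℝ) : max (1 / 2) (min t 1) ≤ (1:ℝ) := max_le (by norm_num) (min_le_right _ _)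
lemma lg_cont {h : ℝ} (hh : 0 < h) : Continuous (lg h) := by
  unfold lg; exact Continuous.div (by fun_prop) (by fun_prop) fun t => by linarith [lg_aux t]
lemma lg_zero (h : ℝ) {t : ℝ} (ht : t ≤ 1 / 2) : lg h t = 0 := by
  rw [lg, max_eq_left ((min_le_left t 1).trans ht), sub_self, zero_div]
lemma lg_le {h : ℝ} (hh : 0 < h) (t : ℝ) : 0 ≤ lg h t ∧ lg h t ≤ 1 / h := by
  have h1 := lg_aux t
  have h2 := le_max_left (1/2) (min t 1)
  unfold lg
  set s := max (1 / 2) (min t 1)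
  refine ⟨div_nonneg (by linarith) (by linarith), ?_⟩
  rw [div_le_div_iff₀ (by linarith) hh]; nlinarith
lemma lg_int {h t : ℝ} (hh : 0 < h) (h8 : h ≤ 1 / 8) (ht : 1 - h ≤ t) : 1 / 4 * Real.log (1 / (8 * h)) ≤ ∫ s in (1/2)..t, lg h s := by
  have hi : ∀ a c, IntervalIntegrable (lg h) volume a c := fun a c => (lg_cont hh).intervalIntegrable a c
  have hc : ContinuousOn (fun s => 1 / 4 * (1 + h - s)⁻¹) (uIcc (3/4) (1 - h)) := by
    rw [uIcc_of_le (by linarith)]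
    exact continuousOn_const.mul (ContinuousOn.inv₀ (by fun_prop) fun s hs => by linarith [hs.2])
  calc _ ≤ 1 / 4 * Real.log ((1 / 4 + h) / (2 * h)) := by
        gcongr 1 / 4 * ?_
        refine Real.log_le_log (by positivity) ?_
        rw [div_le_div_iff₀ (by positivity) (by positivity)]; nlinarith
    _ = ∫ s in (3/4)..(1 - h), 1 / 4 * (1 + h - s)⁻¹ := by
      rw [intervalIntegral.integral_const_mul, intervalIntegral.integral_comp_sub_left (fun x => x⁻¹) (1 + h),
        integral_inv_of_pos (by linarith) (by linarith)]
      congr 2; congr 1 <;> ring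
    _ ≤ ∫ s in (3/4)..(1 - h), lg h s := by
      refine intervalIntegral.integral_mono_on (by linarith) hc.intervalIntegrable (hi _ _) fun s hs => ?_
      have : max (1 / 2) (min s 1) = s := by rw [min_eq_left (by linarith [hs.2]), max_eq_right (by linarith [hs.1])]
      rw [lg, this, div_eq_mul_inv]
      exact mul_le_mul_of_nonneg_right (by linarith [hs.1]) (inv_nonneg.2 (by linarith [hs.2]))
    _ ≤ _ := intervalIntegral.integral_mono_interval (by norm_num) (by linarith) ht
      (Eventually.of_forall fun s => (lg_le hh s).1) (hi _ _)

lemma lg_sq {h t : ℝ} (hh : 0 < h) (ht : 1 / 2 ≤ t) (ht1 : t ≤ 1) : ∫ s in (1/2)..t, lg h s ^ 2 ≤ lg h t := by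
  have e : ∀ s, 1 / 2 ≤ s → s ≤ 1 → lg h s = (s - 1 / 2) / (1 + h - s) := fun s h1 h2 => by
    rw [lg, min_eq_left h2, max_eq_right h1]
  have hc : ContinuousOn (fun s => (1 / 2 + h) / (1 + h - s) ^ 2) (uIcc (1/2) t) := by
    rw [uIcc_of_le ht]
    exact continuousOn_const.div (by fun_prop) fun s hs => (pow_pos (by linarith [hs.2]) 2).ne'
  have := intervalIntegral.integral_eq_sub_of_hasDerivAt (a := 1 / 2) (b := t) (f := fun s => (s - 1 / 2) / (1 + h - s))
    (f' := fun s => (1 / 2 + h) / (1 + h - s) ^ 2) (fun s hs => by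
      rw [uIcc_of_le ht] at hs
      refine (((hasDerivAt_id s).sub_const (1 / 2)).div ((hasDerivAt_id s).const_sub (1 + h)) (by simp; linarith [hs.2])).congr_deriv ?_
      simp only [id]; ring) hc.intervalIntegrable
  calc _ ≤ ∫ s in (1/2)..t, (1 / 2 + h) / (1 + h - s) ^ 2 := by
        refine intervalIntegral.integral_mono_on ht (((lg_cont hh).pow 2).intervalIntegrable _ _) hc.intervalIntegrable fun s hs => ?_
        show lg h s ^ 2 ≤ _
        rw [e s hs.1 (hs.2.trans ht1), div_pow]
        have := hs.1; have := hs.2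
        gcongr
        nlinarith
    _ = _ := by rw [this, e t ht ht1]; simp

lemma Fm.grow (hA : AR n d C₀ Γ) (hb : Fm d Γ Λ b) {θ : ℝ} (hθ : 0 < θ) : ∃ c : ℝ, 0 < c ∧ c ≤ 1 / 2 ∧ ∀ u G g, Sol d Γ b u G g →
    ∀ (y : Eu n) (ρ : ℝ), 0 < ρ → (∀ᵐ X, X ∈ ball y (8 * ρ) → u X ≤ 1) → (∀ X ∈ Γ, X ∈ ball y (8 * ρ) → g X < 1 / 2) →
    (y ∈ Γ ∨ ofReal (θ * ρ ^ n) ≤ volume ({X | u X ≤ 1 / 2} ∩ ball y ρ)) →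
    ∀ᵐ X, X ∈ ball y (ρ / 2) → u X ≤ 1 - c := by
  obtain ⟨ε, hε, hS⟩ := hb.sup hA (K := 1 / 2) (by norm_num)
  obtain ⟨C2, hC2⟩ := hA.mball2
  obtain ⟨B, hB0, hB⟩ := cutoff (n := n)
  obtain ⟨Cb, hCb⟩ := hA.pbW
  obtain ⟨Ci, hCi⟩ := hA.pinW
  have hd := hA.hd
  set C1 : ℝ := 2 * Λ ^ 2 * B * C2 * 8 ^ n with hC1
  set C' : ℝ := (Cb + Ci / θ) * C1 with hC'
  have hC10 : 0 ≤ C1 := by positivity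
  have hC'0 : 0 ≤ C' := by positivity
  set h : ℝ := Real.exp (-(4 * C' / ε)) / 8 with hhd
  have hh : 0 < h := by positivity
  have h8 : h ≤ 1 / 8 := by
    have : Real.exp (-(4 * C' / ε)) ≤ 1 := Real.exp_le_one_iff.2 (by simp only [Left.neg_nonpos_iff]; positivity)
    rw [hhd]; linarith
  have hlog : 1 / 4 * Real.log (1 / (8 * h)) = C' / ε := by
    rw [hhd, show 1 / (8 * (Real.exp (-(4 * C' / ε)) / 8)) = Real.exp (4 * C' / ε) by rw [Real.exp_neg]; field_simp, Real.log_exp]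
    ring
  refine ⟨h / 2, by positivity, by linarith, fun u G g hs y ρ hρ hu hg hy => ?_⟩
  obtain ⟨η, c1, c2, c3, c4, c5⟩ := hB y (8 * ρ) (4 * ρ) (by positivity) (by linarith)
  have hη : ContDiff ℝ 1 η := c1.of_le (by exact_mod_cast le_top)
  obtain ⟨d1, d2⟩ := cut_bd c2 c4 c5
  have hum := hs.um
  obtain ⟨e1, e2⟩ := hs.eng hA hb hη d1 (k := 1 / 2) (R := ‖y‖ + 8 * ρ) (fun X hX hX' => hg X hX (c4 hX'))
    (fun X hX => ⟨(d2 X hX).1, .inl (d2 X hX).2⟩) (lg_cont hh) (fun t ht => lg_zero h ht) (L := Real.toNNReal (1 / h))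
      (fun t => by
        rw [← NNReal.coe_le_coe, coe_nnnorm, Real.norm_of_nonneg (lg_le hh t).1, Real.coe_toNNReal _ (by positivity)]; exact (lg_le hh t).2)
      (Q := (ball y (8 * ρ)).indicator 1) (measurable_one.indicator measurableSet_ball) (by
        filter_upwards [hu] with X hX hX'
        have hXb := c4 (nb_ts hX')
        rw [indicator_of_mem hXb, Pi.one_apply, one_mul]
        rcases le_or_gt (u X) (1 / 2) with h1 | h1
        · rw [(prim (ψ := fun s => lg h s ^ 2) ((lg_cont hh).pow 2) (k := 1 / 2) fun t ht => by simp [lg_zero h ht]).2.2 _ h1]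
          simp
        · have hX1 := hX hXb
          have a3 := lg_le hh (u X)
          rw [← ofReal_norm, ← ofReal_norm]
          rw [Real.norm_of_nonneg a3.1, Real.norm_of_nonneg (intervalIntegral.integral_nonneg h1.le fun s _ => sq_nonneg _)]
          exact ofReal_le_ofReal (lg_sq hh h1.le hX1))
  set φ : Eu n → ℝ := fun X => η X * ∫ s in (1/2)..u X, lg h s with hφ
  set H : Eu n → Eu n := fun X => (η X * lg h (u X)) • G X + (∫ s in (1/2)..u X, lg h s) • nb η X with hH
  set α := ofReal ((infDist y Γ + 8 * ρ) ^ ((n:ℝ) - 1 - d)) with hα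
  have hnb : ∀ X ∈ ball y (4 * ρ), nb η X = 0 := fun X hX => by
    rw [← enorm_eq_zero, nb_enorm, (Filter.EventuallyEq.fderiv_eq (f := fun _ => (1:ℝ)) ?_)]
    · simp [en_zero]
    · filter_upwards [isOpen_ball.mem_nhds hX] with Z hZ using c3 Z hZ
  have hB' : B / (8 * ρ - 4 * ρ) ≤ B / ρ := by gcongr; linarith
  have J : α * ∫⁻ X in ball y (4 * ρ), ‖H X‖ₑ ∂(mm d Γ) ≤ ofReal (C1 * ρ ^ n / ρ) := by
    have j1 := cs (μ := (mm d Γ).restrict (ball y (4 * ρ))) (f := fun _ => 1) (g := fun X => ‖H X‖ₑ) aemeasurable_const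
      e1.m2.enorm.aemeasurable
    simp only [one_mul, one_pow, lintegral_const, Measure.restrict_apply MeasurableSet.univ, univ_inter] at j1
    have j2 : ∫⁻ X in ball y (4 * ρ), ‖H X‖ₑ ^ 2 ∂(mm d Γ) ≤ 4 * Λ ^ 4 * (ofReal (B / ρ) ^ 2 * mm d Γ (ball y (8 * ρ))) := by
      calc _ = ∫⁻ X in ball y (4 * ρ), ‖(η X * lg h (u X)) • G X‖ₑ ^ 2 ∂(mm d Γ) :=
            setLIntegral_congr_fun measurableSet_ball fun X hX => by simp [hH, hnb X hX]
        _ ≤ _ := (setLIntegral_le_lintegral _ _).trans e2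
        _ ≤ _ := by
          gcongr
          rw [← setLIntegral_const, ← lintegral_indicator measurableSet_ball]
          refine lintegral_mono fun X => ?_
          by_cases hX : X ∈ ball y (8 * ρ)
          · simp only [indicator_of_mem hX, Pi.one_apply, one_mul, ← ofReal_norm]
            gcongr; exact (c5 X).trans hB'
          · simp [hX]
    have j3 : α * mm d Γ (ball y (8 * ρ)) ≤ ofReal (C2 * (8 * ρ) ^ n) := by
      rw [ofReal_mul (by positivity), ofReal_coe_nnreal]; exact hC2 y _ (by positivity)
    rw [← ENNReal.pow_le_pow_left_iff two_ne_zero]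
    calc _ ≤ α ^ 2 * (mm d Γ (ball y (8 * ρ)) * (4 * Λ ^ 4 * (ofReal (B / ρ) ^ 2 * mm d Γ (ball y (8 * ρ))))) := by
          rw [mul_pow]
          refine mul_le_mul_right (j1.trans (mul_le_mul' (measure_mono (ball_subset_ball (by linarith))) j2)) _
      _ = 4 * Λ ^ 4 * ofReal (B / ρ) ^ 2 * (α * mm d Γ (ball y (8 * ρ))) ^ 2 := by ring
      _ ≤ 4 * Λ ^ 4 * ofReal (B / ρ) ^ 2 * (ofReal (C2 * (8 * ρ) ^ n)) ^ 2 := by gcongr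
      _ = _ := by
        have e4 : (4 * Λ ^ 4 : ℝ≥0∞) = ofReal (2 * Λ ^ 2) ^ 2 := by
          rw [ofReal_mul (by positivity), ofReal_pow (by positivity)]; simp; ring
        rw [e4, ← mul_pow, ← mul_pow, ← ofReal_mul (by positivity), ← ofReal_mul (by positivity), hC1, mul_pow]
        congr 2; ring
  have hφ0 : ∀ X, u X ≤ 1 / 2 → φ X = 0 := fun X hX => by
    simp only [hφ]; rw [(prim (lg_cont hh) fun t ht => lg_zero h ht).2.2 _ hX, mul_zero]
  have main : ∫⁻ X in ball y ρ, ‖φ X‖ₑ ≤ ofReal (C' * ρ ^ n) := by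
    rcases hy with hy | hy
    · have a1 := hCb _ _ _ e1 y hy ρ hρ
      have hρd : ofReal (ρ ^ d) ≠ 0 := by simpa using Real.rpow_pos_of_pos hρ d
      have hργ : ofReal (ρ ^ ((n:ℝ) - 1 - d)) ≠ 0 := by simpa using Real.rpow_pos_of_pos hρ _
      have a2 : ∫⁻ X in ball y (4 * ρ), ‖H X‖ₑ ∂(mm d Γ) ≤ ofReal (C1 * ρ ^ d) := by
        rw [← ENNReal.mul_le_mul_iff_right hργ (by finiteness), ← ofReal_mul (by positivity)]
        refine (mul_le_mul_left ?_ _).trans (J.trans (ofReal_le_ofReal ?_))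
        · rw [hα, infDist_zero_of_mem hy, zero_add]
          refine ofReal_le_ofReal (Real.rpow_le_rpow hρ.le (by linarith) (by linarith))
        · rw [mul_left_comm, ← Real.rpow_add hρ, mul_div_assoc, ← Real.rpow_natCast, ← Real.rpow_sub_one hρ.ne']
          ring_nf; rfl
      rw [← ENNReal.mul_le_mul_iff_right hρd (by finiteness)]
      calc _ ≤ Cb * ofReal (ρ ^ n) * ofReal (C1 * ρ ^ d) := a1.trans (by gcongr)
        _ = ofReal (ρ ^ d) * ofReal (Cb * C1 * ρ ^ n) := by
          rw [← ofReal_coe_nnreal, ← ofReal_mul (by positivity), ← ofReal_mul (by positivity),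
            ← ofReal_mul (by positivity)]; congr 1; ring
        _ ≤ _ := by
          gcongr
          have : 0 ≤ Ci / θ * C1 := by positivity
          rw [hC']; linarith
    · have a1 := hCi _ _ _ e1 y ρ hρ
      have a2 : ∫⁻ X in ball y (4 * ρ), ‖H X‖ₑ ≤ ofReal (C1 * ρ ^ n / ρ) := by
        refine (hA.vol_le measurableSet_ball (fun X hX => infDist_le_of hA y (8 * ρ) X (ball_subset_ball (by linarith) hX))
          e1.m2.enorm).trans J
      have hθρ : ofReal (θ * ρ ^ n) ≠ 0 := by simp; positivity
      have hT : MeasurableSet ({X | u X ≤ 1 / 2} ∩ ball y ρ) := (measurableSet_le hum measurable_const).inter measurableSet_ball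
      rw [← ENNReal.mul_le_mul_iff_right hθρ (by finiteness)]
      calc _ ≤ volume ({X | u X ≤ 1 / 2} ∩ ball y ρ) * ∫⁻ X in ball y ρ, ‖φ X‖ₑ := by gcongr
        _ = ∫⁻ Y in {X | u X ≤ 1 / 2} ∩ ball y ρ, ∫⁻ X in ball y ρ, ‖φ X - φ Y‖ₑ := by
          rw [mul_comm, ← setLIntegral_const]
          refine setLIntegral_congr_fun hT fun Y hY => ?_
          simp [hφ0 Y hY.1]
        _ ≤ ∫⁻ Y in ball y ρ, ∫⁻ X in ball y ρ, ‖φ X - φ Y‖ₑ := lintegral_mono_set inter_subset_right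
        _ ≤ Ci * ofReal (ρ ^ (n + 1)) * ofReal (C1 * ρ ^ n / ρ) := a1.trans (by gcongr)
        _ = ofReal (θ * ρ ^ n) * ofReal (Ci / θ * C1 * ρ ^ n) := by
          rw [← ofReal_coe_nnreal, ← ofReal_mul (by positivity), ← ofReal_mul (by positivity),
            ← ofReal_mul (by positivity)]; congr 1; rw [pow_succ]; field_simp
        _ ≤ _ := by
          gcongr
          have : 0 ≤ Cb * C1 := by positivity
          rw [hC']; linarith
  have hvol : volume ({X | 1 - h < u X} ∩ ball y ρ) ≤ ofReal (ε * ρ ^ n) := by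
    rcases eq_or_lt_of_le hC'0 with h0 | h0
    · rw [← h0, zero_mul, ofReal_zero, nonpos_iff_eq_zero, lintegral_eq_zero_iff e1.m1.enorm] at main
      have : volume ({X | 1 - h < u X} ∩ ball y ρ) = 0 := by
        have m2 : ∀ᵐ X, X ∈ ball y ρ → φ X = 0 := (ae_restrict_iff' measurableSet_ball).1 (main.mono fun X hX => by simpa using hX)
        rw [measure_eq_zero_iff_ae_notMem]
        filter_upwards [m2] with X hX hX'
        have a3 := hX hX'.2
        simp only [hφ, c3 X (ball_subset_ball (by linarith) hX'.2), one_mul] at a3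
        have a4 : 0 < ∫ s in (1/2)..u X, lg h s := by
          have h1 : 1 - h < u X := hX'.1
          refine intervalIntegral.intervalIntegral_pos_of_pos_on ((lg_cont hh).intervalIntegrable _ _) (fun s hs => ?_) (by linarith)
          have : 1 / 2 < max (1 / 2) (min s 1) := lt_max_of_lt_right (lt_min hs.1 (by norm_num))
          exact div_pos (by linarith) (by linarith [lg_aux s])
        exact a4.ne' a3
      rw [this]; exact zero_le
    · have hc0 : ofReal (C' / ε) ≠ 0 := by simp; positivity
      rw [← ENNReal.mul_le_mul_iff_right hc0 (by finiteness), ← ofReal_mul (by positivity),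
        show C' / ε * (ε * ρ ^ n) = C' * ρ ^ n by field_simp]
      refine le_trans ?_ main
      rw [← setLIntegral_const]
      refine (setLIntegral_mono' ((measurableSet_lt measurable_const hum).inter measurableSet_ball) fun X hX => ?_).trans
        (lintegral_mono_set inter_subset_right)
      have h1 : 1 - h < u X := hX.1
      have := lg_int hh h8 h1.le
      rw [hlog] at this
      simp only [hφ, c3 X (ball_subset_ball (by linarith) hX.2), one_mul, ← ofReal_norm]
      exact ofReal_le_ofReal (this.trans (le_abs_self _))
  have hsub : ∀ X ∈ ball y ρ, X ∈ ball y (8 * ρ) := fun X hX => ball_subset_ball (by linarith) hX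
  have fin := hS _ _ _ (hs.aff hA hb (1 / h) (-(1 - h) / h)) y ρ hρ (hu.mono fun X hX hX' => by
      have := hX (hsub X hX')
      rw [one_div_mul_eq_div, ← add_div, div_le_one hh]; linarith) (fun X hX hX' => by
      have := hg X hX (hsub X hX')
      rw [one_div_mul_eq_div, ← add_div]; exact div_neg_of_neg_of_pos (by linarith) hh) (by
      refine le_trans (measure_mono ?_) hvol
      refine inter_subset_inter_left _ fun X hX => ?_
      rw [mem_ofPred_eq] at hX ⊢
      rw [one_div_mul_eq_div, ← add_div, div_pos_iff_of_pos_right hh] at hX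
      linarith)
  filter_upwards [fin] with X hX hX'
  have := hX hX'
  rw [one_div_mul_eq_div, ← add_div, div_le_iff₀ hh] at this
  linarith

def Dom (f : Eu n → ℝ) : Prop := ∃ F : Eu n → ℝ, Integrable F ∧ ∀ X, |f X| ≤ F X

lemma exI : ∃ I : (Eu n → ℝ) → ℝ, (∀ f g, Dom f → Dom g → I (f + g) = I f + I g) ∧ (∀ (c : ℝ) f, Dom f → I (c • f) = c * I f) ∧
    (∀ f, Dom f → (∀ X, 0 ≤ f X) → 0 ≤ I f) ∧ ∀ f, Integrable f → I f = ∫ X, f X := by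
  have hadd : ∀ f g : Eu n → ℝ, Dom f → Dom g → Dom (f + g) := fun f g ⟨F, h1, h2⟩ ⟨F', h1', h2'⟩ =>
    ⟨F + F', h1.add h1', fun X => (abs_add_le _ _).trans (add_le_add (h2 X) (h2' X))⟩
  have hsm : ∀ (c : ℝ) (f : Eu n → ℝ), Dom f → Dom (c • f) := fun c f ⟨F, h1, h2⟩ =>
    ⟨|c| • F, h1.smul _, fun X => by simp only [Pi.smul_apply, smul_eq_mul, abs_mul]; gcongr; exact h2 X⟩
  have hint : ∀ f : Eu n → ℝ, Integrable f → Dom f := fun f h => ⟨fun X => |f X|, h.abs, fun X => le_rfl⟩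
  let V : Submodule ℝ (Eu n → ℝ) := ⟨⟨⟨{f | Dom f}, fun {f g} hf hg => hadd f g hf hg⟩, ⟨0, integrable_zero _ _ _, fun X => by simp⟩⟩,
    fun c f hf => hsm c f hf⟩
  let P : Submodule ℝ V := ⟨⟨⟨{f | Integrable (f : Eu n → ℝ) volume}, fun {f g} hf hg => Integrable.add hf hg⟩, integrable_zero _ _ _⟩,
    fun c f hf => Integrable.smul c hf⟩
  let L : V →ₗ.[ℝ] ℝ := ⟨P, ⟨⟨fun f => ∫ X, (f : V).1 X, fun f g => integral_add f.2 g.2⟩, fun c f => integral_const_mul c _⟩⟩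
  let s : PointedCone ℝ V := ⟨⟨⟨{f | ∀ X, 0 ≤ f.1 X}, fun {f g} hf hg X => add_nonneg (hf X) (hg X)⟩, fun X => le_rfl⟩,
    fun c f hf X => mul_nonneg c.2 (hf X)⟩
  obtain ⟨g, h1, h2⟩ := riesz_extension s L (fun f hf => integral_nonneg hf) (fun f => by
    obtain ⟨F, hF, hF'⟩ := f.2
    exact ⟨⟨⟨F, hint F hF⟩, hF⟩, show ∀ X, 0 ≤ F X + f.1 X from fun X => by have := (abs_le.1 (hF' X)).1; linarith⟩)
  classical
  have ed : ∀ f (hf : Dom f), (if h : Dom f then g ⟨f, h⟩ else 0) = g ⟨f, hf⟩ := fun f hf => dif_pos hf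
  refine ⟨fun f => if h : Dom f then g ⟨f, h⟩ else 0, fun f f' hf hf' => ?_, fun c f hf => ?_, fun f hf h0 => ?_, fun f hf => ?_⟩
  · simp only [ed _ hf, ed _ hf', ed _ (hadd f f' hf hf')]; exact g.map_add ⟨f, hf⟩ ⟨f', hf'⟩
  · simp only [ed _ hf, ed _ (hsm c f hf)]; exact g.map_smul c ⟨f, hf⟩
  · simp only [ed _ hf]; exact h2 _ h0
  · simp only [ed _ (hint f hf)]; exact h1 ⟨⟨f, hint f hf⟩, hf⟩

open Classical in
noncomputable def qf (Γ : Set (Eu n)) (A : Eu n → Matrix (Fin n) (Fin n) ℝ) (G H : Eu n → Eu n) (X : Eu n) : ℝ :=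
  if X ∈ Γ then 0 else ∑ i, ∑ j, A X i j * G X j * H X i

lemma LL.int {G H : Eu n → Eu n} (h : LL d Γ G) (h' : LL d Γ H) : ∫⁻ X, ‖G X‖ₑ * ‖H X‖ₑ ∂(mm d Γ) ≠ ∞ := by
  have := cs (μ := mm d Γ) h.1.enorm.aemeasurable h'.1.enorm.aemeasurable
  intro h0
  rw [h0] at this
  exact ENNReal.mul_ne_top h.2 h'.2 (top_le_iff.1 (by simpa [N2] using this))

lemma exForm (hA : AR n d C₀ Γ) {C₃ : ℝ} (hC : 0 < C₃) {A : Eu n → Matrix (Fin n) (Fin n) ℝ}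
    (hell : ∀ X ∉ Γ, ∀ ξ ζ : Eu n, C₃⁻¹ * infDist X Γ ^ (d + 1 - (n : ℝ)) * ‖ξ‖ ^ 2 ≤ ∑ i, ∑ j, A X i j * ξ j * ξ i ∧
      |∑ i, ∑ j, A X i j * ξ j * ζ i| ≤ C₃ * infDist X Γ ^ (d + 1 - (n : ℝ)) * ‖ξ‖ * ‖ζ‖) :
    ∃ b, Fm d Γ (Real.toNNReal C₃) b ∧ ∀ G H, Integrable (qf Γ A G H) → ∫ X, qf Γ A G H X = b G H := by
  obtain ⟨I, i1, i2, i3, i4⟩ := exI (n := n)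
  have wm := meas_wt (d := d) (Γ := Γ)
  have w0 : ∀ X, 0 ≤ wt d Γ X := fun X => Real.rpow_nonneg infDist_nonneg _
  have wΓ : ∀ X ∈ Γ, wt d Γ X = 0 := fun X hX => by
    rw [wt, infDist_zero_of_mem hX, Real.zero_rpow (by linarith [hA.hd])]
  have hle : ∀ f g : Eu n → ℝ, Dom f → Dom g → (∀ X, f X ≤ g X) → I f ≤ I g := fun f g hf hg h => by
    have hn : Dom ((-1 : ℝ) • f) := let ⟨F, a, c⟩ := hf; ⟨F, a, fun X => by simpa using c X⟩
    have := i3 (g + (-1 : ℝ) • f) (let ⟨F, a, c⟩ := hn; let ⟨F', a', c'⟩ := hg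
      ⟨F' + F, a'.add a, fun X => (abs_add_le _ _).trans (add_le_add (c' X) (c X))⟩) (fun X => by simpa using h X)
    rw [i1 _ _ hg hn, i2 _ _ hf] at this
    linarith
  have hI : ∀ {G H}, LL d Γ G → LL d Γ H → Integrable (fun X => wt d Γ X * ‖G X‖ * ‖H X‖) ∧
      ofReal (∫ X, wt d Γ X * ‖G X‖ * ‖H X‖) = ∫⁻ X, ‖G X‖ₑ * ‖H X‖ₑ ∂(mm d Γ) := fun {G H} hG hH => by
    have e := hG.int hH
    have hGm := hG.1; have hHm := hH.1
    have e2 : ∀ X, ofReal (wt d Γ X * ‖G X‖ * ‖H X‖) = ofReal (wt d Γ X) * (‖G X‖ₑ * ‖H X‖ₑ) := fun X => by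
      rw [ofReal_mul (mul_nonneg (w0 X) (norm_nonneg _)), ofReal_mul (w0 X), ofReal_norm, ofReal_norm, mul_assoc]
    have e3 : ∫⁻ X, ofReal (wt d Γ X * ‖G X‖ * ‖H X‖) = ∫⁻ X, ‖G X‖ₑ * ‖H X‖ₑ ∂(mm d Γ) := by
      rw [int_mm (by fun_prop)]
      exact lintegral_congr fun X => (e2 X).trans (by simp only [wt]; ring)
    have hnn : ∀ X, 0 ≤ wt d Γ X * ‖G X‖ * ‖H X‖ := fun X => mul_nonneg (mul_nonneg (w0 X) (norm_nonneg _)) (norm_nonneg _)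
    have hin : Integrable (fun X => wt d Γ X * ‖G X‖ * ‖H X‖) := by
      refine ⟨by fun_prop, ?_⟩
      rw [hasFiniteIntegral_iff_ofReal (Eventually.of_forall hnn), e3]; exact e.lt_top
    exact ⟨hin, by rw [ofReal_integral_eq_lintegral_ofReal hin (Eventually.of_forall hnn), e3]⟩
  have hbd : ∀ {G H} X, |qf Γ A G H X| ≤ C₃ * (wt d Γ X * ‖G X‖ * ‖H X‖) := fun {G H} X => by
    have := mul_nonneg hC.le (mul_nonneg (mul_nonneg (w0 X) (norm_nonneg (G X))) (norm_nonneg (H X)))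
    unfold qf
    split_ifs with hX
    · simpa using this
    · refine ((hell X hX (G X) (H X)).2).trans (le_of_eq ?_); simp only [wt]; ring
  have hD : ∀ {G H}, LL d Γ G → LL d Γ H → Dom (qf Γ A G H) := fun hG hH => ⟨_, (hI hG hH).1.const_mul C₃, hbd⟩
  have q1 : ∀ G G' H, qf Γ A (G + G') H = qf Γ A G H + qf Γ A G' H := fun G G' H => by
    ext1 X; simp only [qf, Pi.add_apply]; split_ifs
    · simp
    · simp [mul_add, add_mul, Finset.sum_add_distrib]
  have q2 : ∀ G H H', qf Γ A G (H + H') = qf Γ A G H + qf Γ A G H' := fun G H H' => by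
    ext1 X; simp only [qf, Pi.add_apply]; split_ifs
    · simp
    · simp [mul_add, Finset.sum_add_distrib]
  have q3 : ∀ (c : ℝ) G H, qf Γ A (c • G) H = c • qf Γ A G H := fun c G H => by
    ext1 X; simp only [qf, Pi.smul_apply, smul_eq_mul]; split_ifs
    · simp
    · simp only [Finset.mul_sum, PiLp.smul_apply, smul_eq_mul]; congr! 2; ring
  have q4 : ∀ (c : ℝ) G H, qf Γ A G (c • H) = c • qf Γ A G H := fun c G H => by
    ext1 X; simp only [qf, Pi.smul_apply, smul_eq_mul]; split_ifs
    · simp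
    · simp only [Finset.mul_sum, PiLp.smul_apply, smul_eq_mul]; congr! 2; ring
  have hC3 : (Real.toNNReal C₃ : ℝ≥0∞) = ofReal C₃ := rfl
  refine ⟨fun G H => I (qf Γ A G H), ⟨fun hG hG' hH => ?_, fun hG hH hH' => ?_, fun c hG hH => ?_, fun c hG hH => ?_, fun {G H} hG hH => ?_,
    fun {G f M} hG hf hM => ?_⟩, fun G H h => (i4 _ h).symm⟩
  · simp only [q1, i1 _ _ (hD hG hH) (hD hG' hH)]
  · simp only [q2, i1 _ _ (hD hG hH) (hD hG hH')]
  · simp only [q3, i2 _ _ (hD hG hH)]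
  · simp only [q4, i2 _ _ (hD hG hH)]
  · obtain ⟨a1, a2⟩ := hI hG hH
    have a3 := a1.const_mul C₃
    have a4 : Dom fun X => C₃ * (wt d Γ X * ‖G X‖ * ‖H X‖) := ⟨_, a3.abs, fun X => le_rfl⟩
    have a5 : I (fun X => C₃ * (wt d Γ X * ‖G X‖ * ‖H X‖)) = C₃ * ∫ X, wt d Γ X * ‖G X‖ * ‖H X‖ := by
      rw [i4 _ a3, integral_const_mul]
    rw [hC3, ← a2, ← ofReal_mul hC.le]
    refine ofReal_le_ofReal (abs_le.2 ⟨?_, ?_⟩)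
    · have : Dom ((-1:ℝ) • qf Γ A G H) := by rw [← q4]; exact hD hG (hH.smul _)
      have := hle _ _ this a4 fun X => by simpa using (neg_le_abs _).trans (hbd X)
      rw [a5, i2 _ _ (hD hG hH)] at this; linarith
    · rw [← a5]; exact hle _ _ (hD hG hH) a4 fun X => (le_abs_self _).trans (hbd X)
  · have hfG : LL d Γ fun X => f X • G X := hG.mul hf (M := Real.toNNReal M) fun X => by
      rw [← ofReal_norm, Real.norm_of_nonneg (hM X).1]; exact ofReal_le_ofReal (hM X).2
    obtain ⟨a1, a2⟩ := hI hG hfG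
    have a3 := a1.const_mul C₃⁻¹
    have e1 : ∫⁻ X, ofReal (f X) * ‖G X‖ₑ ^ 2 ∂(mm d Γ) = ∫⁻ X, ‖G X‖ₑ * ‖f X • G X‖ₑ ∂(mm d Γ) :=
      lintegral_congr fun X => by rw [enorm_smul, ← ofReal_norm (f X), Real.norm_of_nonneg (hM X).1]; ring
    rw [hC3, e1, ← a2, ← ofReal_mul hC.le]
    refine ofReal_le_ofReal ?_
    rw [← inv_mul_le_iff₀ hC, ← integral_const_mul, ← i4 _ a3]
    refine hle _ _ ⟨_, a3.abs, fun X => le_rfl⟩ (hD hG hfG) fun X => ?_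
    unfold qf
    split_ifs with hX
    · simp [wΓ X hX]
    · have := (hell X hX (G X) (G X)).1
      calc C₃⁻¹ * (wt d Γ X * ‖G X‖ * ‖f X • G X‖) = f X * (C₃⁻¹ * infDist X Γ ^ (d + 1 - (n : ℝ)) * ‖G X‖ ^ 2) := by
            rw [norm_smul, Real.norm_of_nonneg (hM X).1, wt]; ring
        _ ≤ f X * (∑ i, ∑ j, A X i j * G X j * G X i) := mul_le_mul_of_nonneg_left this (hM X).1
        _ = _ := by simp only [Finset.mul_sum, PiLp.smul_apply, smul_eq_mul]; congr! 2; ring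

section Lpn
variable {F : Type*} [NormedAddCommGroup F] {μ : Measure (Eu n)}

lemma N2_eL (f : Eu n → F) : N2 μ f = eLpNorm f 2 μ ^ 2 := by
  rw [eLpNorm_eq_lintegral_rpow_enorm_toReal two_ne_zero ENNReal.ofNat_ne_top, ← ENNReal.rpow_two, ← ENNReal.rpow_mul]
  simp [N2]

lemma N2_lp (x : Lp F 2 μ) : N2 μ x = ofReal (‖x‖ ^ 2) := by
  rw [N2_eL, ofReal_pow (norm_nonneg _), ofReal_norm, Lp.enorm_def]

lemma N2_congr {f g : Eu n → F} (h : f =ᵐ[μ] g) : N2 μ f = N2 μ g :=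
  lintegral_congr_ae (h.mono fun X hX => by simp only [hX])

lemma N2_lps (x y : Lp F 2 μ) : N2 μ (⇑x - ⇑y) = ofReal (‖x - y‖ ^ 2) := by
  rw [← N2_lp]; exact N2_congr (Lp.coeFn_sub x y).symm

lemma mlp {f : Eu n → F} (hf : AEStronglyMeasurable f μ) (h : N2 μ f ≠ ∞) : MemLp f 2 μ := by
  refine ⟨hf, lt_top_iff_ne_top.2 fun h' => h ?_⟩
  rw [N2_eL, h']; rfl
end Lpn

lemma LL.lp (x : Lp (Eu n) 2 (mm d Γ)) : LL d Γ x :=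
  ⟨(Lp.stronglyMeasurable x).measurable, by rw [N2_lp]; finiteness⟩

lemma Fm.c1 (hb : Fm d Γ Λ b) {G G' H} (hG : LL d Γ G) (hG' : LL d Γ G') (hH : LL d Γ H) (h : G =ᵐ[mm d Γ] G') : b G H = b G' H := by
  have h1 := hb.bd (hG.add (hG'.smul (-1))) hH
  rw [hb.add₁ hG (hG'.smul (-1)) hH, hb.smul₁ _ hG' hH, lintegral_congr_ae (g := fun _ => 0)
    (h.mono fun X hX => by simp [hX, en_zero])] at h1
  simp at h1; linarith

lemma Fm.c2 (hb : Fm d Γ Λ b) {G H H'} (hG : LL d Γ G) (hH : LL d Γ H) (hH' : LL d Γ H') (h : H =ᵐ[mm d Γ] H') : b G H = b G H' := by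
  have h1 := hb.bd hG (hH.add (hH'.smul (-1)))
  rw [hb.add₂ hG hH (hH'.smul (-1)), hb.smul₂ _ hG hH', lintegral_congr_ae (g := fun _ => 0)
    (h.mono fun X hX => by simp [hX, en_zero])] at h1
  simp at h1; linarith

lemma Fm.bd2 (hb : Fm d Γ Λ b) {G H} (hG : LL d Γ G) (hH : LL d Γ H) :
    ofReal |b G H| ^ 2 ≤ Λ ^ 2 * (N2 (mm d Γ) G * N2 (mm d Γ) H) := by
  refine (pow_le_pow_left' (hb.bd hG hH) 2).trans ?_
  rw [mul_pow]
  exact mul_le_mul_right (cs hG.1.enorm.aemeasurable hH.1.enorm.aemeasurable) _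

lemma Fm.bdL (hb : Fm d Γ Λ b) {G} (hG : LL d Γ G) {K : ℝ} (hK : 0 ≤ K) (hN : N2 (mm d Γ) G ≤ ofReal (K ^ 2))
    (y : Lp (Eu n) 2 (mm d Γ)) : |b G y| ≤ Λ * K * ‖y‖ := by
  have h := (hb.bd2 hG (LL.lp y)).trans (mul_le_mul_right (mul_le_mul_left hN _) _)
  rw [N2_lp, ← ofReal_mul (by positivity), ← ofReal_coe_nnreal, ← ofReal_pow (by positivity),
    ← ofReal_pow (by positivity), ← ofReal_mul (by positivity), ofReal_le_ofReal_iff (by positivity)] at h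
  exact (sq_le_sq₀ (by positivity) (by positivity)).1 (h.trans (le_of_eq (by ring)))

lemma Fm.exist (hA : AR n d C₀ Γ) (hb : Fm d Γ Λ b) {g : Eu n → ℝ} (hg : ContDiff ℝ 1 g) (hgs : HasCompactSupport g) :
    ∃ u G, Sol d Γ b u G g := by
  have hng : LL d Γ (nb g) := ⟨nb_meas hg, gfin0 hg hgs hA⟩
  have hcl : ∀ {φ}, CC Γ φ → LL d Γ (nb φ) := fun h => ⟨nb_meas h.c1, h.gfin hA⟩
  let S : Submodule ℝ (Lp (Eu n) 2 (mm d Γ)) := ⟨⟨⟨{x | ∃ φ, CC Γ φ ∧ x =ᵐ[mm d Γ] nb φ}, fun {x y} ⟨φ, h1, h2⟩ ⟨ψ, h3, h4⟩ =>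
      ⟨φ + ψ, h1.add h3, by rw [nb_add h1.c1 h3.c1]; exact (Lp.coeFn_add x y).trans (h2.add h4)⟩⟩,
    ⟨0, ⟨contDiff_const, HasCompactSupport.zero, by simp⟩, by
      have : nb (0 : Eu n → ℝ) = 0 := by ext1 X; simp [nb, gradient]
      rw [this]; exact Lp.coeFn_zero _ _ _⟩⟩,
    fun c x ⟨φ, h1, h2⟩ => ⟨c • φ, h1.smul c, by
      rw [nb_smul h1.c1]; exact (Lp.coeFn_smul c x).trans (h2.mono fun X hX => by simp [hX])⟩⟩
  let V := S.topologicalClosure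
  have : CompleteSpace V := S.isClosed_topologicalClosure.completeSpace_coe
  let B0 : V →ₗ[ℝ] V →ₗ[ℝ] ℝ := LinearMap.mk₂ ℝ (fun x y => b x.1 y.1)
    (fun x x' y => by
      rw [← hb.add₁ (LL.lp _) (LL.lp _) (LL.lp _)]
      exact hb.c1 (LL.lp _) ((LL.lp _).add (LL.lp _)) (LL.lp _) (Lp.coeFn_add _ _))
    (fun c x y => by
      rw [smul_eq_mul, ← hb.smul₁ _ (LL.lp _) (LL.lp _)]
      exact hb.c1 (LL.lp _) ((LL.lp _).smul c) (LL.lp _) (Lp.coeFn_smul _ _))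
    (fun x y y' => by
      rw [← hb.add₂ (LL.lp _) (LL.lp _) (LL.lp _)]
      exact hb.c2 (LL.lp _) (LL.lp _) ((LL.lp _).add (LL.lp _)) (Lp.coeFn_add _ _))
    (fun c x y => by
      rw [smul_eq_mul, ← hb.smul₂ _ (LL.lp _) (LL.lp _)]
      exact hb.c2 (LL.lp _) (LL.lp _) ((LL.lp _).smul c) (Lp.coeFn_smul _ _))
  let B : V →L[ℝ] V →L[ℝ] ℝ := B0.mkContinuous₂ Λ fun x y =>
    hb.bdL (LL.lp x.1) (norm_nonneg _) (N2_lp _).le y.1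
  have hB : ∀ x y, B x y = b x.1 y.1 := fun x y => rfl
  have hco : IsCoercive B := by
    refine ⟨((Λ : ℝ) + 1)⁻¹, by positivity, fun x => ?_⟩
    have h := hb.co (f := fun _ => 1) (M := 1) (LL.lp x.1) measurable_const (fun _ => ⟨zero_le_one, le_rfl⟩)
    simp only [ofReal_one, one_mul, one_smul] at h
    change N2 _ x.1 ≤ _ * ofReal (b x.1 x.1) at h
    have h0 : 0 ≤ b x.1 x.1 := by
      by_contra h'
      rw [ofReal_of_nonpos (not_le.1 h').le, mul_zero, N2_lp, nonpos_iff_eq_zero, ofReal_eq_zero] at h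
      have h3 := hb.bdL (LL.lp x.1) (norm_nonneg _) (N2_lp _).le x.1
      have : ‖x.1‖ = 0 := by nlinarith [norm_nonneg x.1]
      rw [this] at h3
      have := abs_le.1 h3
      push Not at h'; linarith
    rw [N2_lp, ← ofReal_coe_nnreal, ← ofReal_mul (by positivity), ofReal_le_ofReal_iff (by positivity)] at h
    rw [hB, mul_assoc, inv_mul_le_iff₀ (by positivity)]
    change ‖x.1‖ * ‖x.1‖ ≤ _
    nlinarith
  let l0 : V →ₗ[ℝ] ℝ := ⟨⟨fun y => -b (nb g) y.1, fun y y' => by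
      rw [← neg_add, ← hb.add₂ hng (LL.lp _) (LL.lp _)]
      exact congrArg _ (hb.c2 hng (LL.lp _) ((LL.lp _).add (LL.lp _)) (Lp.coeFn_add _ _))⟩, fun c y => by
      show _ = c * -b (nb g) y.1
      rw [mul_neg, ← hb.smul₂ _ hng (LL.lp _)]
      exact congrArg _ (hb.c2 hng (LL.lp _) ((LL.lp _).smul c) (Lp.coeFn_smul _ _))⟩
  let l : V →L[ℝ] ℝ := l0.mkContinuous (Λ * √(N2 (mm d Γ) (nb g)).toReal) fun y => by
    show ‖-b (nb g) y.1‖ ≤ _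
    rw [norm_neg]
    exact hb.bdL hng (Real.sqrt_nonneg _) (by rw [Real.sq_sqrt ENNReal.toReal_nonneg, ofReal_toReal hng.2]) y.1
  let v := hco.continuousLinearEquivOfBilin.symm ((InnerProductSpace.toDual ℝ V).symm l)
  have hv : ∀ y : V, b v.1 y.1 = - b (nb g) y.1 := fun y => by
    have h := hco.continuousLinearEquivOfBilin_apply v y
    rw [ContinuousLinearEquiv.apply_symm_apply, InnerProductSpace.toDual_symm_apply] at h
    exact h.symm
  obtain ⟨x, hx, hxl⟩ := mem_closure_iff_seq_limit.1 (show v.1 ∈ closure (S : Set _) from v.2)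
  choose φ h1 h2 using hx
  have hG : LL d Γ (⇑v.1 + nb g) := (LL.lp _).add hng
  have t1 : Tendsto (fun j => N2 (mm d Γ) (nb (φ j) - ⇑v.1)) atTop (𝓝 0) := by
    have e : ∀ j, N2 (mm d Γ) (nb (φ j) - ⇑v.1) = ofReal (‖x j - v.1‖ ^ 2) := fun j => by
      rw [← N2_lps]; exact N2_congr ((h2 j).symm.sub (ae_eq_refl _))
    simp only [e]
    have := (tendsto_iff_norm_sub_tendsto_zero.1 hxl).pow 2
    simpa using ENNReal.tendsto_ofReal this
  obtain ⟨C, hC⟩ := hA.hardyW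
  have hφ2 : ∀ j, MemLp (φ j) 2 (m2 d Γ) := fun j => mlp (h1 j).c1.continuous.aestronglyMeasurable (ne_of_lt
    ((hC _ _ _ (h1 j).w0).trans_lt (ENNReal.mul_lt_top ENNReal.coe_lt_top (((h1 j).gfin hA).lt_top))))
  let p : ℕ → Lp ℝ 2 (m2 d Γ) := fun j => (hφ2 j).toLp
  have hp : ∀ i j, ‖p i - p j‖ ≤ √C * ‖x i - x j‖ := fun i j => by
    have h := hC _ _ _ ((h1 i).add ((h1 j).smul (-1))).w0
    rw [nb_add (h1 i).c1 ((h1 j).smul _).c1, nb_smul (h1 j).c1, neg_one_smul, neg_one_smul, ← sub_eq_add_neg, ← sub_eq_add_neg,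
      N2_congr ((h2 i).symm.sub (h2 j).symm), N2_lps, ← N2_congr ((hφ2 i).coeFn_toLp.sub (hφ2 j).coeFn_toLp), N2_lps,
      ← ofReal_coe_nnreal, ← ofReal_mul (by positivity), ofReal_le_ofReal_iff (by positivity)] at h
    refine (sq_le_sq₀ (by positivity) (by positivity)).1 ?_
    rw [mul_pow, Real.sq_sqrt (by positivity)]; exact h
  have hcau : CauchySeq p := by
    have hx' := hxl.cauchySeq
    rw [Metric.cauchySeq_iff'] at hx' ⊢
    intro ε hε
    obtain ⟨N, hN⟩ := hx' (ε / (√C + 1)) (by positivity)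
    refine ⟨N, fun j hj => ?_⟩
    have := hN j hj
    rw [dist_eq_norm, lt_div_iff₀ (by positivity)] at this
    rw [dist_eq_norm]
    nlinarith [hp j N, norm_nonneg (x j - x N)]
  obtain ⟨q, hq⟩ := cauchySeq_tendsto_of_complete hcau
  have hqm := (Lp.stronglyMeasurable q).measurable
  have t2 : Tendsto (fun j => N2 (m2 d Γ) (φ j - ⇑q)) atTop (𝓝 0) := by
    have e : ∀ j, N2 (m2 d Γ) (φ j - ⇑q) = ofReal (‖p j - q‖ ^ 2) := fun j => by
      rw [← N2_lps]; exact N2_congr ((hφ2 j).coeFn_toLp.symm.sub (ae_eq_refl _))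
    simp only [e]
    have := (tendsto_iff_norm_sub_tendsto_zero.1 hq).pow 2
    simpa using ENNReal.tendsto_ofReal this
  refine ⟨⇑q + g, ⇑v.1 + nb g, hg, ?_, ?_, hqm.add hg.continuous.measurable, hG, fun ψ H hw => ?_⟩
  · obtain ⟨R, hR⟩ := hgs.isCompact.isBounded.subset_ball 0
    exact ⟨0, R, fun X hX => image_eq_zero_of_notMem_tsupport fun h => by
      have := hR h; rw [mem_ball_zero_iff] at this; linarith⟩
  · rw [add_sub_cancel_right, add_sub_cancel_right]
    exact ⟨hqm, (LL.lp _).1, subset_univ _, φ, h1, fun _ => subset_univ _, t1, t2⟩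
  · have hH := hw.ll hA
    obtain ⟨P, hP, -, hP1, -⟩ := hw.ex
    have z : ∀ j, b (⇑v.1 + nb g) (nb (P j)) = 0 := fun j => by
      let y : Lp (Eu n) 2 (mm d Γ) := (mlp (hcl (hP j)).1.aestronglyMeasurable (hcl (hP j)).2).toLp
      have hy : y =ᵐ[mm d Γ] nb (P j) := MemLp.coeFn_toLp _
      rw [← hb.c2 hG (LL.lp y) (hcl (hP j)) hy, hb.add₁ (LL.lp _) hng (LL.lp _),
        hv ⟨y, S.le_topologicalClosure ⟨P j, hP j, hy⟩⟩]
      simp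
    have e : ∀ j, ofReal |b (⇑v.1 + nb g) H| ^ 2 ≤ Λ ^ 2 * N2 (mm d Γ) (⇑v.1 + nb g) * (0 + N2 (mm d Γ) (nb (P j) - H)) := fun j => by
      have h3 := hb.bd2 hG (hH.add ((hcl (hP j)).smul (-1)))
      rw [hb.add₂ hG hH ((hcl (hP j)).smul _), hb.smul₂ _ hG (hcl (hP j)), z j, mul_zero, add_zero, neg_one_smul,
        ← sub_eq_add_neg, N2_symm, ← mul_assoc] at h3
      rwa [zero_add]
    have := lim1 hP1 (by have := hG.2; finiteness) e
    simpa using this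

lemma Sol.ub (hA : AR n d C₀ Γ) (hb : Fm d Γ Λ b) {u G g} (hs : Sol d Γ b u G g) {k : ℝ} (hk : ∀ X, g X < k) : ∀ᵐ X, u X ≤ k := by
  have h0 : ∀ X, nb (fun _ : Eu n => (1 : ℝ)) X = 0 := fun X => by simp [nb, gradient]
  have := hs.maxp hA hb (η := fun _ => 1) contDiff_const (M := 1) (fun X => by rw [h0]; simp) (k := k) (R := 0) (fun X _ _ => hk X)
    (fun X _ => ⟨h0 X, Or.inr (hk X)⟩) (Eventually.of_forall fun X h => absurd (h0 X) h)
  exact this.mono fun X h => h one_ne_zero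

lemma Sol.congr {u U G g} (hs : Sol d Γ b u G g) (hU : Measurable U) (h : u =ᵐ[volume] U) : Sol d Γ b U G g := by
  obtain ⟨P, h1, h2, h3, h4⟩ := hs.w.ex
  have hac : m2 d Γ ≪ (volume : Measure (Eu n)) := withDensity_absolutelyContinuous _ _
  refine ⟨hs.g1, hs.gc, ⟨hU.sub hs.g1.continuous.measurable, hs.w.m2, subset_univ _, P, h1, h2, h3, ?_⟩, hU, hs.Gl, hs.eq⟩
  convert h4 using 2 with j
  exact N2_congr (hac.ae_eq (h.mono fun X hX => by simp [hX]))

lemma geo {L q ε : ℝ} (hL : 0 < L) (hq : 0 ≤ q) (hq1 : q < 1) (hε : 0 < ε) : ∃ i : ℕ, L * q ^ i ≤ ε := by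
  obtain ⟨i, hi⟩ := exists_pow_lt_of_lt_one (show 0 < ε / L by positivity) hq1
  exact ⟨i, by rw [lt_div_iff₀ hL] at hi; linarith⟩

lemma Fm.bdry (hA : AR n d C₀ Γ) (hb : Fm d Γ Λ b) {u G g} (hs : Sol d Γ b u G g) {L : ℝ} (hu : ∀ᵐ X, u X ≤ L) {X0 : Eu n} (h0 : X0 ∈ Γ)
    {ε : ℝ} (hε : 0 < ε) : ∃ ρ > 0, ∀ᵐ X, X ∈ ball X0 ρ → u X ≤ g X0 + ε := by
  obtain ⟨c, c0, c1, H⟩ := hb.grow hA one_pos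
  obtain ⟨ρ0, hρ0, hρg⟩ := Metric.continuous_iff.1 hs.g1.continuous X0 (ε / 2) (by positivity)
  set L' := |L - (g X0 + ε / 2)| + 1
  have hL' : 0 < L' := by positivity
  have key : ∀ i : ℕ, ∃ ρ > 0, ρ ≤ ρ0 ∧ ∀ᵐ X, X ∈ ball X0 ρ → u X ≤ g X0 + ε / 2 + L' * (1 - c) ^ i := by
    intro i
    induction i with
    | zero => exact ⟨ρ0, hρ0, le_rfl, hu.mono fun X h _ => by linarith [le_abs_self (L - (g X0 + ε / 2))]⟩
    | succ i ih =>
      obtain ⟨ρ, hρ, hρ', h⟩ := ih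
      have hK : 0 < L' * (1 - c) ^ i := mul_pos hL' (pow_pos (by linarith) _)
      have := H _ _ _ (hs.aff hA hb (L' * (1 - c) ^ i)⁻¹ (-((L' * (1 - c) ^ i)⁻¹ * (g X0 + ε / 2)))) X0 (ρ / 8) (by positivity)
        (h.mono fun X hX hX' => by
          rw [← sub_eq_add_neg, ← mul_sub, inv_mul_le_iff₀ hK]
          linarith [hX (by convert hX' using 2; ring)])
        (fun X _ hX => by
          have h1 := hρg X (lt_of_lt_of_le (by rwa [mul_div_cancel₀ _ (by norm_num)] at hX) hρ')
          rw [Real.dist_eq, abs_lt] at h1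
          rw [← sub_eq_add_neg, ← mul_sub, inv_mul_lt_iff₀ hK]
          linarith) (Or.inl h0)
      refine ⟨ρ / 8 / 2, by positivity, by linarith, this.mono fun X hX hX' => ?_⟩
      have := hX hX'
      rw [← sub_eq_add_neg, ← mul_sub, inv_mul_le_iff₀ hK] at this
      rw [pow_succ]; linarith
  obtain ⟨i, hi⟩ := geo hL' (show 0 ≤ 1 - c by linarith) (by linarith) (half_pos hε)
  obtain ⟨ρ, hρ, -, h⟩ := key i
  exact ⟨ρ, hρ, h.mono fun X hX hX' => by linarith [hX hX']⟩

lemma Fm.intr (hA : AR n d C₀ Γ) (hb : Fm d Γ Λ b) {u G g} (hs : Sol d Γ b u G g) {L : ℝ} (hL : 0 < L) (hu : ∀ᵐ X, |u X| ≤ L) {X0 : Eu n}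
    (h0 : X0 ∉ Γ) {ε : ℝ} (hε : 0 < ε) : ∃ ρ > 0, ∃ a, ∀ᵐ X, X ∈ ball X0 ρ → |u X - a| ≤ ε := by
  set v1 := (volume (ball (0 : Eu n) 1)).toReal
  have hv1 : 0 < v1 := ENNReal.toReal_pos (measure_ball_pos _ _ one_pos).ne' measure_ball_lt_top.ne
  obtain ⟨c, c0, c1, H⟩ := hb.grow hA (show 0 < v1 / 2 by positivity)
  have hδ := hA.pos h0
  have key : ∀ i : ℕ, ∃ ρ > 0, ρ ≤ infDist X0 Γ ∧ ∃ a, ∀ᵐ X, X ∈ ball X0 ρ → |u X - a| ≤ L * (1 - c / 2) ^ i := by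
    intro i
    induction i with
    | zero => exact ⟨_, hδ, le_rfl, 0, hu.mono fun X h _ => by simpa using h⟩
    | succ i ih =>
      obtain ⟨ρ, hρ, hρ', a, h⟩ := ih
      set K := L * (1 - c / 2) ^ i with hKd
      have hK : 0 < K := mul_pos hL (pow_pos (by linarith) _)
      have hno : ∀ X ∈ Γ, X ∉ ball X0 (8 * (ρ / 8)) := fun X hX hX' => by
        rw [mul_div_cancel₀ _ (by norm_num), mem_ball, dist_comm] at hX'
        linarith [infDist_le_dist_of_mem (x := X0) hX]
      have st : ∀ s : ℝ, |s| = 1 → ofReal (v1 / 2 * (ρ / 8) ^ n) ≤ volume ({X | s * K⁻¹ * u X + -(s * K⁻¹ * a) ≤ 1 / 2} ∩ ball X0 (ρ / 8)) →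
          ∃ ρ > 0, ρ ≤ infDist X0 Γ ∧ ∃ a, ∀ᵐ X, X ∈ ball X0 ρ → |u X - a| ≤ L * (1 - c / 2) ^ (i + 1) := fun s hs1 hv => by
        have e : ∀ X, s * K⁻¹ * u X + -(s * K⁻¹ * a) = K⁻¹ * (s * (u X - a)) := fun X => by ring
        have := H _ _ _ (hs.aff hA hb (s * K⁻¹) (-(s * K⁻¹ * a))) X0 (ρ / 8) (by positivity)
          (h.mono fun X hX hX' => by
            rw [e, inv_mul_le_iff₀ hK, mul_one]
            refine (le_abs_self _).trans ?_
            rw [abs_mul, hs1, one_mul]; exact hX (by convert hX' using 2; ring))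
          (fun X hX hX' => absurd hX' (hno X hX)) (Or.inr hv)
        refine ⟨ρ / 8 / 2, by positivity, by linarith, a - s * K * (c / 2), ?_⟩
        filter_upwards [this, h] with X h1 h2 hX
        have h3 := h1 hX
        rw [e, inv_mul_le_iff₀ hK] at h3
        have h4 := abs_le.1 (h2 (ball_subset_ball (by linarith) hX))
        rw [show L * (1 - c / 2) ^ (i + 1) = K * (1 - c / 2) by rw [hKd]; ring, abs_le]
        rcases (abs_eq zero_le_one).1 hs1 with rfl | rfl <;> constructor <;> nlinarith
      have hcov : ofReal (v1 * (ρ / 8) ^ n) ≤ volume ({X | 1 * K⁻¹ * u X + -(1 * K⁻¹ * a) ≤ 1 / 2} ∩ ball X0 (ρ / 8)) +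
          volume ({X | -1 * K⁻¹ * u X + -(-1 * K⁻¹ * a) ≤ 1 / 2} ∩ ball X0 (ρ / 8)) := by
        refine le_trans (le_of_eq ?_) ((measure_mono (μ := volume) (s := ball X0 (ρ / 8)) fun X hX => ?_).trans (measure_union_le _ _))
        · rw [vball _ (by positivity), mul_comm, ofReal_mul (by positivity), ofReal_toReal measure_ball_lt_top.ne]
        · by_cases h : 1 * K⁻¹ * u X + -(1 * K⁻¹ * a) ≤ 1 / 2
          · exact Or.inl ⟨h, hX⟩
          · exact Or.inr ⟨by rw [mem_ofPred_eq]; linarith, hX⟩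
      by_cases hh : ofReal (v1 / 2 * (ρ / 8) ^ n) ≤ volume ({X | 1 * K⁻¹ * u X + -(1 * K⁻¹ * a) ≤ 1 / 2} ∩ ball X0 (ρ / 8))
      · exact st 1 (by simp) hh
      · refine st (-1) (by simp) ?_
        by_contra hh'
        have := ENNReal.add_lt_add (not_le.1 hh) (not_le.1 hh')
        rw [← ofReal_add (by positivity) (by positivity)] at this
        exact absurd (hcov.trans_lt this) (by rw [not_lt]; apply le_of_eq; congr 1; ring)
  obtain ⟨i, hi⟩ := geo hL (show 0 ≤ 1 - c / 2 by linarith) (by linarith) hε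
  obtain ⟨ρ, hρ, -, a, h⟩ := key i
  exact ⟨ρ, hρ, a, h.mono fun X hX hX' => (hX hX').trans hi⟩

lemma crep {u g : Eu n → ℝ} (hu : Measurable u) (h : ∀ X0 ε, 0 < ε → ∃ ρ > 0, ∃ a, (∀ᵐ X, X ∈ ball X0 ρ → |u X - a| ≤ ε) ∧ (X0 ∈ Γ → a = g X0)) :
    ∃ U, Continuous U ∧ u =ᵐ[volume] U ∧ ∀ X ∈ Γ, U X = g X := by
  set T : Eu n → Set ℝ := fun X => {a | ∃ ρ > 0, ∀ᵐ Z, Z ∈ ball X ρ → u Z ≤ a}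
  have key : ∀ X0 ε ρ a, (∀ᵐ X, X ∈ ball X0 ρ → |u X - a| ≤ ε) → ∀ X ∈ ball X0 ρ, |sInf (T X) - a| ≤ ε := by
    intro X0 ε ρ a h X hX
    have hlow : ∀ t ∈ T X, a - ε ≤ t := fun t ⟨ρ', hρ', ht⟩ => by
      by_contra hlt
      have h0 : volume (ball X0 ρ ∩ ball X ρ') = 0 := by
        rw [measure_eq_zero_iff_ae_notMem]
        filter_upwards [h, ht] with Z h1 h2 hZ
        have := (abs_le.1 (h1 hZ.1)).1; have := h2 hZ.2; linarith
      exact ((isOpen_ball.inter isOpen_ball).measure_pos volume ⟨X, hX, mem_ball_self hρ'⟩).ne' h0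
    obtain ⟨ρ', hρ', hs⟩ := Metric.isOpen_ball.mem_nhds hX |> Metric.mem_nhds_iff.1
    have hmem : a + ε ∈ T X := ⟨ρ', hρ', h.mono fun Z hZ hZ' => by linarith [(abs_le.1 (hZ (hs hZ'))).2]⟩
    rw [abs_le]
    constructor
    · linarith [le_csInf ⟨_, hmem⟩ hlow]
    · linarith [csInf_le ⟨_, hlow⟩ hmem]
  refine ⟨fun X => sInf (T X), ?_, ?_, fun X hX => ?_⟩
  · rw [Metric.continuous_iff]
    intro X0 ε hε
    obtain ⟨ρ, hρ, a, h1, -⟩ := h X0 (ε / 3) (by positivity)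
    refine ⟨ρ, hρ, fun X hX => ?_⟩
    have h2 := abs_le.1 (key _ _ _ _ h1 X hX); have h3 := abs_le.1 (key _ _ _ _ h1 X0 (mem_ball_self hρ))
    rw [Real.dist_eq, abs_lt]; constructor <;> linarith
  · have hk : ∀ k : ℕ, ∀ᵐ X, |u X - sInf (T X)| ≤ 2 * (1 / ((k : ℝ) + 1)) := fun k => by
      refine measure_null_of_locally_null _ fun X0 _ => ?_
      obtain ⟨ρ, hρ, a, h1, -⟩ := h X0 (1 / ((k : ℝ) + 1)) (by positivity)
      refine ⟨_, inter_mem_nhdsWithin _ (ball_mem_nhds X0 hρ), ?_⟩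
      rw [measure_eq_zero_iff_ae_notMem]
      filter_upwards [h1] with X hX hX'
      refine hX'.1 ?_
      have h2 := abs_le.1 (key _ _ _ _ h1 X hX'.2); have h3 := abs_le.1 (hX hX'.2)
      show |u X - sInf (T X)| ≤ _
      rw [abs_le]; constructor <;> linarith
    filter_upwards [ae_all_iff.2 hk] with X hX
    have : |u X - sInf (T X)| ≤ 2 * 0 := ge_of_tendsto' (tendsto_one_div_add_atTop_nhds_zero_nat.const_mul 2) hX
    rw [mul_zero, abs_nonpos_iff] at this; linarith
  · refine eq_of_forall_dist_le fun ε hε => ?_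
    obtain ⟨ρ, hρ, a, h1, h2⟩ := h X ε hε
    rw [← h2 hX]; exact key _ _ _ _ h1 X (mem_ball_self hρ)

lemma Fm.cont (hA : AR n d C₀ Γ) (hb : Fm d Γ Λ b) {g : Eu n → ℝ} (hg : ContDiff ℝ 1 g) (hgs : HasCompactSupport g) :
    ∃ u G, Continuous u ∧ Sol d Γ b u G g ∧ ∀ X ∈ Γ, u X = g X := by
  obtain ⟨u, G, hs⟩ := hb.exist hA hg hgs
  obtain ⟨M, hM⟩ := hg.continuous.bounded_above_of_compact_support hgs
  have hM0 := (norm_nonneg _).trans (hM 0)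
  have hn := hs.aff hA hb (-1) 0
  have h1 := hs.ub hA hb (k := M + 1) fun X => by linarith [le_abs_self (g X), hM X, Real.norm_eq_abs (g X)]
  have h2 := hn.ub hA hb (k := M + 1) fun X => by linarith [neg_le_abs (g X), hM X, Real.norm_eq_abs (g X)]
  have h3 : ∀ᵐ X, |u X| ≤ M + 1 := by
    filter_upwards [h1, h2] with X a b; rw [abs_le]; constructor <;> linarith
  obtain ⟨U, hU, hUe, hUg⟩ := crep (Γ := Γ) (g := g) hs.um fun X0 ε hε => by
    by_cases hX : X0 ∈ Γ
    · obtain ⟨ρ, hρ, a⟩ := hb.bdry hA hs h1 hX hε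
      obtain ⟨ρ', hρ', a'⟩ := hb.bdry hA hn h2 hX hε
      refine ⟨min ρ ρ', lt_min hρ hρ', g X0, ?_, fun _ => rfl⟩
      filter_upwards [a, a'] with X b b' hX
      have := b (ball_subset_ball (min_le_left _ _) hX); have := b' (ball_subset_ball (min_le_right _ _) hX)
      rw [abs_le]; constructor <;> linarith
    · obtain ⟨ρ, hρ, a, h⟩ := hb.intr hA hs (by positivity) h3 hX hε
      exact ⟨ρ, hρ, a, h, fun h => absurd h hX⟩
  exact ⟨U, G, hU, hs.congr hU.measurable hUe, hUg⟩

lemma nb_i (φ : Eu n → ℝ) (X : Eu n) (i : Fin n) : nb φ X i = fderiv ℝ φ X (EuclideanSpace.single i 1) := by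
  have h : inner ℝ (nb φ X) (EuclideanSpace.single i (1:ℝ)) = fderiv ℝ φ X (EuclideanSpace.single i 1) :=
    InnerProductSpace.toDual_symm_apply
  rw [← h, EuclideanSpace.inner_single_right]; simp

lemma bint {f φ : Eu n → ℝ} {R : ℝ} {M : ℝ≥0} (hs : ∀ X ∉ ball (0 : Eu n) R, φ X = 0) (hM : ∀ X, ‖φ X‖ ≤ M) :
    ‖∫ X, f X * φ X‖ₑ ≤ M * ∫⁻ X in ball 0 R, ‖f X‖ₑ := by
  refine (enorm_integral_le_lintegral_enorm _).trans ?_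
  rw [← lintegral_indicator measurableSet_ball, ← lintegral_const_mul' _ _ ENNReal.coe_ne_top]
  refine lintegral_mono fun X => ?_
  by_cases hX : X ∈ ball 0 R
  · rw [indicator_of_mem hX, enorm_mul, mul_comm]
    exact mul_le_mul_left (by rw [← ofReal_norm, ← ofReal_coe_nnreal]; exact ofReal_le_ofReal (hM X)) _
  · simp [hs X hX, en_zero]

lemma Sol.weak (hA : AR n d C₀ Γ) {u G g} (hs : Sol d Γ b u G g) (hu : Continuous u) {φ : Eu n → ℝ} (hφ : ContDiff ℝ (⊤ : ℕ∞) φ)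
    (hc : HasCompactSupport φ) (i : Fin n) :
    ∫ X, u X * fderiv ℝ φ X (EuclideanSpace.single i 1) = - ∫ X, G X i * φ X := by
  set ψ : Eu n → ℝ := fun X => fderiv ℝ φ X (EuclideanSpace.single i 1) with hψ
  have hφ1 : ContDiff ℝ 1 φ := hφ.of_le (by exact_mod_cast le_top)
  have hψc : Continuous ψ := (hφ1.continuous_fderiv one_ne_zero).clm_apply continuous_const
  have hψs : HasCompactSupport ψ := (hc.fderiv (𝕜 := ℝ)).comp_left (g := fun l : Eu n →L[ℝ] ℝ => l (EuclideanSpace.single i 1)) rfl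
  obtain ⟨M1, h1⟩ := hφ1.continuous.bounded_above_of_compact_support hc
  obtain ⟨M2, h2⟩ := hψc.bounded_above_of_compact_support hψs
  set M := Real.toNNReal (max M1 M2)
  have hM : ∀ X, ‖φ X‖ ≤ M ∧ ‖ψ X‖ ≤ M := fun X => ⟨(h1 X).trans ((le_max_left _ _).trans (Real.le_coe_toNNReal _)),
    (h2 X).trans ((le_max_right _ _).trans (Real.le_coe_toNNReal _))⟩
  obtain ⟨R, hR⟩ := (hc.isCompact.union hψs.isCompact).isBounded.subset_ball 0
  have z1 : ∀ X ∉ ball (0 : Eu n) R, φ X = 0 := fun X hX => image_eq_zero_of_notMem_tsupport fun h => hX (hR (Or.inl h))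
  have z2 : ∀ X ∉ ball (0 : Eu n) R, ψ X = 0 := fun X hX => image_eq_zero_of_notMem_tsupport fun h => hX (hR (Or.inr h))
  obtain ⟨K, hK⟩ := hA.vL1 (F := Eu n) 0 R
  have Gm : Measurable G := hs.Gl.1
  have hGi : Measurable fun X => G X i := (measurable_pi_apply i).comp ((WithLp.measurable_ofLp 2 _).comp Gm)
  have hGe : ∀ (F : Eu n → Eu n) X, ‖F X i‖ₑ ≤ ‖F X‖ₑ := fun F X => by
    rw [← ofReal_norm, ← ofReal_norm]; exact ofReal_le_ofReal (PiLp.norm_apply_le _ _)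
  have iG : Integrable fun X => G X i * φ X := by
    refine ⟨(hGi.mul hφ1.continuous.measurable).aestronglyMeasurable, ?_⟩
    refine lt_of_le_of_lt (b := (M : ℝ≥0∞) * ∫⁻ X in ball 0 R, ‖G X‖ₑ) ?_ (ENNReal.mul_lt_top ENNReal.coe_lt_top ?_)
    · rw [← lintegral_indicator measurableSet_ball, ← lintegral_const_mul' _ _ ENNReal.coe_ne_top]
      refine lintegral_mono fun X => ?_
      by_cases hX : X ∈ ball 0 R
      · rw [indicator_of_mem hX, enorm_mul, mul_comm]
        exact mul_le_mul' (by rw [← ofReal_norm, ← ofReal_coe_nnreal]; exact ofReal_le_ofReal (hM X).1) (hGe G X)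
      · simp [z1 X hX, en_zero]
    · have := hK G Gm
      by_contra h
      rw [not_lt, top_le_iff] at h
      rw [h] at this
      exact ENNReal.mul_ne_top ENNReal.coe_ne_top hs.Gl.2 (top_le_iff.1 (by simpa using this))
  obtain ⟨P, hP, -, hP1, hP2⟩ := hs.w.ex
  set h : ℕ → Eu n → ℝ := fun j => P j + g
  have hh : ∀ j, ContDiff ℝ 1 (h j) := fun j => (hP j).c1.add hs.g1
  have hnh : ∀ j, nb (h j) = nb (P j) + nb g := fun j => nb_add (hP j).c1 hs.g1
  have I1 : ∀ f : Eu n → ℝ, Continuous f → Integrable fun X => f X * ψ X := fun f hf => (hf.mul hψc).integrable_of_hasCompactSupport hψs.mul_left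
  have hni : ∀ j, Continuous fun X => nb (h j) X i := fun j => by
    simp only [nb_i]; exact ((hh j).continuous_fderiv one_ne_zero).clm_apply continuous_const
  have I2 : ∀ j, Integrable fun X => nb (h j) X i * φ X := fun j =>
    ((hni j).mul hφ1.continuous).integrable_of_hasCompactSupport hc.mul_left
  have ibp : ∀ j, ∫ X, h j X * ψ X = - ∫ X, nb (h j) X i * φ X := fun j => by
    have := integral_mul_fderiv_eq_neg_fderiv_mul_of_integrable (μ := (volume : Measure (Eu n))) (f := h j) (g := φ)
      (v := EuclideanSpace.single i (1:ℝ)) (by simpa only [nb_i] using I2 j) (I1 _ (hh j).continuous)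
      (((hh j).continuous.mul hφ1.continuous).integrable_of_hasCompactSupport hc.mul_left)
      (fun X _ => (hh j).differentiable one_ne_zero X) (fun X _ => hφ1.differentiable one_ne_zero X)
    simpa only [nb_i] using this
  have e1 : ∀ j, (∫ X, u X * ψ X) + ∫ X, G X i * φ X = (∫ X, (u X - h j X) * ψ X) + ∫ X, (G X i - nb (h j) X i) * φ X := fun j => by
    simp only [sub_mul]
    rw [integral_sub (I1 _ hu) (I1 _ (hh j).continuous), integral_sub iG (I2 j), ibp j]; ring
  have t1 := hA.vL3 (fun j => (hP j).c1.continuous.measurable) hs.w.m1 hP2 0 R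
  have t2 : Tendsto (fun j => ∫⁻ X in ball 0 R, ‖(nb (P j) - (G - nb g)) X‖ₑ) atTop (𝓝 0) :=
    sq0 (lim0 hP1 fun j => hK _ ((nb_meas (hP j).c1).sub hs.w.m2))
  have t3 := t1.add t2
  rw [add_zero] at t3
  have fin : ‖(∫ X, u X * ψ X) + ∫ X, G X i * φ X‖ₑ ≤ M * 0 := by
    refine lim1 t3 ENNReal.coe_ne_top fun j => ?_
    rw [e1 j, zero_add, mul_add]
    refine (enorm_add_le _ _).trans (add_le_add ((bint z2 fun X => (hM X).2).trans (le_of_eq ?_)) ((bint z1 fun X => (hM X).1).trans ?_))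
    · congr 1; refine lintegral_congr fun X => ?_
      congr 1; simp only [h, Pi.sub_apply, Pi.add_apply]; ring
    · refine mul_le_mul_right (lintegral_mono fun X => ?_) _
      refine le_trans (le_of_eq ?_) (hGe (fun X => (nb (P j) - (G - nb g)) X) X)
      rw [hnh, ← enorm_neg]; congr 1
      simp only [Pi.sub_apply, Pi.add_apply, PiLp.sub_apply, PiLp.add_apply]; ring
  have : ‖(∫ X, u X * ψ X) + ∫ X, G X i * φ X‖ₑ = 0 := by simpa using fin
  rw [enorm_eq_zero] at this
  linarith

lemma exrep (hA : AR n d C₀ Γ) {A : Eu n → Matrix (Fin n) (Fin n) ℝ} (hb : Fm d Γ Λ b)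
    (hq : ∀ G H, Integrable (qf Γ A G H) → ∫ X, qf Γ A G H X = b G H) {ω : Eu n → Measure (Eu n)}
    (hprob : ∀ X ∉ Γ, IsProbabilityMeasure (ω X) ∧ ω X Γᶜ = 0)
    (hrepr : ∀ (u : EuclideanSpace ℝ (Fin n) → ℝ)
      (G : EuclideanSpace ℝ (Fin n) → EuclideanSpace ℝ (Fin n)),
      Continuous u →
      (∀ φ : EuclideanSpace ℝ (Fin n) → ℝ, ContDiff ℝ (⊤ : ℕ∞) φ → HasCompactSupport φ →
        tsupport φ ⊆ Γᶜ → ∀ i : Fin n,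
          ∫ X, u X * fderiv ℝ φ X (EuclideanSpace.single i 1) = - ∫ X, G X i * φ X) →
      ((∫⁻ X in Γᶜ,
          ofReal (‖G X‖ ^ 2 * Metric.infDist X Γ ^ (d + 1 - (n : ℝ)))) < ⊤) →
      (∀ φ : EuclideanSpace ℝ (Fin n) → ℝ, ContDiff ℝ (⊤ : ℕ∞) φ → HasCompactSupport φ →
        tsupport φ ⊆ Γᶜ →
          ∫ X, ∑ i, (∑ j, A X i j * G X j) * fderiv ℝ φ X (EuclideanSpace.single i 1) = 0) →
      ∀ X ∉ Γ, u X = ∫ y, u y ∂(ω X))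
    {g : Eu n → ℝ} (hg : ContDiff ℝ 1 g) (hgs : HasCompactSupport g) :
    ∃ u G, Continuous u ∧ Sol d Γ b u G g ∧ (∀ X ∈ Γ, u X = g X) ∧ ∀ X ∉ Γ, u X = ∫ y, g y ∂(ω X) := by
  obtain ⟨u, G, hu, hs, hΓ⟩ := hb.cont hA hg hgs
  refine ⟨u, G, hu, hs, hΓ, fun X hX => ?_⟩
  rw [hrepr u G hu (fun φ h1 h2 _ i => hs.weak hA hu h1 h2 i) ?_ (fun φ h1 h2 h3 => ?_) X hX]
  · refine integral_congr_ae (mem_ae_iff.2 (measure_mono_null (fun y hy => ?_) (hprob X hX).2))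
    exact fun hy' => hy (hΓ y hy')
  · refine (setLIntegral_le_lintegral _ _).trans_lt (lt_of_le_of_lt (le_of_eq ?_) hs.Gl.2.lt_top)
    have hm := hs.Gl.1
    rw [N2, int_mm (by fun_prop)]
    refine lintegral_congr fun X => ?_
    rw [ofReal_mul (by positivity), ofReal_pow (norm_nonneg _), ofReal_norm]
    congr 3; ring
  · have hcc : CC Γ φ := ⟨h1.of_le (by exact_mod_cast le_top), h2, h3⟩
    have e : (fun X => ∑ i, (∑ j, A X i j * G X j) * fderiv ℝ φ X (EuclideanSpace.single i 1)) = qf Γ A G (nb φ) := by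
      ext X; unfold qf
      split_ifs with hX
      · rw [((hcc.zero hX).fderiv_eq : fderiv ℝ φ X = fderiv ℝ 0 X)]; simp
      · simp only [nb_i, Finset.sum_mul]
    rw [e]
    by_cases hi : Integrable (qf Γ A G (nb φ))
    · rw [hq _ _ hi]; exact hs.eq _ _ hcc.w0
    · exact integral_undef hi

def Hm (d : ℝ) (Γ : Set (Eu n)) (b : (Eu n → Eu n) → (Eu n → Eu n) → ℝ) (u : Eu n → ℝ) : Prop :=
  Continuous u ∧ ∃ G g, Sol d Γ b u G g ∧ ∀ X ∈ Γ, g X = u X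

lemma Hm.aff {u} (h : Hm d Γ b u) (hA : AR n d C₀ Γ) (hb : Fm d Γ Λ b) (a c : ℝ) : Hm d Γ b (fun X => a * u X + c) :=
  let ⟨h1, _, _, h2, h3⟩ := h
  ⟨by fun_prop, _, _, h2.aff hA hb a c, fun X hX => by simp only [h3 X hX]⟩

lemma Hm.add {u v} (h : Hm d Γ b u) (hA : AR n d C₀ Γ) (hb : Fm d Γ Λ b) (h' : Hm d Γ b v) : Hm d Γ b (fun X => u X + v X) :=
  let ⟨h1, _, _, h2, h3⟩ := h
  let ⟨h1', _, _, h2', h3'⟩ := h'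
  ⟨h1.add h1', _, _, h2.add hA hb h2', fun X hX => by simp only [h3 X hX, h3' X hX]⟩

lemma ae_all_of {u : Eu n → ℝ} (hu : Continuous u) {U : Set (Eu n)} (hU : IsOpen U) {K : ℝ} (h : ∀ᵐ X, X ∈ U → u X ≤ K) : ∀ X ∈ U, u X ≤ K := by
  intro X hX
  by_contra hlt
  refine ((hU.inter (isOpen_lt continuous_const hu)).measure_pos volume ⟨X, hX, show K < u X from not_le.1 hlt⟩).ne' ?_
  rw [measure_eq_zero_iff_ae_notMem]
  exact h.mono fun Z hZ hZ' => absurd (hZ hZ'.1) (not_le.2 hZ'.2)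

lemma dens (hA : AR n d C₀ Γ) (hb : Fm d Γ Λ b) {Q : ℝ} (hQ : 0 < Q) : ∃ ε : ℝ, 0 < ε ∧ ∀ u, Hm d Γ b u → ∀ (y : Eu n) (τ : ℝ), 0 < τ →
    0 < u y → (∀ X ∈ ball y τ, u X ≤ Q * u y) → (∀ X ∈ Γ, X ∈ ball y τ → u X ≤ 0) →
    ofReal (ε * τ ^ n) < volume ({X | u y / 2 < u X} ∩ ball y τ) := by
  obtain ⟨ε, hε, H⟩ := hb.sup hA (K := 1 / (4 * Q)) (by positivity)
  refine ⟨ε, hε, fun u hu y τ hτ hy hB hΓ => ?_⟩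
  by_contra hlt
  have hv := hu.aff hA hb (Q * u y)⁻¹ (-((Q * u y)⁻¹ * (u y / 2)))
  have hp : 0 < Q * u y := by positivity
  have e : ∀ X, (Q * u y)⁻¹ * u X + -((Q * u y)⁻¹ * (u y / 2)) = (Q * u y)⁻¹ * (u X - u y / 2) := fun X => by ring
  obtain ⟨c1, G, g, hs, hg⟩ := hv
  have h1 := H _ _ _ hs y τ hτ (Eventually.of_forall fun X hX => by
      rw [e, inv_mul_le_iff₀ hp]; linarith [hB X hX]) (fun X hX hX' => by
      rw [hg X hX]; beta_reduce; rw [e, inv_mul_lt_iff₀ hp]; linarith [hΓ X hX hX']) (by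
      refine le_trans (measure_mono (inter_subset_inter_left _ fun X hX => ?_)) (not_lt.1 hlt)
      rw [mem_ofPred_eq, e] at hX
      have := (mul_pos_iff_of_pos_left (inv_pos.2 hp)).1 hX
      rw [mem_ofPred_eq]; linarith)
  have h2 := ae_all_of c1 isOpen_ball h1 y (mem_ball_self (by positivity))
  rw [e, inv_mul_le_iff₀ hp] at h2
  have : Q * u y * (1 / (4 * Q)) = u y / 4 := by field_simp
  linarith

lemma grw (hA : AR n d C₀ Γ) (hb : Fm d Γ Λ b) {θ : ℝ} (hθ : 0 < θ) : ∃ c : ℝ, 0 < c ∧ c ≤ 1 / 2 ∧ ∀ u, Hm d Γ b u → ∀ (y : Eu n) (ρ m : ℝ),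
    0 < ρ → 0 < m → (∀ X ∈ ball y (8 * ρ), 0 ≤ u X) → (∀ X ∈ Γ, X ∈ ball y (8 * ρ) → m < u X) →
    (y ∈ Γ ∨ ofReal (θ * ρ ^ n) ≤ volume ({X | m ≤ u X} ∩ ball y ρ)) → ∀ X ∈ ball y (ρ / 2), c * m ≤ u X := by
  obtain ⟨c, c0, c1, H⟩ := hb.grow hA hθ
  refine ⟨c, c0, c1, fun u hu y ρ m hρ hm h0 hΓ hor => ?_⟩
  have hp : 0 < 2 * m := by positivity
  obtain ⟨c1, G, g, hs, hg⟩ := hu.aff hA hb (-(2 * m)⁻¹) 1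
  have e : ∀ X, -(2 * m)⁻¹ * u X + 1 = 1 - (2 * m)⁻¹ * u X := fun X => by ring
  have h1 := H _ _ _ hs y ρ hρ (Eventually.of_forall fun X hX => by
      rw [e]; have := mul_nonneg (inv_pos.2 hp).le (h0 X hX); linarith) (fun X hX hX' => by
      rw [hg X hX]; beta_reduce; rw [e]
      have : 1 / 2 < (2 * m)⁻¹ * u X := by rw [lt_inv_mul_iff₀ hp]; linarith [hΓ X hX hX']
      linarith) (hor.imp id fun h => h.trans (measure_mono (inter_subset_inter_left _ fun X hX => by
        rw [mem_ofPred_eq] at hX ⊢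
        rw [e]
        have : 1 / 2 ≤ (2 * m)⁻¹ * u X := by rw [le_inv_mul_iff₀ hp]; linarith
        linarith)))
  intro X hX
  have h2 := ae_all_of c1 isOpen_ball h1 X hX
  rw [e] at h2
  have h3 : c ≤ (2 * m)⁻¹ * u X := by linarith
  rw [le_inv_mul_iff₀ hp] at h3
  nlinarith

lemma blow {u : Eu n → ℝ} (hu : Continuous u) {x0 : Eu n} {R Q C : ℝ} (hR : 0 < R) (hQ : 2 ≤ Q) (hC : 0 ≤ C)
    (h : ∀ j : ℕ, ∀ y ∈ ball x0 (3 * R), 0 < u y → (∀ z ∈ ball y (R / 2 ^ j), u z ≤ Q * u y) → u y ≤ C * Q ^ j) : ∀ X ∈ ball x0 R, u X ≤ C := by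
  intro X hX
  by_contra hlt
  rw [not_le] at hlt
  have hex : ∀ (j : ℕ) y, ∃ z, y ∈ ball x0 (3 * R) → 0 < u y → C * Q ^ j < u y → z ∈ ball y (R / 2 ^ j) ∧ Q * u y < u z := fun j y => by
    by_contra hc
    push Not at hc
    obtain ⟨h1, h2, h3, -⟩ := hc y
    exact absurd (h j y h1 h2 fun z hz => (hc z).2.2.2 hz) (not_le.2 h3)
  choose f hf using hex
  let z : ℕ → Eu n := fun j => Nat.rec X (fun j y => f j y) j
  have key : ∀ j, dist (z j) x0 < R + 2 * R * (1 - 1 / 2 ^ j) ∧ C * Q ^ j < u (z j) ∧ u X * Q ^ j ≤ u (z j) ∧ dist (z j) (z (j + 1)) < R / 2 ^ j := by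
    have aux : ∀ j, dist (z j) x0 < R + 2 * R * (1 - 1 / 2 ^ j) ∧ C * Q ^ j < u (z j) ∧ u X * Q ^ j ≤ u (z j) →
        z (j + 1) ∈ ball (z j) (R / 2 ^ j) ∧ Q * u (z j) < u (z (j + 1)) := fun j ⟨h1, h2, h3⟩ => by
      have hp : (0:ℝ) < 1 / 2 ^ j := by positivity
      exact hf j (z j) (by rw [mem_ball]; nlinarith) (lt_of_le_of_lt (by positivity) h2) h2
    have k2 : ∀ j, dist (z j) x0 < R + 2 * R * (1 - 1 / 2 ^ j) ∧ C * Q ^ j < u (z j) ∧ u X * Q ^ j ≤ u (z j) := fun j => by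
      induction j with
      | zero => simpa [z] using ⟨hX, hlt⟩
      | succ j ih =>
        obtain ⟨a1, a2⟩ := aux j ih
        obtain ⟨h1, h2, h3⟩ := ih
        rw [mem_ball] at a1
        refine ⟨?_, ?_, ?_⟩
        · have := dist_triangle (z (j + 1)) (z j) x0
          have e : R / 2 ^ j = 2 * R * (1 / 2 ^ j) - 2 * R * (1 / 2 ^ (j + 1)) := by rw [pow_succ]; field_simp; ring
          nlinarith
        · rw [pow_succ]; nlinarith
        · rw [pow_succ]; nlinarith
    exact fun j => ⟨(k2 j).1, (k2 j).2.1, (k2 j).2.2, by rw [dist_comm]; exact (aux j (k2 j)).1⟩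
  have hcau : CauchySeq z := cauchySeq_of_le_geometric_two (C := 2 * R) fun j => by
    have := (key j).2.2.2.le; rwa [mul_div_cancel_left₀ _ two_ne_zero]
  obtain ⟨q, hq⟩ := cauchySeq_tendsto_of_complete hcau
  have t1 := (hu.tendsto q).comp hq
  have t2 : Tendsto (fun j : ℕ => u X * Q ^ j) atTop atTop :=
    (tendsto_pow_atTop_atTop_of_one_lt (by linarith)).const_mul_atTop (hC.trans_lt hlt)
  exact not_tendsto_atTop_of_tendsto_nhds t1 (tendsto_atTop_mono (fun j => (key j).2.2.1) t2)

lemma harnack (hA : AR n d C₀ Γ) (hb : Fm d Γ Λ b) : ∃ C : ℝ, 1 ≤ C ∧ ∀ u, Hm d Γ b u → ∀ (x0 : Eu n) (R : ℝ), 0 < R →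
    (∀ X ∈ ball x0 (80 * R), 0 ≤ u X ∧ X ∉ Γ) → ∀ X ∈ ball x0 R, ∀ Y ∈ ball x0 R, u X ≤ C * u Y := by
  set v1 := (volume (ball (0 : Eu n) 1)).toReal
  have hv1 : 0 < v1 := ENNReal.toReal_pos v1pos measure_ball_lt_top.ne
  obtain ⟨c2, p2, q2, H2⟩ := grw hA hb (θ := v1 / 4 ^ n) (by positivity)
  obtain ⟨ε, hε, HD⟩ := dens hA hb (Q := c2⁻¹) (by positivity)
  obtain ⟨c1, p1, q1, H1⟩ := grw hA hb hε
  have hQ : 2 ≤ c2⁻¹ := by rw [le_inv_comm₀ (by norm_num) p2]; linarith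
  refine ⟨(c1 * c2 ^ 3 / 2)⁻¹, ?_, fun u hu x0 R hR hB X hX Y hY => ?_⟩
  · rw [one_le_inv₀ (by positivity)]
    have : c2 ^ 3 ≤ 1 := pow_le_one₀ p2.le (by linarith)
    nlinarith [pow_pos p2 3]
  refine blow hu.1 hR hQ (mul_nonneg (by positivity) (hB Y (ball_subset_ball (by linarith) hY)).1) (fun j y hy hpos hz => ?_) X hX
  set τ := R / 2 ^ j with hτd
  have hτ : 0 < τ := by positivity
  have hτR : τ ≤ R := div_le_self hR.le (one_le_pow₀ one_le_two)
  rw [mem_ball] at hy hY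
  have hin : ∀ s ≤ 64 * R, ∀ Z ∈ ball y s, 0 ≤ u Z ∧ Z ∉ Γ := fun s hs Z hZ => hB Z (by
    rw [mem_ball] at hZ ⊢; linarith [dist_triangle Z y x0])
  have st : ∀ k ≤ j + 3, ∀ Z ∈ ball y (τ * 2 ^ k / 2), c1 * c2 ^ k * (u y / 2) ≤ u Z := fun k => by
    induction k with
    | zero =>
      intro _ Z hZ
      have h8 : 8 * τ ≤ 64 * R := by linarith
      rw [pow_zero, mul_one]
      refine H1 u hu y τ (u y / 2) hτ (by positivity) (fun X hX => (hin _ h8 X hX).1) (fun X hX hX' => absurd hX (hin _ h8 X hX').2)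
        (Or.inr ((HD u hu y τ hτ hpos hz fun X hX hX' => absurd hX (hin τ (by linarith) X hX').2).le.trans
          (measure_mono (inter_subset_inter_left _ fun X hX => show u y / 2 ≤ u X from le_of_lt hX)))) Z (by simpa using hZ)
    | succ k ih =>
      intro hk Z hZ
      have ih := ih (by omega)
      have hle : τ * 2 ^ k ≤ 4 * R := by
        rw [hτd, div_mul_eq_mul_div, div_le_iff₀ (by positivity)]
        have : (2:ℝ) ^ k ≤ 2 ^ (j + 2) := pow_le_pow_right₀ one_le_two (by omega)
        rw [pow_add] at this; nlinarith
      have h8 : 8 * (τ * 2 ^ k * 2) ≤ 64 * R := by linarith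
      have := H2 u hu y (τ * 2 ^ k * 2) (c1 * c2 ^ k * (u y / 2)) (by positivity) (by positivity) (fun X hX => (hin _ h8 X hX).1)
        (fun X hX hX' => absurd hX (hin _ h8 X hX').2) (Or.inr ?_) Z (by convert hZ using 2; rw [pow_succ]; ring)
      · rw [pow_succ]; linarith
      · refine le_trans (le_of_eq ?_) (measure_mono (μ := volume) (s := ball y (τ * 2 ^ k / 2)) fun X hX =>
          ⟨ih X hX, ball_subset_ball (by nlinarith [show 0 < τ * 2 ^ k by positivity]) hX⟩)
        rw [vball _ (by positivity), ← ofReal_toReal (measure_ball_lt_top (μ := volume) (x := (0 : Eu n)) (r := 1)).ne,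
          ← ofReal_mul (by positivity)]
        congr 1
        rw [show τ * 2 ^ k * 2 = (τ * 2 ^ k / 2) * 4 by ring, mul_pow]
        field_simp
        rfl
  have hf := st (j + 3) le_rfl Y (by
    rw [mem_ball, hτd, pow_add]
    have : R / 2 ^ j * (2 ^ j * 2 ^ 3) / 2 = 4 * R := by field_simp; norm_num
    rw [this]; linarith [dist_triangle_right Y y x0])
  rw [inv_pow, ← div_eq_mul_inv, le_div_iff₀ (by positivity), le_inv_mul_iff₀ (by positivity)]
  rw [pow_add] at hf; linarith

lemma hc (hA : AR n d C₀ Γ) (hb : Fm d Γ Λ b) {ε K : ℝ} (hε : 0 < ε) (hK : 0 < K) : ∃ C : ℝ, 1 ≤ C ∧ ∀ u, Hm d Γ b u → ∀ (s : ℝ) (X Y : Eu n),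
    0 < s → ε * s ≤ infDist X Γ → ε * s ≤ infDist Y Γ → dist X Y ≤ K * s → (∀ Z ∈ ball X ((K + 2) * s), 0 ≤ u Z) → u X ≤ C * u Y := by
  obtain ⟨C, hC, H⟩ := harnack hA hb
  set e := min ε 1
  have he : 0 < e := lt_min hε one_pos
  have heε : e ≤ ε := min_le_left _ _
  have he1 : e ≤ 1 := min_le_right _ _
  obtain ⟨e', he', HZ⟩ := hA.chain (show 0 < e / 80 by positivity) hK
  set f := min e' 1
  have hf : 0 < f := lt_min he' one_pos
  have hfe : f ≤ e' := min_le_left _ _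
  have hf1 : f ≤ 1 := min_le_right _ _
  obtain ⟨N, hN⟩ := exists_nat_gt (80 * K / f)
  have hN0 : (0:ℝ) < N := lt_trans (by positivity) hN
  refine ⟨C ^ (N + 2), one_le_pow₀ hC, fun u hu s X Y hs hX hY hXY hp => ?_⟩
  have st : ∀ (P : Eu n) (a : ℝ), 0 < a → a ≤ 1 → a * s ≤ infDist P Γ → dist P X ≤ (K + 1) * s → ∀ P1 P2, dist P1 P < a * s / 80 → dist P2 P < a * s / 80 → u P1 ≤ C * u P2 := by
    intro P a ha ha1 h1 h2 P1 P2 h3 h4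
    refine H u hu P (a * s / 80) (by positivity) (fun Z hZ => ?_) P1 h3 P2 h4
    rw [mem_ball] at hZ
    have : a * s ≤ s := by nlinarith
    refine ⟨hp Z ?_, fun hZ' => ?_⟩
    · rw [mem_ball]; linarith [dist_triangle Z P X]
    · have := infDist_le_dist_of_mem (x := P) hZ'
      rw [dist_comm] at this; linarith
  obtain ⟨z, hz, HP⟩ := HZ s X Y hs hXY
  set p : ℕ → Eu n := fun i => X + z + ((i:ℝ) / N) • (Y - X)
  have hes : e * s ≤ s := by nlinarith
  have hEs : e * s ≤ ε * s := by nlinarith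
  have hfs : f * s ≤ e' * s := by nlinarith
  have hI : ∀ i ≤ N, u X ≤ C ^ (i + 1) * u (p i) := by
    intro i
    induction i with
    | zero =>
      intro _
      rw [zero_add, pow_one]
      refine st X e he he1 (by linarith) (by rw [dist_self]; positivity) X _ (by rw [dist_self]; positivity) ?_
      simp only [p, Nat.cast_zero, zero_div, zero_smul, add_zero, dist_eq_norm, add_sub_cancel_left]; linarith
    | succ i ih =>
      intro hi
      refine (ih (by omega)).trans ?_
      rw [pow_succ _ (i + 1), mul_assoc]
      refine mul_le_mul_of_nonneg_left ?_ (by positivity)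
      have hiN : (i:ℝ) ≤ N := by exact_mod_cast (by omega : i ≤ N)
      have ht : (i:ℝ) / N ∈ Icc (0:ℝ) 1 := ⟨by positivity, by rw [div_le_one hN0]; exact hiN⟩
      have hYX : ‖Y - X‖ ≤ K * s := by rwa [← dist_eq_norm, dist_comm]
      refine st (p i) f hf hf1 (by linarith [HP _ ht]) ?_ (p i) _ (by rw [dist_self]; positivity) ?_
      · have : dist (p i) X = ‖z + ((i:ℝ) / N) • (Y - X)‖ := by rw [dist_eq_norm]; congr 1; simp only [p]; abel
        rw [this]
        have h2 := norm_add_le z (((i:ℝ) / N) • (Y - X))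
        rw [norm_smul, Real.norm_of_nonneg ht.1] at h2
        nlinarith [ht.2, ht.1, norm_nonneg (Y - X)]
      · have : dist (p (i + 1)) (p i) = (1 / N) * ‖Y - X‖ := by
          rw [dist_eq_norm, ← Real.norm_of_nonneg (show (0:ℝ) ≤ 1 / N by positivity), ← norm_smul]; congr 1
          simp only [p]; rw [add_sub_add_left_eq_sub, ← sub_smul]; congr 1; push_cast; ring
        rw [this]
        rw [div_lt_iff₀ hf] at hN
        rw [one_div, inv_mul_lt_iff₀ hN0]
        nlinarith
  refine (hI N le_rfl).trans ?_
  rw [pow_succ _ (N + 1), mul_assoc]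
  refine mul_le_mul_of_nonneg_left ?_ (by positivity)
  refine st Y e he he1 (by linarith) (by rw [dist_comm]; nlinarith) _ _ ?_ (by rw [dist_self]; positivity)
  have : dist (p N) Y = ‖z‖ := by
    rw [dist_eq_norm]; congr 1; simp only [p]; rw [div_self hN0.ne', one_smul]; abel
  rw [this]; linarith

lemma carl (hA : AR n d C₀ Γ) (hb : Fm d Γ Λ b) {ε K : ℝ} (hε : 0 < ε) (hK : 0 < K) : ∃ C : ℝ, 1 ≤ C ∧ ∀ u, Hm d Γ b u → (∀ X, 0 ≤ u X) →
    ∀ (x0 A : Eu n) (R : ℝ), 0 < R → (∀ X ∈ Γ, X ∈ ball x0 (8 * R) → u X = 0) → ε * R ≤ infDist A Γ → dist A x0 ≤ K * R →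
    ∀ X ∈ ball x0 R, u X ≤ C * u A := by
  obtain ⟨c, hc0, hc1, HC⟩ := hA.cork
  obtain ⟨Q1, hQ1, HQ⟩ := hc hA hb hc0 (show (0:ℝ) < 3 by norm_num)
  set Q := max Q1 2
  have hQ : 2 ≤ Q := le_max_right _ _
  have hQQ : Q1 ≤ Q := le_max_left _ _
  obtain ⟨ε0, hε0, HD⟩ := dens hA hb (show 0 < Q by linarith)
  obtain ⟨Cn, HN⟩ := hA.nbhd
  obtain ⟨η, hη0, hη1, hη2⟩ := small_rpow Cn (a := ofReal ε0) (by simpa using hε0) (p := n - d) (by linarith [hA.hd]) one_pos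
  obtain ⟨C2, hC2, H2⟩ := hc hA hb (lt_min hη0 hc0) (show (0:ℝ) < 2 by norm_num)
  obtain ⟨C3, hC3, H3⟩ := hc hA hb (lt_min hε hc0) (show (0:ℝ) < K + 4 by positivity)
  refine ⟨2 * C2 * C3, by nlinarith, fun u hu hp x0 A R hR h0 hA1 hA2 X hX => ?_⟩
  refine blow hu.1 hR hQ (mul_nonneg (by positivity) (hp A)) (fun j y hy hpos hz => ?_) X hX
  set τ := R / 2 ^ j with hτd
  have hτ : 0 < τ := by positivity
  have hτR : τ ≤ R := div_le_self hR.le (one_le_pow₀ one_le_two)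
  have h1 := HD u hu y τ hτ hpos hz fun X hX hX' => (h0 X hX (by
    rw [mem_ball] at *; linarith [dist_triangle X y x0])).le
  choose! Z hZ1 hZ2 using fun k : ℕ => HC y (2 ^ k * τ) (by positivity)
  have h2 := HN y (η * τ) τ (by positivity) (by nlinarith)
  rw [Real.mul_rpow hη0.le hτ.le, mul_assoc, ← Real.rpow_add hτ, sub_add_cancel, Real.rpow_natCast, ofReal_mul (by positivity), ← mul_assoc] at h2
  have h3 : ∃ z ∈ ball y τ, u y / 2 < u z ∧ η * τ ≤ infDist z Γ := by
    by_contra! hcon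
    refine absurd (h1.trans_le (measure_mono fun X hX => (⟨hcon X hX.2 hX.1, hX.2⟩ : X ∈ {X | infDist X Γ < η * τ} ∩ ball y τ))) (not_lt.2 (h2.trans ?_))
    rw [ofReal_mul hε0.le]
    exact mul_le_mul_left hη2.le _
  obtain ⟨z, hzy, hz1, hz2⟩ := h3
  have a1 : min η c ≤ η := min_le_left _ _
  have a2 : min η c ≤ c := min_le_right _ _
  have a3 : min ε c ≤ ε := min_le_left _ _
  have a4 : min ε c ≤ c := min_le_right _ _
  have hZ2' := hZ2 0
  have hZ1' := hZ1 0
  simp only [pow_zero, one_mul, mem_ball] at hZ1' hZ2' hzy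
  have h4 := H2 u hu τ z (Z 0) hτ (by nlinarith) (by nlinarith) (by linarith [dist_triangle_right z (Z 0) y]) fun _ _ => hp _
  have h5 : ∀ k, u (Z 0) ≤ Q ^ k * u (Z k) := fun k => by
    induction k with
    | zero => simp
    | succ k ih =>
      have hs : 0 < 2 ^ k * τ := by positivity
      have b1 := hZ1 k
      have b2 := hZ1 (k + 1)
      have b3 := hZ2 (k + 1)
      rw [mem_ball] at b1 b2
      rw [pow_succ] at b2 b3
      have b4 := HQ u hu (2 ^ k * τ) (Z k) (Z (k + 1)) hs (hZ2 k) (by nlinarith) (by linarith [dist_triangle_right (Z k) (Z (k + 1)) y]) fun _ _ => hp _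
      rw [pow_succ, mul_assoc]
      exact ih.trans (mul_le_mul_of_nonneg_left (b4.trans (mul_le_mul_of_nonneg_right hQQ (hp _))) (by positivity))
  have hj : 2 ^ j * τ = R := by rw [hτd]; field_simp
  have c1 := hZ1 j
  have c2 := hZ2 j
  rw [hj] at c1 c2
  rw [mem_ball] at c1 hy
  have h6 := H3 u hu R (Z j) A hR (by nlinarith) (by nlinarith) (by linarith [dist_triangle (Z j) y x0, dist_triangle_right (Z j) A x0]) fun _ _ => hp _
  have hq : 0 ≤ Q ^ j := by positivity
  calc u y ≤ 2 * u z := by linarith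
    _ ≤ 2 * (C2 * (Q ^ j * (C3 * u A))) := by
      refine mul_le_mul_of_nonneg_left (h4.trans (mul_le_mul_of_nonneg_left ((h5 j).trans (mul_le_mul_of_nonneg_left h6 hq)) (by linarith))) (by norm_num)
    _ = _ := by ring

lemma bpos (hA : AR n d C₀ Γ) (hb : Fm d Γ Λ b) : ∃ ε L : ℝ, 0 < ε ∧ 2 ≤ L ∧ ∀ w, Hm d Γ b w → ∀ (x1 : Eu n) (ρ a : ℝ), 0 < ρ → 0 < a →
    (∀ X ∈ Γ, X ∈ ball x1 ρ → w X = 0) → (∀ X ∈ ball x1 ρ, -a ≤ w X) → (∀ X ∈ ball x1 ρ, ε * ρ ≤ infDist X Γ → a * L ≤ w X) → 0 ≤ w x1 := by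
  obtain ⟨c, hc0, hc1, HC⟩ := hA.cork
  obtain ⟨CH, hCH, HH⟩ := hc hA hb (show (0:ℝ) < 1 / 2 by norm_num) (show (0:ℝ) < 1 / c by positivity)
  obtain ⟨g, hg0, hg1, HG⟩ := grw hA hb one_pos
  set L := 2 * CH
  have hL : 2 ≤ L := by linarith
  obtain ⟨N, hN⟩ := exists_pow_lt_of_lt_one (show (0:ℝ) < 1 / L by positivity) (show 1 - g / 2 < 1 by linarith)
  set q := 1 - g / 2
  have hq0 : 0 < q := by simp only [q]; linarith
  set ε := min (1 / (40 * (N + 1) : ℝ)) (c / 8)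
  have hε : 0 < ε := by positivity
  have hεN : ε * (40 * (N + 1)) ≤ 1 := by
    have : ε ≤ 1 / (40 * (N + 1) : ℝ) := min_le_left _ _
    rwa [le_div_iff₀ (by positivity)] at this
  have hεc : ε ≤ c / 8 := min_le_right _ _
  refine ⟨ε, L, hε, hL, fun w hw x1 ρ a hρ ha h0 h1 h2 => ?_⟩
  have st : ∀ ρ a, 0 < ρ → 0 < a → (∀ X ∈ Γ, X ∈ ball x1 ρ → w X = 0) → (∀ X ∈ ball x1 ρ, -a ≤ w X) →
      (∀ X ∈ ball x1 ρ, ε * ρ ≤ infDist X Γ → a * L ≤ w X) → (∀ X ∈ ball x1 (ρ / 2), -(a / L) ≤ w X) ∧ (∀ X ∈ ball x1 (ρ / 2), ε * (ρ / 2) ≤ infDist X Γ → a ≤ w X) := by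
    intro ρ a hρ ha h0 h1 h2
    have hερ : 0 < ε * ρ := by positivity
    constructor
    · have hI : ∀ i : ℕ, ∀ X ∈ ball x1 (ρ - 20 * ε * ρ * i), -(a * q ^ i) ≤ w X := fun i => by
        induction i with
        | zero => intro X hX; simpa using h1 X (by simpa using hX)
        | succ i ih =>
          intro X hX
          rw [mem_ball] at hX
          push_cast at hX
          have hi0 : 0 ≤ 20 * ε * ρ * i := by positivity
          have haq : 0 < a * q ^ i := by positivity
          by_cases hδ : ε * ρ ≤ infDist X Γ
          · refine le_trans ?_ (h2 X (by rw [mem_ball]; nlinarith) hδ)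
            have : 0 < a * q ^ (i + 1) := by positivity
            nlinarith
          · push Not at hδ
            obtain ⟨z, hz, hz1⟩ := hA.near X
            have hin : ∀ Y ∈ ball z (8 * (2 * (ε * ρ))), dist Y x1 < ρ - 20 * ε * ρ * i := fun Y hY => by
              rw [mem_ball] at hY
              linarith [dist_triangle Y z x1, dist_triangle z X x1, dist_comm X z]
            have := HG _ (hw.aff hA hb 1 (a * q ^ i)) z (2 * (ε * ρ)) (a * q ^ i / 2) (by positivity) (by positivity)
              (fun Y hY => by linarith [ih Y (hin Y hY)]) (fun Y hY hY' => by
                beta_reduce; rw [h0 Y hY (by rw [mem_ball]; linarith [hin Y hY'])]; linarith) (Or.inl hz) X (by rw [mem_ball]; linarith)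
            simp only [q] at *
            rw [pow_succ]; nlinarith
      intro X hX
      have := hI N X (ball_subset_ball (by nlinarith) hX)
      have h3 : a * q ^ N ≤ a * (1 / L) := mul_le_mul_of_nonneg_left hN.le ha.le
      rw [mul_one_div] at h3; linarith
    · intro X hX hδ
      obtain ⟨Y, hY, hYδ⟩ := HC X (ε * ρ / c) (by positivity)
      rw [mul_div_cancel₀ _ hc0.ne'] at hYδ
      rw [mem_ball] at hX hY
      have h8 : ε * ρ / c ≤ ρ / 8 := by rw [div_le_iff₀ hc0]; nlinarith
      have h9 : ε * ρ ≤ ρ / 8 := by nlinarith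
      have hYx : dist Y x1 < 5 * ρ / 8 := by linarith [dist_triangle Y X x1]
      have h10 : (1 / c + 2) * (ε * ρ) = ε * ρ / c + 2 * (ε * ρ) := by ring
      have := HH _ (hw.aff hA hb 1 a) (ε * ρ) Y X hερ (by linarith) (by linarith) (by rw [one_div_mul_eq_div]; exact hY.le) (fun Z hZ => by
        rw [h10, mem_ball] at hZ
        linarith [h1 Z (by rw [mem_ball]; linarith [dist_triangle Z Y x1])])
      have h11 := h2 Y (by rw [mem_ball]; linarith) hYδ
      by_contra! hcon
      simp only [L] at h11
      nlinarith
  have it : ∀ k : ℕ, (∀ X ∈ ball x1 (ρ / 2 ^ k), -(a / L ^ k) ≤ w X) ∧ (∀ X ∈ ball x1 (ρ / 2 ^ k), ε * (ρ / 2 ^ k) ≤ infDist X Γ → a / L ^ k * L ≤ w X) := fun k => by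
    induction k with
    | zero => simpa using ⟨h1, h2⟩
    | succ k ih =>
      have hle : ρ / 2 ^ k ≤ ρ := div_le_self hρ.le (one_le_pow₀ one_le_two)
      have := st (ρ / 2 ^ k) (a / L ^ k) (by positivity) (by positivity) (fun X hX hX' => h0 X hX (ball_subset_ball hle hX')) ih.1 ih.2
      rw [div_div, div_div, ← pow_succ, ← pow_succ] at this
      refine ⟨this.1, fun X hX hX' => le_trans (le_of_eq ?_) (this.2 X hX hX')⟩
      rw [pow_succ]; field_simp
  by_contra! hcon
  obtain ⟨k, hk⟩ := exists_pow_lt_of_lt_one (show 0 < -w x1 / a from div_pos (by linarith) ha) (show (1:ℝ) / L < 1 by rw [div_lt_one (by linarith)]; linarith)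
  have := (it k).1 x1 (mem_ball_self (by positivity))
  rw [one_div, inv_pow, lt_div_iff₀ ha, inv_mul_eq_div] at hk
  linarith

lemma bhp (hA : AR n d C₀ Γ) (hb : Fm d Γ Λ b) {ε K : ℝ} (hε : 0 < ε) (hK : 0 < K) : ∃ C : ℝ, 1 ≤ C ∧ ∀ u v, Hm d Γ b u → (∀ X, 0 ≤ u X) →
    Hm d Γ b v → (∀ X, 0 ≤ v X) → ∀ (x0 A : Eu n) (R : ℝ), 0 < R → (∀ X ∈ Γ, X ∈ ball x0 (8 * R) → u X = 0 ∧ v X = 0) → ε * R ≤ infDist A Γ → dist A x0 ≤ K * R →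
    ∀ X ∈ ball x0 (R / 2), u X * v A ≤ C * (u A * v X) := by
  obtain ⟨C1, hC1, H1⟩ := carl hA hb hε hK
  obtain ⟨e, L, he, hL, HB⟩ := bpos hA hb
  obtain ⟨C4, hC4, H4⟩ := hc hA hb (lt_min hε (show 0 < e / 2 by positivity)) (show (0:ℝ) < K + 1 by positivity)
  have hM : 1 ≤ C4 * (C1 * (L + 1)) := one_le_mul_of_one_le_of_one_le hC4 (one_le_mul_of_one_le_of_one_le hC1 (by linarith))
  refine ⟨C4 * (C1 * (L + 1)), hM, fun u v hu hu0 hv hv0 x0 A R hR h0 hA1 hA2 X hX => ?_⟩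
  set M := C4 * (C1 * (L + 1))
  have hca := H1 u hu hu0 x0 A R hR (fun X hX hX' => (h0 X hX hX').1) hA1 hA2
  rcases (hv0 A).eq_or_lt with h | hvA
  · rw [← h, mul_zero]; exact mul_nonneg (by linarith) (mul_nonneg (hu0 A) (hv0 X))
  have hXR : X ∈ ball x0 R := ball_subset_ball (by linarith) hX
  rcases (hu0 A).eq_or_lt with h | huA
  · have := hca X hXR
    rw [← h, mul_zero] at this
    rw [le_antisymm this (hu0 X), ← h]; simp
  have hp : 0 < u A * v A := by positivity
  have hin : ∀ Y ∈ ball X (R / 2), dist Y x0 < R := fun Y hY => by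
    rw [mem_ball] at *; linarith [dist_triangle Y X x0]
  have hw := (hv.aff hA hb (M * u A) 0).add hA hb (hu.aff hA hb (-v A) 0)
  have := HB _ hw X (R / 2) (C1 * (u A * v A)) (by positivity) (by positivity) (fun Y hY hY' => by
      have := h0 Y hY (by rw [mem_ball]; linarith [hin Y hY'])
      simp [this.1, this.2]) (fun Y hY => by
      have := mul_le_mul_of_nonneg_left (hca Y (hin Y hY)) hvA.le
      have h2 : 0 ≤ M * u A * v Y := mul_nonneg (by positivity) (hv0 Y)
      linarith) (fun Y hY hδ => by
      have := mul_le_mul_of_nonneg_left (hca Y (hin Y hY)) hvA.le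
      have h3 := hin Y hY
      have a1 : min ε (e / 2) ≤ ε := min_le_left _ _
      have a2 : min ε (e / 2) ≤ e / 2 := min_le_right _ _
      have h4 := H4 v hv R A Y hR (by nlinarith) (by nlinarith) (by linarith [dist_triangle_right A Y x0]) fun _ _ => hv0 _
      have h5 : C1 * (L + 1) * u A * v A ≤ C1 * (L + 1) * u A * (C4 * v Y) := mul_le_mul_of_nonneg_left h4 (by positivity)
      simp only [M]
      linarith)
  linarith

def Bd (d : ℝ) (Γ : Set (Eu n)) (b : (Eu n → Eu n) → (Eu n → Eu n) → ℝ) (x : Eu n) (s : ℝ) (u : Eu n → ℝ) : Prop :=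
  Continuous u ∧ (∀ X, 0 ≤ u X) ∧ ∃ G g, Sol d Γ b u G g ∧ (∀ X ∈ Γ, g X = u X) ∧ ∀ X, s ≤ dist X x → g X = 0

lemma Bd.hm {x s u} (h : Bd d Γ b x s u) : Hm d Γ b u := let ⟨h1, _, _, _, h2, h3, _⟩ := h; ⟨h1, _, _, h2, h3⟩

lemma glob (hA : AR n d C₀ Γ) (hb : Fm d Γ Λ b) {ε : ℝ} (hε : 0 < ε) : ∃ C : ℝ, 1 ≤ C ∧ ∀ (x A : Eu n) (r : ℝ) u v, 0 < r →
    Bd d Γ b x (6 / 5 * r) u → Bd d Γ b x (6 / 5 * r) v → dist A x ≤ r → ε * r ≤ infDist A Γ → ∀ X, 2 * r ≤ dist X x → u X * v A ≤ C * (u A * v X) := by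
  obtain ⟨C1, hC1, H1⟩ := hc hA hb (lt_min hε (show (0:ℝ) < 1 / 100 by norm_num)) (show (0:ℝ) < 3 by norm_num)
  obtain ⟨C2, hC2, H2⟩ := bhp hA hb hε (show (0:ℝ) < 90 by norm_num)
  obtain ⟨C3, hC3, H3⟩ := cutoff (n := n)
  refine ⟨max (C1 * C1) C2, le_max_of_le_right hC2, fun x A r u v hr hu hv hAx hAδ X hX => ?_⟩
  set C := max (C1 * C1) C2
  have hC1' : C1 * C1 ≤ C := le_max_left _ _
  have hC2' : C2 ≤ C := le_max_right _ _
  have huh := hu.hm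
  have hvh := hv.hm
  obtain ⟨hu1, hu2, Gu, g, hu3, hu4, hu5⟩ := hu
  obtain ⟨hv1, hv2, Gv, h, hv3, hv4, hv5⟩ := hv
  have ann : ∀ Y, 8 / 5 * r ≤ dist Y x → dist Y x ≤ 9 / 5 * r → u Y * v A ≤ C * (u A * v Y) := fun Y hY1 hY2 => by
    by_cases hδ : r / 100 ≤ infDist Y Γ
    · have a1 : min ε (1 / 100) ≤ ε := min_le_left _ _
      have a2 : min ε (1 / 100) ≤ 1 / 100 := min_le_right _ _
      have b1 := H1 u huh r Y A hr (by nlinarith) (by nlinarith) (by linarith [dist_triangle_right Y A x]) fun _ _ => hu2 _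
      have b2 := H1 v hvh r A Y hr (by nlinarith) (by nlinarith) (by linarith [dist_triangle_right A Y x]) fun _ _ => hv2 _
      calc u Y * v A ≤ (C1 * u A) * (C1 * v Y) := mul_le_mul b1 b2 (hv2 A) (mul_nonneg (by linarith) (hu2 A))
        _ = C1 * C1 * (u A * v Y) := by ring
        _ ≤ _ := mul_le_mul_of_nonneg_right hC1' (mul_nonneg (hu2 _) (hv2 _))
    · push Not at hδ
      obtain ⟨z, hz, hz1⟩ := hA.near Y
      refine (H2 u v huh hu2 hvh hv2 z A (r / 30) (by positivity) (fun Z hZ hZ' => ?_) (by nlinarith) ?_ Y ?_).trans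
        (mul_le_mul_of_nonneg_right hC2' (mul_nonneg (hu2 _) (hv2 _)))
      · rw [mem_ball] at hZ'
        have : 6 / 5 * r ≤ dist Z x := by linarith [dist_triangle Y z x, dist_triangle_left z x Z]
        exact ⟨by rw [← hu4 Z hZ, hu5 Z this], by rw [← hv4 Z hZ, hv5 Z this]⟩
      · linarith [dist_triangle_right A z x, dist_triangle_left z x Y]
      · rw [mem_ball]; linarith
  obtain ⟨χ, k1, k2, k3, k4, k5⟩ := H3 x (9 / 5 * r) (8 / 5 * r) (by positivity) (by linarith)
  obtain ⟨m1, m2⟩ := cut_bd k2 k4 k5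
  have k1' : ContDiff ℝ 1 χ := k1.of_le (by exact_mod_cast le_top)
  have hnb : nb (fun X => ((-1:ℝ) • χ) X + 1) = (-1:ℝ) • nb χ := by rw [nb_addc, nb_smul k1']
  set η : Eu n → ℝ := fun X => ((-1:ℝ) • χ) X + 1
  have hη : ∀ X, η X = 1 - χ X := fun X => by simp only [η, Pi.smul_apply, smul_eq_mul]; ring
  have hts : tsupport η ⊆ (ball x (8 / 5 * r))ᶜ := closure_minimal (fun Y hY hY' => hY (by rw [hη, k3 Y hY', sub_self])) isOpen_ball.isClosed_compl
  have hw := (hu3.aff hA hb (v A) 0).add hA hb (hv3.aff hA hb (-(C * u A)) 0)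
  have key : ∀ k : ℝ, 0 < k → v A * u X + 0 + (-(C * u A) * v X + 0) ≤ k := fun k hk => by
    have hgz : ∀ Y, 6 / 5 * r ≤ dist Y x → v A * g Y + 0 + (-(C * u A) * h Y + 0) < k := fun Y hY => by
      rw [hu5 Y hY, hv5 Y hY]; simpa using hk
    have := hw.maxp hA hb (η := η) ((contDiff_const.smul k1').add contDiff_const) (M := Real.toNNReal (max 1 (C3 / (9 / 5 * r - 8 / 5 * r)))) (fun Y => ⟨?_, ?_⟩)
      (k := k) (R := ‖x‖ + 9 / 5 * r) (fun Y _ hY => hgz Y ?_) (fun Y hY => ⟨?_, Or.inr (hgz Y ?_)⟩) (Eventually.of_forall fun Y hY => ?_)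
    · refine ae_all_of (U := {Y | 9 / 5 * r < dist Y x}) (by fun_prop) (isOpen_lt continuous_const (by fun_prop)) (this.mono fun Y hY hY' => hY ?_) X (show 9 / 5 * r < dist X x by linarith)
      have : χ Y = 0 := image_eq_zero_of_notMem_tsupport fun h' => by
        have h2 := mem_ball.1 (k4 h'); have h3 : 9 / 5 * r < dist Y x := hY'; linarith
      rw [hη, this]; norm_num
    · rw [← ofReal_norm, hη, Real.norm_of_nonneg (by linarith [(k2 Y).2])]
      exact ofReal_le_ofReal (le_max_of_le_left (by linarith [(k2 Y).1]))
    · rw [hnb]; simpa using (m1 Y).2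
    · have := hts hY; rw [mem_compl_iff, mem_ball] at this; linarith
    · rw [hnb, Pi.smul_apply, (m2 Y hY).1, smul_zero]
    · have := norm_le_norm_add_norm_sub' Y x; rw [← dist_eq_norm] at this; linarith
    · have e1 := hts (nb_ts hY)
      rw [mem_compl_iff, mem_ball] at e1
      have e2 : nb χ Y ≠ 0 := fun h' => hY (by rw [hnb, Pi.smul_apply, h', smul_zero])
      have e3 := mem_ball.1 (k4 (nb_ts e2))
      have := ann Y (by linarith) e3.le
      nlinarith
  have := le_of_forall_pos_le_add fun k hk => (key k hk).trans (zero_add k).ge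
  nlinarith

lemma nondeg (hA : AR n d C₀ Γ) (hb : Fm d Γ Λ b) {ε K : ℝ} (hε : 0 < ε) (hK : 0 < K) : ∃ c : ℝ, 0 < c ∧ ∀ v, Hm d Γ b v → (∀ X, 0 ≤ v X) →
    ∀ x ∈ Γ, ∀ (r : ℝ) (A : Eu n), 0 < r → (∀ Y ∈ Γ, Y ∈ ball x (r / 2) → v Y = 1) → dist A x ≤ K * r → ε * r ≤ infDist A Γ → c ≤ v A := by
  obtain ⟨c, hc0, hc1, HC⟩ := hA.cork
  obtain ⟨g, hg0, hg1, HG⟩ := grw hA hb one_pos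
  obtain ⟨C, hC, H⟩ := hc hA hb (lt_min hε (show 0 < c / 32 by positivity)) (show 0 < K + 1 by positivity)
  refine ⟨g / (2 * C), by positivity, fun v hv hv0 x hx r A hr h1 h2 h3 => ?_⟩
  obtain ⟨Z, hZ, hZ'⟩ := HC x (r / 32) (by positivity)
  have e1 := HG v hv x (r / 16) (1 / 2) (by positivity) (by norm_num) (fun _ _ => hv0 _) (fun Y hY hY' => by
    rw [h1 Y hY (by convert hY' using 2; ring)]; norm_num) (Or.inl hx) Z (by convert hZ using 2; ring)
  rw [mem_ball] at hZ
  have a1 : min ε (c / 32) ≤ ε := min_le_left _ _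
  have a2 : min ε (c / 32) ≤ c / 32 := min_le_right _ _
  have e2 := H v hv r Z A hr (by nlinarith) (by nlinarith) (by linarith [dist_triangle_right Z A x]) fun _ _ => hv0 _
  rw [div_le_iff₀ (by positivity)]; linarith

lemma meas_cmp {μ ν : Measure (Eu n)} [IsFiniteMeasure μ] [IsFiniteMeasure ν] {x : Eu n} {r C : ℝ} (hC : 0 ≤ C)
    (h : ∀ g : Eu n → ℝ, ContDiff ℝ 1 g → (∀ X, 0 ≤ g X) → (∀ X ∉ ball x r, g X = 0) → ∫ y, g y ∂μ ≤ C * ∫ y, g y ∂ν) {E : Set (Eu n)}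
    (hE : E ⊆ ball x r) : μ E ≤ ofReal C * ν E := by
  have hU : ∀ U, IsOpen U → U ⊆ ball x r → μ U ≤ ofReal C * ν U := fun U hU hUB => by
    rw [hU.measure_eq_iSup_isCompact]
    refine iSup₂_le fun K hKU => iSup_le fun hK => ?_
    obtain ⟨f, f1, f2, f3⟩ := hU.exists_contDiff_support_eq (n := 1)
    have f0 : ∀ X, 0 ≤ f X := fun X => (f3 ⟨X, rfl⟩).1
    have hm : ∃ m : ℝ, 0 < m ∧ ∀ X ∈ K, m ≤ f X := by
      rcases K.eq_empty_or_nonempty with rfl | hne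
      · exact ⟨1, one_pos, fun _ h => h.elim⟩
      · obtain ⟨z, hz, hz'⟩ := hK.exists_isMinOn hne f2.continuous.continuousOn
        have : z ∈ f.support := by rw [f1]; exact hKU hz
        exact ⟨f z, lt_of_le_of_ne (f0 z) (Ne.symm this), fun X hX => hz' hX⟩
    obtain ⟨m, hm, hmK⟩ := hm
    set g : Eu n → ℝ := fun X => Real.smoothTransition (f X / m)
    have g1 : ContDiff ℝ 1 g := Real.smoothTransition.contDiff.comp (f2.div_const m)
    have g0 : ∀ X, 0 ≤ g X := fun X => Real.smoothTransition.nonneg _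
    have gl : ∀ X, g X ≤ 1 := fun X => Real.smoothTransition.le_one _
    have gz : ∀ X ∉ U, g X = 0 := fun X hX => by
      have : f X = 0 := by rw [← f1] at hX; simpa using hX
      simp only [g, this, zero_div]; exact Real.smoothTransition.zero
    have gK : ∀ X ∈ K, g X = 1 := fun X hX => Real.smoothTransition.one_of_one_le (by rw [le_div_iff₀ hm]; linarith [hmK X hX])
    have gi : ∀ ρ : Measure (Eu n), IsFiniteMeasure ρ → Integrable g ρ := fun ρ _ =>
      Integrable.of_bound g1.continuous.aestronglyMeasurable 1 (ae_of_all _ fun X => by rw [Real.norm_of_nonneg (g0 X)]; exact gl X)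
    have k1 := h g g1 g0 fun X hX => gz X fun hX' => hX (hUB hX')
    have k2 : μ K ≤ ofReal (∫ y, g y ∂μ) := by
      rw [ofReal_integral_eq_lintegral_ofReal (gi μ ‹_›) (ae_of_all _ g0), ← lintegral_indicator_one hK.measurableSet]
      refine lintegral_mono fun X => ?_
      by_cases hX : X ∈ K
      · simp [hX, gK X hX]
      · simp [hX]
    have k3 : ofReal (∫ y, g y ∂ν) ≤ ν U := by
      rw [ofReal_integral_eq_lintegral_ofReal (gi ν ‹_›) (ae_of_all _ g0), ← lintegral_indicator_one hU.measurableSet]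
      refine lintegral_mono fun X => ?_
      by_cases hX : X ∈ U
      · simpa [hX] using gl X
      · simp [hX, gz X hX]
    refine k2.trans ((ofReal_le_ofReal k1).trans ?_)
    rw [ofReal_mul hC]
    exact mul_le_mul_right k3 _
  refine le_of_forall_gt fun t ht => ?_
  rcases eq_or_ne (ofReal C) 0 with h0 | h0
  · have := hU (ball x r) isOpen_ball subset_rfl
    rw [h0, zero_mul] at this ht
    exact ((measure_mono hE).trans this).trans_lt ht
  have ht' : ν E < t / ofReal C := by
    rw [ENNReal.lt_div_iff_mul_lt (Or.inl h0) (Or.inl ofReal_ne_top), mul_comm]; exact ht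
  obtain ⟨U, hEU, hUo, hUt⟩ := E.exists_isOpen_lt_of_lt _ ht'
  calc μ E ≤ μ (U ∩ ball x r) := measure_mono (subset_inter hEU hE)
    _ ≤ ofReal C * ν (U ∩ ball x r) := hU _ (hUo.inter isOpen_ball) inter_subset_right
    _ ≤ ofReal C * ν U := mul_le_mul_right (measure_mono inter_subset_left) _
    _ < t := by
      rw [ENNReal.lt_div_iff_mul_lt (Or.inl h0) (Or.inl ofReal_ne_top), mul_comm] at hUt; exact hUt

lemma final (hA : AR n d C₀ Γ) (hb : Fm d Γ Λ b) {ω : Eu n → Measure (Eu n)} (hprob : ∀ X ∉ Γ, IsProbabilityMeasure (ω X) ∧ ω X Γᶜ = 0)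
    (hrep : ∀ {g : Eu n → ℝ}, ContDiff ℝ 1 g → HasCompactSupport g →
      ∃ u G, Continuous u ∧ Sol d Γ b u G g ∧ (∀ X ∈ Γ, u X = g X) ∧ ∀ X ∉ Γ, u X = ∫ y, g y ∂(ω X)) {ε : ℝ} (hε : 0 < ε) :
    ∃ C : ℝ, 0 < C ∧ ∀ x ∈ Γ, ∀ r : ℝ, 0 < r → ∀ A : Eu n, A ∈ Γᶜ ∩ ball x r → ball A (ε * r) ⊆ Γᶜ →
      ∀ E : Set (Eu n), E ⊆ ball x r ∩ Γ → ∀ X ∉ Γ, X ∉ ball x (2 * r) →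
        ofReal C⁻¹ * ω A E ≤ ω X E / ω X (Γ ∩ ball x r) ∧ ω X E / ω X (Γ ∩ ball x r) ≤ ofReal C * ω A E := by
  obtain ⟨Cg, hCg, HG⟩ := glob hA hb hε
  obtain ⟨c, hc, HN⟩ := nondeg hA hb hε one_pos
  obtain ⟨_, _, HC⟩ := cutoff (n := n)
  refine ⟨max Cg (Cg / c), by positivity, fun x hx r hr A hAm hAb E hE X hX hXr => ?_⟩
  set C := max Cg (Cg / c)
  have hCC : Cg ≤ C := le_max_left _ _
  have hCC' : Cg / c ≤ C := le_max_right _ _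
  have hC0 : 0 < C := by linarith
  obtain ⟨hPX, hX0⟩ := hprob X hX
  obtain ⟨hPA, hA0⟩ := hprob A hAm.1
  have hAx : dist A x ≤ r := (mem_ball.1 hAm.2).le
  have hAδ : ε * r ≤ infDist A Γ := (le_infDist hA.ne).2 fun y hy => by
    by_contra! hlt
    exact hAb (by rw [mem_ball, dist_comm]; exact hlt) hy
  rw [mem_ball, not_lt] at hXr
  have hωB : ω X (Γ ∩ ball x r) = ω X (ball x r) := by
    refine le_antisymm (measure_mono inter_subset_right) ?_
    calc ω X (ball x r) ≤ ω X (Γ ∩ ball x r) + ω X Γᶜ := (measure_mono fun Y hY => by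
          by_cases h : Y ∈ Γ
          · exact Or.inl ⟨h, hY⟩
          · exact Or.inr h).trans (measure_union_le _ _)
      _ = _ := by rw [hX0, add_zero]
  rw [hωB]
  have rep : ∀ g : Eu n → ℝ, ContDiff ℝ 1 g → (∀ Y, 0 ≤ g Y) → (∀ Y, 6 / 5 * r ≤ dist Y x → g Y = 0) →
      ∃ u, Bd d Γ b x (6 / 5 * r) u ∧ (∀ Y ∈ Γ, u Y = g Y) ∧ ∀ Y ∉ Γ, u Y = ∫ y, g y ∂(ω Y) := fun g g1 g2 g3 => by
    obtain ⟨u, G, u1, u2, u3, u4⟩ := hrep g1 (HasCompactSupport.intro (isCompact_closedBall x (6 / 5 * r)) fun Y hY => g3 Y (by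
      rw [mem_closedBall, not_le] at hY; exact hY.le))
    refine ⟨u, ⟨u1, fun Y => ?_, G, g, u2, fun Y hY => (u3 Y hY).symm, g3⟩, u3, u4⟩
    by_cases hY : Y ∈ Γ
    · rw [u3 Y hY]; exact g2 Y
    · rw [u4 Y hY]; exact integral_nonneg g2
  have gi : ∀ (μ : Measure (Eu n)) (g : Eu n → ℝ), IsProbabilityMeasure μ → ContDiff ℝ 1 g → (∀ Y, 0 ≤ g Y ∧ g Y ≤ 1) → Integrable g μ := fun μ g _ g1 g2 =>
    Integrable.of_bound g1.continuous.aestronglyMeasurable 1 (ae_of_all _ fun Y => by rw [Real.norm_of_nonneg (g2 Y).1]; exact (g2 Y).2)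
  obtain ⟨h1, a1, a2, a3, a4, -⟩ := HC x r (r / 2) (by positivity) (by linarith)
  obtain ⟨h2, b1, b2, b3, b4, -⟩ := HC x (6 / 5 * r) r hr (by linarith)
  have a1' : ContDiff ℝ 1 h1 := a1.of_le (by exact_mod_cast le_top)
  have b1' : ContDiff ℝ 1 h2 := b1.of_le (by exact_mod_cast le_top)
  have z1 : ∀ Y ∉ ball x r, h1 Y = 0 := fun Y hY => image_eq_zero_of_notMem_tsupport fun h' => hY (a4 h')
  have z2 : ∀ Y ∉ ball x (6 / 5 * r), h2 Y = 0 := fun Y hY => image_eq_zero_of_notMem_tsupport fun h' => hY (b4 h')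
  obtain ⟨v1, p1, p2, p3⟩ := rep h1 a1' (fun Y => (a2 Y).1) fun Y hY => z1 Y (by rw [mem_ball]; linarith)
  obtain ⟨v2, q1, q2, q3⟩ := rep h2 b1' (fun Y => (b2 Y).1) fun Y hY => z2 Y (by rw [mem_ball]; linarith)
  have one : ∀ Y ∈ Γ, Y ∈ ball x (r / 2) → v1 Y = 1 := fun Y hY hY' => by rw [p2 Y hY, a3 Y hY']
  have c1 : c ≤ v1 A := HN v1 p1.hm p1.2.1 x hx r A hr one (by linarith) hAδ
  have c2 : 0 < v1 X := by
    obtain ⟨c', hc', HN'⟩ := nondeg hA hb (show 0 < infDist X Γ / r from div_pos (hA.pos hX) hr) (show 0 < dist X x / r from div_pos (by linarith) hr)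
    exact hc'.trans_le (HN' v1 p1.hm p1.2.1 x hx r X hr one (by rw [div_mul_cancel₀ _ hr.ne']) (by rw [div_mul_cancel₀ _ hr.ne']))
  set m := (ω X).real (ball x r) with hm
  have c3 : v1 X ≤ m := by
    rw [p3 X hX, hm, ← integral_indicator_one measurableSet_ball]
    refine integral_mono (gi _ _ hPX a1' a2) ((integrable_const (1:ℝ)).indicator measurableSet_ball) fun Z => ?_
    by_cases hZ : Z ∈ ball x r
    · rw [indicator_of_mem hZ]; exact (a2 Z).2
    · rw [indicator_of_notMem hZ]; exact (z1 Z hZ).le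
  have c4 : m ≤ v2 X := by
    rw [q3 X hX, hm, ← integral_indicator_one measurableSet_ball]
    refine integral_mono ((integrable_const (1:ℝ)).indicator measurableSet_ball) (gi _ _ hPX b1' b2) fun Z => ?_
    by_cases hZ : Z ∈ ball x r
    · rw [indicator_of_mem hZ]; exact (b3 Z hZ).ge
    · rw [indicator_of_notMem hZ]; exact (b2 Z).1
  have c5 : v2 A ≤ 1 := by
    rw [q3 A hAm.1]
    refine (integral_mono (gi _ _ hPA b1' b2) (integrable_const (1:ℝ)) fun Z => (b2 Z).2).trans ?_
    simp
  have hm0 : 0 < m := c2.trans_le c3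
  have hmE : ω X (ball x r) = ofReal m := by rw [hm, ofReal_measureReal]
  have hmne : ofReal m ≠ 0 := by simpa using hm0
  have hEB : E ⊆ ball x r := hE.trans inter_subset_left
  have gz : ∀ g : Eu n → ℝ, (∀ Y ∉ ball x r, g Y = 0) → ∀ Y, 6 / 5 * r ≤ dist Y x → g Y = 0 := fun g hg Y hY => hg Y (by rw [mem_ball]; linarith)
  have lo : ω A E ≤ ofReal (C / m) * ω X E := meas_cmp (by positivity) (fun g g1 g2 g3 => by
    obtain ⟨u, u1, u2, u3⟩ := rep g g1 g2 (gz g g3)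
    have := HG x A r v2 u hr q1 u1 hAx hAδ X hXr
    rw [← u3 X hX, ← u3 A hAm.1, div_mul_eq_mul_div, le_div_iff₀ hm0]
    have e1 := mul_le_mul_of_nonneg_right c4 (u1.2.1 A)
    have e2 := mul_le_mul_of_nonneg_right c5 (u1.2.1 X)
    have e3 : Cg * (v2 A * u X) ≤ C * (1 * u X) := mul_le_mul hCC e2 (mul_nonneg (q1.2.1 _) (u1.2.1 _)) hC0.le
    linarith) hEB
  have up : ω X E ≤ ofReal (C * m) * ω A E := meas_cmp (by positivity) (fun g g1 g2 g3 => by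
    obtain ⟨u, u1, u2, u3⟩ := rep g g1 g2 (gz g g3)
    have := HG x A r u v1 hr u1 p1 hAx hAδ X hXr
    rw [← u3 X hX, ← u3 A hAm.1]
    have e1 := mul_le_mul_of_nonneg_left c1 (u1.2.1 X)
    have e2 := mul_le_mul_of_nonneg_left c3 (u1.2.1 A)
    have e3 : u X * c ≤ Cg * (u A * m) := (e1.trans this).trans (mul_le_mul_of_nonneg_left e2 (by linarith))
    rw [← le_div_iff₀ hc] at e3
    have e4 : Cg / c * (u A * m) ≤ C * (u A * m) := mul_le_mul_of_nonneg_right hCC' (mul_nonneg (u1.2.1 A) hm0.le)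
    calc u X ≤ _ := e3
      _ = Cg / c * (u A * m) := by ring
      _ ≤ _ := e4
      _ = _ := by ring) hEB
  rw [hmE]
  constructor
  · rw [ENNReal.le_div_iff_mul_le (Or.inl hmne) (Or.inl ofReal_ne_top)]
    calc ofReal C⁻¹ * ω A E * ofReal m ≤ ofReal C⁻¹ * (ofReal (C / m) * ω X E) * ofReal m := by gcongr
      _ = ofReal (C⁻¹ * (C / m) * m) * ω X E := by
        rw [ofReal_mul (by positivity), ofReal_mul (by positivity)]; ring
      _ = ω X E := by
        rw [show C⁻¹ * (C / m) * m = 1 by field_simp]; simp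
  · refine ENNReal.div_le_of_le_mul (up.trans (le_of_eq ?_))
    rw [ofReal_mul hC0.le]; ring
end EM

/-- Change-of-pole / comparison principle for the elliptic measure:
C⁻¹ ω^{A_B}(E) ≤ ω^X(E)/ω^X(Γ ∩ B) ≤ C ω^{A_B}(E) for E ⊆ B ∩ Γ Borel and X ∈ Ω \ 2B,
where A_B is a corkscrew point for B = B(x,r). -/
theorem elliptic_measure_change_of_pole
    (n : ℕ) (d C₀ C₃ : ℝ) (hd₀ : 0 ≤ d) (hd : d < (n : ℝ) - 1) (hC₀ : 0 < C₀) (hC₃ : 0 < C₃)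
    (Γ : Set (EuclideanSpace ℝ (Fin n))) (hclosed : IsClosed Γ) (hΓne : Γ.Nonempty)
    (hunb : ¬ Bornology.IsBounded Γ)
    (hAR : ∀ x ∈ Γ, ∀ r : ℝ, 0 < r →
      ENNReal.ofReal (C₀⁻¹ * r ^ d) ≤ μH[d] (Γ ∩ ball x r) ∧
      μH[d] (Γ ∩ ball x r) ≤ ENNReal.ofReal (C₀ * r ^ d))
    (A : EuclideanSpace ℝ (Fin n) → Matrix (Fin n) (Fin n) ℝ)
    -- degenerate ellipticity and boundedness with weight w(X) = dist(X,Γ)^{d+1-n}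
    (hell : ∀ X ∉ Γ, ∀ ξ ζ : EuclideanSpace ℝ (Fin n),
      C₃⁻¹ * Metric.infDist X Γ ^ (d + 1 - (n : ℝ)) * ‖ξ‖ ^ 2 ≤
          ∑ i, ∑ j, A X i j * ξ j * ξ i ∧
      |∑ i, ∑ j, A X i j * ξ j * ζ i| ≤
          C₃ * Metric.infDist X Γ ^ (d + 1 - (n : ℝ)) * ‖ξ‖ * ‖ζ‖)
    (ω : EuclideanSpace ℝ (Fin n) → Measure (EuclideanSpace ℝ (Fin n)))
    -- ω X is a Borel probability measure carried by Γ, for each pole X ∈ Ω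
    (hprob : ∀ X ∉ Γ, IsProbabilityMeasure (ω X) ∧ ω X Γᶜ = 0)
    -- defining property of the elliptic measure: it represents continuous solutions
    -- of Lu = 0 in Ω lying in the energy space W, via their boundary values
    (hrepr : ∀ (u : EuclideanSpace ℝ (Fin n) → ℝ)
      (G : EuclideanSpace ℝ (Fin n) → EuclideanSpace ℝ (Fin n)),
      Continuous u →
      (∀ φ : EuclideanSpace ℝ (Fin n) → ℝ, ContDiff ℝ (⊤ : ℕ∞) φ → HasCompactSupport φ →
        tsupport φ ⊆ Γᶜ → ∀ i : Fin n,
          ∫ X, u X * fderiv ℝ φ X (EuclideanSpace.single i 1) = - ∫ X, G X i * φ X) →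
      ((∫⁻ X in Γᶜ,
          ENNReal.ofReal (‖G X‖ ^ 2 * Metric.infDist X Γ ^ (d + 1 - (n : ℝ)))) < ⊤) →
      (∀ φ : EuclideanSpace ℝ (Fin n) → ℝ, ContDiff ℝ (⊤ : ℕ∞) φ → HasCompactSupport φ →
        tsupport φ ⊆ Γᶜ →
          ∫ X, ∑ i, (∑ j, A X i j * G X j) * fderiv ℝ φ X (EuclideanSpace.single i 1) = 0) →
      ∀ X ∉ Γ, u X = ∫ y, u y ∂(ω X))

    (C₁ : ℝ) (hC₁ : 0 < C₁) :
    ∃ C : ℝ, 0 < C ∧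
      ∀ x ∈ Γ, ∀ r : ℝ, 0 < r →
        ∀ A_B : EuclideanSpace ℝ (Fin n), A_B ∈ Γᶜ ∩ ball x r →
          ball A_B (C₁⁻¹ * r) ⊆ Γᶜ →
          ∀ E : Set (EuclideanSpace ℝ (Fin n)), MeasurableSet E → E ⊆ ball x r ∩ Γ →
            ∀ X ∉ Γ, X ∉ ball x (2 * r) →
              ENNReal.ofReal C⁻¹ * ω A_B E ≤ ω X E / ω X (Γ ∩ ball x r) ∧
              ω X E / ω X (Γ ∩ ball x r) ≤ ENNReal.ofReal C * ω A_B E := by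
  have hA : EM.AR n d C₀ Γ := ⟨hd₀, hd, hC₀, hclosed, hΓne, hAR⟩
  obtain ⟨b, hb, hq⟩ := EM.exForm hA hC₃ hell
  obtain ⟨C, hC, H⟩ := EM.final hA hb hprob (fun hg hgs => EM.exrep hA hb hq hprob hrepr hg hgs) (inv_pos.2 hC₁)
  exact ⟨C, hC, fun x hx r hr AB h1 h2 E _ hE X hX hX' => H x hx r hr AB h1 h2 E hE X hX hX'⟩
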